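/- For m > 14, the polytope P_m has a dissection strictly larger than every triangulation; moreover the gap 4m - 6 - (7m/2 + 1) between the maximal dissection size and the maximal triangulation size grows linearly in the number of vertices m+4. -/

import Mathlib

open Set MeasureTheory
open scoped Classical

noncomputable section

abbrev Pt3 := Fin 3 → ℝ

/-- A (geometric) tetrahedron: 4 affinely independent points. -/
def IsTet (σ : Finset Pt3) : Prop :=
  σ.card = 4 ∧ AffineIndependent ℝ (fun p : (σ : Set Pt3) => (p : Pt3))

/-- A dissection of the convex polytope `conv V` using only vertices in `V`:
tetrahedra with pairwise disjoint interiors covering the polytope. -/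
def IsDissection (V : Finset Pt3) (D : Finset (Finset Pt3)) : Prop :=
  (∀ σ ∈ D, IsTet σ ∧ (σ : Set Pt3) ⊆ (V : Set Pt3)) ∧
  (∀ σ ∈ D, ∀ τ ∈ D, σ ≠ τ →
    interior (convexHull ℝ (σ : Set Pt3)) ∩ interior (convexHull ℝ (τ : Set Pt3)) = ∅) ∧
  (⋃ σ ∈ D, convexHull ℝ (σ : Set Pt3)) = convexHull ℝ (V : Set Pt3)

/-- A triangulation: a dissection in which any two tetrahedra meet in a common
(possibly empty) face. -/
def IsTriangulation (V : Finset Pt3) (D : Finset (Finset Pt3)) : Prop :=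
  IsDissection V D ∧
  ∀ σ ∈ D, ∀ τ ∈ D,
    convexHull ℝ (σ : Set Pt3) ∩ convexHull ℝ (τ : Set Pt3)
      = convexHull ℝ ((σ ∩ τ : Finset Pt3) : Set Pt3)

/-- The vertex set of the standard regular `m`-gon in the plane `z = 0`. -/
def regPoly (m : ℕ) : Finset Pt3 :=
  (Finset.univ : Finset (Fin m)).image
    (fun k => ![Real.cos (2 * Real.pi * k.1 / m), Real.sin (2 * Real.pi * k.1 / m), 0])

/-- The hypotheses describing the polytope `P_m`: the convex hull of a regular
`m`-gon `Q_m` (m even) together with two orthogonal segments `v₁v₂` and `u₁u₂`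
parallel to the plane of `Q_m`, on opposite sides of it, each of the four
segments `vᵢuⱼ` crossing the relative interior of `Q_m`, and with `v₁v₂`, `u₁u₂`
not parallel to any edge or diagonal of `Q_m`. -/
def PmSetup (m : ℕ) (v₁ v₂ u₁ u₂ : Pt3) : Prop :=
  Even m ∧ 3 ≤ m ∧ v₁ ≠ v₂ ∧ u₁ ≠ u₂ ∧
  -- v₁v₂ parallel to the plane of Q_m, above it; u₁u₂ parallel, below it
  v₁ 2 = v₂ 2 ∧ 0 < v₁ 2 ∧ u₁ 2 = u₂ 2 ∧ u₁ 2 < 0 ∧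
  -- the two segments are orthogonal to each other
  ((v₂ 0 - v₁ 0) * (u₂ 0 - u₁ 0) + (v₂ 1 - v₁ 1) * (u₂ 1 - u₁ 1) = 0) ∧
  -- the four segments vᵢuⱼ intersect the relative interior of Q_m
  (∀ v ∈ ({v₁, v₂} : Set Pt3), ∀ u ∈ ({u₁, u₂} : Set Pt3),
    (openSegment ℝ v u ∩ intrinsicInterior ℝ (convexHull ℝ (regPoly m : Set Pt3))).Nonempty) ∧
  -- v₁v₂ and u₁u₂ are not parallel to any edge or diagonal of Q_m
  (∀ a ∈ regPoly m, ∀ b ∈ regPoly m, a ≠ b → ∀ t : ℝ,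
    v₂ - v₁ ≠ t • (b - a) ∧ u₂ - u₁ ≠ t • (b - a))

open Filter Topology


theorem tet_unique {σ : Finset Pt3} (hσ : IsTet σ) {w w' : Pt3 → ℝ}
    (h1 : ∑ p ∈ σ, w p = ∑ p ∈ σ, w' p) (h2 : ∑ p ∈ σ, w p • p = ∑ p ∈ σ, w' p • p) :
    ∀ p ∈ σ, w p = w' p := by
  intro p hp
  have := AffineIndependent.eq_zero_of_sum_eq_zero_subtype (s := σ) (w := fun p => w p - w' p) hσ.2
    (by simp [h1]) (by simp [sub_smul, h2]) p hp
  linarith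

def tetBasis {σ : Finset Pt3} (hσ : IsTet σ) : AffineBasis (σ : Set Pt3) ℝ Pt3 :=
  ⟨fun p => (p : Pt3), hσ.2, by
    rw [hσ.2.affineSpan_eq_top_iff_card_eq_finrank_add_one]
    simp [hσ.1]⟩

theorem tetBasis_apply {σ : Finset Pt3} (hσ : IsTet σ) (p : (σ : Set Pt3)) :
    tetBasis hσ p = (p : Pt3) := rfl

theorem tet_range {σ : Finset Pt3} (hσ : IsTet σ) : range (tetBasis hσ) = (σ : Set Pt3) := by
  ext x; constructor
  · rintro ⟨p, rfl⟩; exact p.2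
  · intro hx; exact ⟨⟨x, hx⟩, rfl⟩

/-- barycentric coordinate as a function on points -/
def bc {σ : Finset Pt3} (hσ : IsTet σ) (x : Pt3) (p : Pt3) : ℝ :=
  if h : p ∈ (σ : Set Pt3) then (tetBasis hσ).coord ⟨p, h⟩ x else 0

theorem bc_sum {σ : Finset Pt3} (hσ : IsTet σ) (x : Pt3) : ∑ p ∈ σ, bc hσ x p = 1 := by
  rw [← (tetBasis hσ).sum_coord_apply_eq_one x, ← Finset.sum_coe_sort]
  apply Finset.sum_congr rfl
  intro i _
  have := i.2
  simp [bc]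

theorem bc_comb {σ : Finset Pt3} (hσ : IsTet σ) (x : Pt3) : ∑ p ∈ σ, bc hσ x p • p = x := by
  conv_rhs => rw [← (tetBasis hσ).linear_combination_coord_eq_self x]
  rw [← Finset.sum_coe_sort]
  apply Finset.sum_congr rfl
  intro i _
  have := i.2
  simp [bc]
  rfl

theorem mem_interior_tet {σ : Finset Pt3} (hσ : IsTet σ) {x : Pt3} :
    x ∈ interior (convexHull ℝ (σ : Set Pt3)) ↔
      ∃ w : Pt3 → ℝ, (∀ p ∈ σ, 0 < w p) ∧ ∑ p ∈ σ, w p = 1 ∧ ∑ p ∈ σ, w p • p = x := by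
  have key : x ∈ interior (convexHull ℝ (σ : Set Pt3)) ↔ ∀ p ∈ σ, 0 < bc hσ x p := by
    rw [← tet_range hσ, AffineBasis.interior_convexHull]
    constructor
    · intro h p hp
      have := h ⟨p, hp⟩
      simpa [bc, hp] using this
    · intro h i
      have := h i i.2
      have h2 := i.2
      simpa [bc] using this
  rw [key]
  constructor
  · intro h
    exact ⟨bc hσ x, h, bc_sum hσ x, bc_comb hσ x⟩
  · rintro ⟨w, h0, h1, h2⟩ p hp
    have := tet_unique hσ (w := w) (w' := bc hσ x) (by rw [h1, bc_sum]) (by rw [h2, bc_comb]) p hp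
    rw [← this]; exact h0 p hp

theorem interior_tet_nonempty {σ : Finset Pt3} (hσ : IsTet σ) :
    (interior (convexHull ℝ (σ : Set Pt3))).Nonempty := by
  refine ⟨∑ p ∈ σ, (1/4 : ℝ) • p, (mem_interior_tet hσ).2 ⟨fun _ => 1/4, ?_, ?_, rfl⟩⟩
  · intros; norm_num
  · simp [hσ.1]

theorem interior_inter_conv {σ τ : Finset Pt3} (hτ : IsTet τ) {x : Pt3}
    (h1 : x ∈ interior (convexHull ℝ (σ : Set Pt3))) (h2 : x ∈ convexHull ℝ (τ : Set Pt3)) :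
    (interior (convexHull ℝ (σ : Set Pt3)) ∩ interior (convexHull ℝ (τ : Set Pt3))).Nonempty := by
  have h3 : x ∈ closure (interior (convexHull ℝ (τ : Set Pt3))) := by
    rw [(convex_convexHull ℝ _).closure_interior_eq_closure_of_nonempty_interior
      (interior_tet_nonempty hτ)]
    exact subset_closure h2
  exact mem_closure_iff.1 h3 _ isOpen_interior h1

/-- separation lemma -/
theorem sep_disjoint {σ τ : Finset Pt3} (hσ : IsTet σ) (G : Pt3 →ₗ[ℝ] ℝ) (c : ℝ)
    (h1 : ∀ p ∈ σ, G p ≤ c) (h2 : ∃ p ∈ σ, G p < c) (h3 : ∀ p ∈ τ, c ≤ G p) :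
    interior (convexHull ℝ (σ : Set Pt3)) ∩ interior (convexHull ℝ (τ : Set Pt3)) = ∅ := by
  rw [Set.eq_empty_iff_forall_notMem]
  rintro x ⟨hx, hx'⟩
  obtain ⟨w, w0, w1, rfl⟩ := (mem_interior_tet hσ).1 hx
  obtain ⟨w', w0', w1', h'⟩ := Finset.mem_convexHull'.1 (interior_subset hx')
  have a1 : G (∑ p ∈ σ, w p • p) < c := by
    rw [map_sum]
    calc ∑ p ∈ σ, G (w p • p) < ∑ p ∈ σ, w p * c := by
          apply Finset.sum_lt_sum
          · intro p hp
            simp only [map_smul, smul_eq_mul]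
            exact mul_le_mul_of_nonneg_left (h1 p hp) (w0 p hp).le
          · obtain ⟨p, hp, hc⟩ := h2
            refine ⟨p, hp, ?_⟩
            simp only [map_smul, smul_eq_mul]
            exact mul_lt_mul_of_pos_left hc (w0 p hp)
      _ = c := by rw [← Finset.sum_mul, w1, one_mul]
  have a2 : c ≤ G (∑ p ∈ τ, w' p • p) := by
    rw [map_sum]
    calc c = ∑ p ∈ τ, w' p * c := by rw [← Finset.sum_mul, w1', one_mul]
      _ ≤ _ := by
          apply Finset.sum_le_sum
          intro p hp
          simp only [map_smul, smul_eq_mul]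
          exact mul_le_mul_of_nonneg_left (h3 p hp) (w0' p hp)
  rw [h'] at a2
  linarith

/-- faces of triangulations -/
theorem face_ext {V : Finset Pt3} {T : Finset (Finset Pt3)} (hT : IsTriangulation V T)
    {σ τ : Finset Pt3} (hσ : σ ∈ T) (hτ : τ ∈ T) {x y z : Pt3}
    (hx : x ∈ convexHull ℝ (σ : Set Pt3)) (hy : y ∈ convexHull ℝ (σ : Set Pt3))
    (hz : z ∈ openSegment ℝ x y) (hzτ : z ∈ convexHull ℝ (τ : Set Pt3)) :
    x ∈ convexHull ℝ (τ : Set Pt3) ∧ y ∈ convexHull ℝ (τ : Set Pt3) := by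
  have hσt := (hT.1.1 σ hσ).1
  have key : ∀ x y : Pt3, x ∈ convexHull ℝ (σ : Set Pt3) → y ∈ convexHull ℝ (σ : Set Pt3) →
      z ∈ openSegment ℝ x y → x ∈ convexHull ℝ (τ : Set Pt3) := by
    intro x y hx hy hz
    have hzσ : z ∈ convexHull ℝ (σ : Set Pt3) :=
      (convex_convexHull ℝ _).openSegment_subset hx hy hz
    have hz2 : z ∈ convexHull ℝ ((σ ∩ τ : Finset Pt3) : Set Pt3) := by
      rw [← hT.2 σ hσ τ hτ]; exact ⟨hzσ, hzτ⟩
    obtain ⟨wx, x0, x1, rfl⟩ := Finset.mem_convexHull'.1 hx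
    obtain ⟨wy, y0, y1, rfl⟩ := Finset.mem_convexHull'.1 hy
    obtain ⟨wz, z0, z1, z2⟩ := Finset.mem_convexHull'.1 hz2
    obtain ⟨s, t, hs, ht, hst, hz3⟩ := hz
    have sub : σ ∩ τ ⊆ σ := Finset.inter_subset_left
    have e1 : ∑ p ∈ σ, (if p ∈ σ ∩ τ then wz p else 0) = 1 := by
      rw [← Finset.sum_filter, ← z1]
      congr 1; ext p; simp
    have e2 : ∑ p ∈ σ, (if p ∈ σ ∩ τ then wz p else 0) • p = z := by
      rw [← z2, ← Finset.sum_subset sub]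
      · apply Finset.sum_congr rfl; intro p hp; rw [if_pos hp]
      · intro p _ hp; rw [if_neg hp, zero_smul]
    have uq := tet_unique hσt (w := fun p => s * wx p + t * wy p)
      (w' := fun p => if p ∈ σ ∩ τ then wz p else 0)
      (by rw [e1, Finset.sum_add_distrib, ← Finset.mul_sum, ← Finset.mul_sum, x1, y1]; linarith)
      (by rw [e2, ← hz3]; simp only [add_smul, mul_smul, Finset.sum_add_distrib, Finset.smul_sum])
    have zero : ∀ p ∈ σ, p ∉ σ ∩ τ → wx p = 0 := by
      intro p hp hn
      have := uq p hp
      simp only [hn, if_false] at this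
      have h1 := x0 p hp
      have h2 := y0 p hp
      nlinarith [mul_nonneg hs.le h1, mul_nonneg ht.le h2]
    have : ∑ p ∈ σ, wx p • p ∈ convexHull ℝ ((σ ∩ τ : Finset Pt3) : Set Pt3) := by
      refine Finset.mem_convexHull'.2 ⟨wx, fun p hp => x0 p (sub hp), ?_, ?_⟩
      · rw [← x1]; exact Finset.sum_subset sub (fun p hp hn => zero p hp hn)
      · exact Finset.sum_subset sub (fun p hp hn => by rw [zero p hp hn, zero_smul])
    rw [← hT.2 σ hσ τ hτ] at this
    exact this.2
  exact ⟨key x y hx hy hz, key y x hy hx (by rwa [openSegment_symm])⟩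

theorem face_vertex {V : Finset Pt3} {T : Finset (Finset Pt3)} (hT : IsTriangulation V T)
    {σ τ : Finset Pt3} (hσ : σ ∈ T) (hτ : τ ∈ T) {p : Pt3} (hp : p ∈ σ)
    (hpτ : p ∈ convexHull ℝ (τ : Set Pt3)) : p ∈ τ := by
  have hσt := (hT.1.1 σ hσ).1
  have hz2 : p ∈ convexHull ℝ ((σ ∩ τ : Finset Pt3) : Set Pt3) := by
    rw [← hT.2 σ hσ τ hτ]; exact ⟨subset_convexHull ℝ _ hp, hpτ⟩
  obtain ⟨wz, z0, z1, z2⟩ := Finset.mem_convexHull'.1 hz2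
  have sub : σ ∩ τ ⊆ σ := Finset.inter_subset_left
  by_contra hn
  have hn' : p ∉ σ ∩ τ := fun h => hn (Finset.mem_inter.1 h).2
  have uq := tet_unique hσt (w := fun q => if q = p then 1 else 0)
      (w' := fun p => if p ∈ σ ∩ τ then wz p else 0)
      (by
        rw [← Finset.sum_filter (fun p => p ∈ σ ∩ τ)]
        have : σ.filter (fun p => p ∈ σ ∩ τ) = σ ∩ τ := by ext q; simp
        rw [this, z1]; simp [hp])
      (by
        have : ∑ p ∈ σ, (if p ∈ σ ∩ τ then wz p else 0) • p = p := by
          conv_rhs => rw [← z2]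
          rw [← Finset.sum_subset sub]
          · apply Finset.sum_congr rfl; intro p hp; rw [if_pos hp]
          · intro p _ hp; rw [if_neg hp, zero_smul]
        rw [this]; simp [ite_smul, hp]) p hp
  simp [hn] at uq

/-! explicit four-tuples -/
def Tet4 (a b c d : Pt3) : Prop := ∀ w x y z : ℝ, w + x + y + z = 0 →
  w • a + x • b + y • c + z • d = 0 → w = 0 ∧ x = 0 ∧ y = 0 ∧ z = 0

theorem Tet4.distinct {a b c d : Pt3} (h : Tet4 a b c d) :
    a ≠ b ∧ a ≠ c ∧ a ≠ d ∧ b ≠ c ∧ b ≠ d ∧ c ≠ d := by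
  refine ⟨?_, ?_, ?_, ?_, ?_, ?_⟩ <;> rintro rfl
  · have := h 1 (-1) 0 0 (by norm_num) (by simp); simp at this
  · have := h 1 0 (-1) 0 (by norm_num) (by simp); simp at this
  · have := h 1 0 0 (-1) (by norm_num) (by simp); simp at this
  · have := h 0 1 (-1) 0 (by norm_num) (by simp); simp at this
  · have := h 0 1 0 (-1) (by norm_num) (by simp); simp at this
  · have := h 0 0 1 (-1) (by norm_num) (by simp); simp at this

theorem sum_four {M : Type*} [AddCommMonoid M] {a b c d : Pt3} (F : Pt3 → M)
    (h : a ≠ b ∧ a ≠ c ∧ a ≠ d ∧ b ≠ c ∧ b ≠ d ∧ c ≠ d) :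
    ∑ p ∈ ({a, b, c, d} : Finset Pt3), F p = F a + F b + F c + F d := by
  obtain ⟨h1, h2, h3, h4, h5, h6⟩ := h
  rw [Finset.sum_insert (by simp [*]), Finset.sum_insert (by simp [*]),
    Finset.sum_insert (by simp [*]), Finset.sum_singleton]
  simp only [add_assoc]

theorem fun_four {a b c d : Pt3} (h : a ≠ b ∧ a ≠ c ∧ a ≠ d ∧ b ≠ c ∧ b ≠ d ∧ c ≠ d)
    (w x y z : ℝ) : ∃ F : Pt3 → ℝ, F a = w ∧ F b = x ∧ F c = y ∧ F d = z := by
  obtain ⟨h1, h2, h3, h4, h5, h6⟩ := h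
  refine ⟨fun p => if p = a then w else if p = b then x else if p = c then y else z, ?_⟩
  simp [h1.symm, h2.symm, h3.symm, h4.symm, h5.symm, h6.symm]

theorem IsTet.tet4 {a b c d : Pt3} (hσ : IsTet {a, b, c, d})
    (h : a ≠ b ∧ a ≠ c ∧ a ≠ d ∧ b ≠ c ∧ b ≠ d ∧ c ≠ d) : Tet4 a b c d := by
  intro w x y z h0 h1
  obtain ⟨F, rfl, rfl, rfl, rfl⟩ := fun_four h w x y z
  have := tet_unique hσ (w := F) (w' := fun _ => 0) (by rw [sum_four _ h, h0]; simp)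
    (by rw [sum_four _ h, h1]; simp)
  exact ⟨this a (by simp), this b (by simp), this c (by simp), this d (by simp)⟩

theorem Tet4.isTet {a b c d : Pt3} (h : Tet4 a b c d) : IsTet {a, b, c, d} := by
  have hd := h.distinct
  refine ⟨?_, ?_⟩
  · obtain ⟨h1, h2, h3, h4, h5, h6⟩ := hd
    rw [Finset.card_insert_of_notMem (by simp [*]), Finset.card_insert_of_notMem (by simp [*]),
      Finset.card_insert_of_notMem (by simp [*]), Finset.card_singleton]
  · rw [affineIndependent_iff]
    intro s w h1 h2 e he
    let F : Pt3 → ℝ := fun p => if hp : p ∈ (({a, b, c, d} : Finset Pt3) : Set Pt3) then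
      (if (⟨p, hp⟩ : ((({a, b, c, d} : Finset Pt3)) : Set Pt3)) ∈ s then w ⟨p, hp⟩ else 0) else 0
    have hF : ∀ i : ((({a, b, c, d} : Finset Pt3)) : Set Pt3), F i = if i ∈ s then w i else 0 := by
      intro i
      have := i.2
      simp only [F]
      rw [dif_pos this]
    have e1 : ∑ p ∈ ({a, b, c, d} : Finset Pt3), F p = 0 := by
      rw [← Finset.sum_coe_sort]
      have : ∑ i : ((({a, b, c, d} : Finset Pt3)) : Set Pt3), F i = 0 := by
        simp_rw [hF]
        rw [Finset.sum_ite_mem, Finset.univ_inter, h1]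
      exact this
    have e2 : ∑ p ∈ ({a, b, c, d} : Finset Pt3), F p • p = 0 := by
      rw [← Finset.sum_coe_sort]
      have : ∑ i : ((({a, b, c, d} : Finset Pt3)) : Set Pt3), F i • (i : Pt3) = 0 := by
        simp_rw [hF, ite_smul, zero_smul]
        rw [Finset.sum_ite_mem, Finset.univ_inter, h2]
      exact this
    rw [sum_four _ hd] at e1 e2
    have := h _ _ _ _ e1 e2
    have h3 := hF e
    rw [if_pos he] at h3
    rw [← h3]
    have h4 := e.2
    simp only [Finset.coe_insert, Finset.coe_singleton, Set.mem_insert_iff,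
      Set.mem_singleton_iff] at h4
    rcases h4 with h4 | h4 | h4 | h4 <;> rw [h4] <;> tauto

theorem Tet4.mem_interior {a b c d : Pt3} (h : Tet4 a b c d) {w x y z : ℝ} (hw : 0 < w)
    (hx : 0 < x) (hy : 0 < y) (hz : 0 < z) (h1 : w + x + y + z = 1) :
    w • a + x • b + y • c + z • d ∈
      interior (convexHull ℝ (({a, b, c, d} : Finset Pt3) : Set Pt3)) := by
  obtain ⟨F, rfl, rfl, rfl, rfl⟩ := fun_four h.distinct w x y z
  refine (mem_interior_tet h.isTet).2 ⟨F, ?_, ?_, ?_⟩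
  · intro p hp
    simp only [Finset.mem_insert, Finset.mem_singleton] at hp
    rcases hp with rfl | rfl | rfl | rfl <;> assumption
  · rw [sum_four _ h.distinct, h1]
  · rw [sum_four _ h.distinct]

theorem mem_conv_four {a b c d : Pt3} {w x y z : ℝ} (hw : 0 ≤ w)
    (hx : 0 ≤ x) (hy : 0 ≤ y) (hz : 0 ≤ z) (h1 : w + x + y + z = 1) :
    w • a + x • b + y • c + z • d ∈ convexHull ℝ (({a, b, c, d} : Finset Pt3) : Set Pt3) := by
  have hc := convex_convexHull ℝ (({a, b, c, d} : Finset Pt3) : Set Pt3)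
  have := hc.sum_mem (t := Finset.univ) (w := ![w, x, y, z]) (z := ![a, b, c, d])
    (by intro i _; fin_cases i <;> simpa) (by simp [Fin.sum_univ_four, h1])
    (by intro i _; apply subset_convexHull; fin_cases i <;> simp)
  simpa [Fin.sum_univ_four] using this

theorem Tet4.conv_weights {a b c d : Pt3} (h : Tet4 a b c d) {p : Pt3}
    (hp : p ∈ convexHull ℝ (({a, b, c, d} : Finset Pt3) : Set Pt3)) :
    ∃ w x y z : ℝ, 0 ≤ w ∧ 0 ≤ x ∧ 0 ≤ y ∧ 0 ≤ z ∧ w + x + y + z = 1 ∧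
      p = w • a + x • b + y • c + z • d := by
  obtain ⟨F, h0, h1, h2⟩ := Finset.mem_convexHull'.1 hp
  rw [sum_four _ h.distinct] at h1 h2
  exact ⟨F a, F b, F c, F d, h0 _ (by simp), h0 _ (by simp), h0 _ (by simp), h0 _ (by simp),
    h1, h2.symm⟩

theorem Tet4.span {a b c d : Pt3} (h : Tet4 a b c d) (e : Pt3) :
    ∃ w x y z : ℝ, w + x + y + z = 0 ∧ w • a + x • b + y • c + z • d = e := by
  have h1 := bc_sum h.isTet (e + a)
  have h2 := bc_comb h.isTet (e + a)
  rw [sum_four _ h.distinct] at h1 h2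
  refine ⟨bc h.isTet (e + a) a - 1, bc h.isTet (e + a) b, bc h.isTet (e + a) c,
    bc h.isTet (e + a) d, by linarith, ?_⟩
  rw [sub_smul, one_smul]
  rw [← sub_eq_zero, ← sub_eq_zero.2 h2]
  abel

theorem eventually_pos_aux {x w : ℝ} (h : 0 < x ∨ (x = 0 ∧ 0 < w)) :
    ∀ᶠ η in 𝓝[>] (0:ℝ), 0 < x + η * w := by
  rcases h with h | ⟨rfl, h⟩
  · have : Tendsto (fun η : ℝ => x + η * w) (𝓝[>] 0) (𝓝 (x + 0 * w)) :=
      (Continuous.tendsto (by fun_prop) 0).mono_left nhdsWithin_le_nhds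
    exact this.eventually (lt_mem_nhds (by simpa using h))
  · filter_upwards [self_mem_nhdsWithin] with η hη
    have : 0 < η := hη
    simpa using mul_pos this h

theorem Tet4.cone {a b c d : Pt3} (h : Tet4 a b c d) {p e : Pt3} {x1 x2 x3 x4 w1 w2 w3 w4 : ℝ}
    (hs : x1 + x2 + x3 + x4 = 1) (hp : p = x1 • a + x2 • b + x3 • c + x4 • d)
    (ws : w1 + w2 + w3 + w4 = 0) (he : w1 • a + w2 • b + w3 • c + w4 • d = e)
    (h1 : 0 < x1 ∨ (x1 = 0 ∧ 0 < w1)) (h2 : 0 < x2 ∨ (x2 = 0 ∧ 0 < w2))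
    (h3 : 0 < x3 ∨ (x3 = 0 ∧ 0 < w3)) (h4 : 0 < x4 ∨ (x4 = 0 ∧ 0 < w4)) :
    ∀ᶠ η in 𝓝[>] (0:ℝ), p + η • e ∈
      interior (convexHull ℝ (({a, b, c, d} : Finset Pt3) : Set Pt3)) := by
  filter_upwards [eventually_pos_aux h1, eventually_pos_aux h2, eventually_pos_aux h3,
    eventually_pos_aux h4] with η g1 g2 g3 g4
  have := h.mem_interior g1 g2 g3 g4 (by linear_combination hs + η * ws)
  convert this using 1
  rw [hp, ← he]
  module

theorem card_four_pair {σ : Finset Pt3} (h : σ.card = 4) {a b : Pt3} (ha : a ∈ σ) (hb : b ∈ σ)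
    (hab : a ≠ b) : ∃ c d, σ = {a, b, c, d} ∧ a ≠ c ∧ a ≠ d ∧ b ≠ c ∧ b ≠ d ∧ c ≠ d := by
  have h2 : ((σ.erase a).erase b).card = 2 := by
    rw [Finset.card_erase_of_mem (by simp [hb, hab.symm]), Finset.card_erase_of_mem ha, h]
  obtain ⟨c, d, hcd, e⟩ := Finset.card_eq_two.1 h2
  have hc : c ∈ (σ.erase a).erase b := by rw [e]; simp
  have hd : d ∈ (σ.erase a).erase b := by rw [e]; simp
  simp only [Finset.mem_erase] at hc hd
  refine ⟨c, d, ?_, Ne.symm hc.2.1, Ne.symm hd.2.1, Ne.symm hc.1, Ne.symm hd.1, hcd⟩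
  rw [← e, Finset.insert_erase (by simp [hb, hab.symm]), Finset.insert_erase ha]

theorem tet_pair {σ : Finset Pt3} (h : IsTet σ) {a b : Pt3} (ha : a ∈ σ) (hb : b ∈ σ)
    (hab : a ≠ b) : ∃ c d, σ = {a, b, c, d} ∧ Tet4 a b c d := by
  obtain ⟨c, d, rfl, h'⟩ := card_four_pair h.1 ha hb hab
  exact ⟨c, d, rfl, h.tet4 ⟨hab, h'⟩⟩

theorem tet_single {σ : Finset Pt3} (h : IsTet σ) {a : Pt3} (ha : a ∈ σ) :
    ∃ b c d, σ = {a, b, c, d} ∧ Tet4 a b c d := by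
  have : ∃ b ∈ σ, b ≠ a := Finset.exists_mem_ne (by rw [h.1]; norm_num) a
  obtain ⟨b, hb, hba⟩ := this
  obtain ⟨c, d, h1, h2⟩ := tet_pair h ha hb hba.symm
  exact ⟨b, c, d, h1, h2⟩


/-- A linear coordinate frame on space. -/
structure Frame where
  X : Pt3 →ₗ[ℝ] ℝ
  Y : Pt3 →ₗ[ℝ] ℝ
  Z : Pt3 →ₗ[ℝ] ℝ
  inj : ∀ p q, X p = X q → Y p = Y q → Z p = Z q → p = q
  surj : ∀ x y z, ∃ p, X p = x ∧ Y p = y ∧ Z p = z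

namespace Frame
variable (F : Frame)

def mk' (x y z : ℝ) : Pt3 := (F.surj x y z).choose
@[simp] theorem X_mk (x y z : ℝ) : F.X (F.mk' x y z) = x := (F.surj x y z).choose_spec.1
@[simp] theorem Y_mk (x y z : ℝ) : F.Y (F.mk' x y z) = y := (F.surj x y z).choose_spec.2.1
@[simp] theorem Z_mk (x y z : ℝ) : F.Z (F.mk' x y z) = z := (F.surj x y z).choose_spec.2.2

def e : Pt3 := F.mk' 0 0 1

/-- planar determinant -/
def det (p q : Pt3) : ℝ := F.X p * F.Y q - F.Y p * F.X q

theorem planar_par {d w : Pt3} (hd : F.Z d = 0) (hw : F.Z w = 0) (hd0 : d ≠ 0)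
    (h : F.det d w = 0) : ∃ l : ℝ, w = l • d := by
  unfold det at h
  have hn : F.X d ^ 2 + F.Y d ^ 2 ≠ 0 := by
    intro hh
    apply hd0
    have h1 : F.X d = 0 := by nlinarith [sq_nonneg (F.X d), sq_nonneg (F.Y d)]
    have h2 : F.Y d = 0 := by nlinarith [sq_nonneg (F.X d), sq_nonneg (F.Y d)]
    apply F.inj <;> simp [*]
  refine ⟨(F.X d * F.X w + F.Y d * F.Y w) / (F.X d ^ 2 + F.Y d ^ 2), F.inj _ _ ?_ ?_ ?_⟩
  · simp only [map_smul, smul_eq_mul]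
    field_simp
    linear_combination -F.Y d * h
  · simp only [map_smul, smul_eq_mul]
    field_simp
    linear_combination F.X d * h
  · simp [hd, hw]

def Lab (σ : Finset Pt3) (B g : Pt3) : Prop :=
  ∀ᶠ ε in 𝓝[>] (0:ℝ), ∀ᶠ η in 𝓝[>] (0:ℝ),
    B + ε • g + η • F.e ∈ interior (convexHull ℝ (σ : Set Pt3))

theorem Lab.meet {F : Frame} {σ τ : Finset Pt3} {B g : Pt3} (h1 : F.Lab σ B g) (h2 : F.Lab τ B g) :
    (interior (convexHull ℝ (σ : Set Pt3)) ∩ interior (convexHull ℝ (τ : Set Pt3))).Nonempty := by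
  obtain ⟨ε, h⟩ := (h1.and h2).exists
  obtain ⟨η, h⟩ := (h.1.and h.2).exists
  exact ⟨_, h⟩

/-- σ contains a planar triangle (or points just above it) -/
def Slice (σ : Finset Pt3) (A B C : Pt3) : Prop :=
  F.Z A = 0 ∧ F.Z B = 0 ∧ F.Z C = 0 ∧ F.det (B - A) (C - A) ≠ 0 ∧
  ∀ a b c : ℝ, 0 < a → 0 < b → 0 < c → a + b + c = 1 → ∀ᶠ η in 𝓝[>] (0:ℝ),
    a • A + b • B + c • C + η • F.e ∈ interior (convexHull ℝ (σ : Set Pt3))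

theorem Slice.rot {F : Frame} {σ : Finset Pt3} {A B C : Pt3} (h : F.Slice σ A B C) :
    F.Slice σ B C A := by
  obtain ⟨h1, h2, h3, h4, h5⟩ := h
  refine ⟨h2, h3, h1, ?_, ?_⟩
  · intro h; apply h4; simp only [det, map_sub] at h ⊢; linear_combination h
  · intro a b c ha hb hc hs
    convert h5 c a b hc ha hb (by linarith) using 4
    abel

theorem Slice.swap {F : Frame} {σ : Finset Pt3} {A B C : Pt3} (h : F.Slice σ A B C) :
    F.Slice σ B A C := by
  obtain ⟨h1, h2, h3, h4, h5⟩ := h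
  refine ⟨h2, h1, h3, ?_, ?_⟩
  · intro h; apply h4; simp only [det, map_sub] at h ⊢; linear_combination -h
  · intro a b c ha hb hc hs
    convert h5 b a c hb ha hc (by linarith) using 4
    abel

theorem Slice.lab {F : Frame} {σ : Finset Pt3} {A B C d : Pt3} (h : F.Slice σ A B C)
    (hd : F.Z d = 0) (h1 : F.det d A < F.det d B) (h2 : F.det d B < F.det d C) :
    ∃ g, (g = d ∨ g = -d) ∧ F.Lab σ B g ∧ ∃ ε : ℝ, 0 < ε ∧ B + ε • g ∈ openSegment ℝ A C := by
  obtain ⟨zA, zB, zC, hdet, hw⟩ := h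
  have hd0 : d ≠ 0 := by
    rintro rfl; simp [det] at h1
  set fA := F.det d A
  set fB := F.det d B
  set fC := F.det d C
  have hAC : 0 < fC - fA := by linarith
  set t := (fB - fA) / (fC - fA) with ht
  have ht0 : 0 < t := div_pos (by linarith) hAC
  have ht1 : t < 1 := by rw [ht, div_lt_one hAC]; linarith
  have hte : t * (fC - fA) = fB - fA := by rw [ht]; field_simp
  obtain ⟨l, hl⟩ := F.planar_par (d := d) (w := (1 - t) • A + t • C - B) hd
    (by simp [zA, zB, zC]) hd0 (by
      have e1 : F.det d ((1 - t) • A + t • C - B) = (1 - t) * fA + t * fC - fB := by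
        simp only [det, map_add, map_sub, map_smul, smul_eq_mul, fA, fB, fC]; ring
      rw [e1]; linarith)
  have hl0 : l ≠ 0 := by
    rintro rfl
    rw [zero_smul, sub_eq_zero] at hl
    apply hdet
    rw [← hl]
    simp only [det, map_add, map_sub, map_smul, smul_eq_mul]; ring
  have key : ∀ g : Pt3, ∀ k : ℝ, 0 < k → (1 - t) • A + t • C - B = k • g →
      F.Lab σ B g ∧ ∃ ε : ℝ, 0 < ε ∧ B + ε • g ∈ openSegment ℝ A C := by
    intro g k hk hg
    refine ⟨?_, k, hk, ?_⟩
    · have : ∀ᶠ ε in 𝓝[>] (0:ℝ), ε < k := mem_nhdsWithin_of_mem_nhds (Iio_mem_nhds hk)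
      filter_upwards [this, self_mem_nhdsWithin] with ε h1 h2
      have h2 : 0 < ε := h2
      have h3 : 0 < ε / k := div_pos h2 hk
      have h4 : ε / k < 1 := by rwa [div_lt_one hk]
      have := hw ((ε / k) * (1 - t)) (1 - ε / k) ((ε / k) * t) (mul_pos h3 (by linarith))
        (by linarith) (mul_pos h3 ht0) (by ring)
      filter_upwards [this] with η hη
      convert hη using 1
      have : ε • g = (ε / k) • (k • g) := by rw [smul_smul]; congr 1; field_simp
      rw [this, ← hg]
      module
    · rw [← hg]
      refine ⟨1 - t, t, by linarith, ht0, by ring, by abel⟩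
  rcases lt_or_gt_of_ne hl0 with h | h
  · exact ⟨-d, Or.inr rfl, key (-d) (-l) (by linarith) (by rw [hl]; module)⟩
  · exact ⟨d, Or.inl rfl, key d l h hl⟩

/-- counting lemma -/
theorem count_lab {F : Frame} {S Pe : Finset Pt3} {d : Pt3} (hd : F.Z d = 0)
    (hext : ∀ q ∈ S, ∀ w : Pt3, w ≠ 0 → q + w ∈ convexHull ℝ (S : Set Pt3) →
      q - w ∈ convexHull ℝ (S : Set Pt3) → False)
    (Fam : Finset (Finset Pt3))
    (hdis : ∀ σ ∈ Fam, ∀ τ ∈ Fam, σ ≠ τ →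
      interior (convexHull ℝ (σ : Set Pt3)) ∩ interior (convexHull ℝ (τ : Set Pt3)) = ∅)
    (hfam : ∀ σ ∈ Fam, ∃ A B C, F.Slice σ A B C ∧ A ∈ convexHull ℝ (S : Set Pt3) ∧
      C ∈ convexHull ℝ (S : Set Pt3) ∧ F.det d A < F.det d B ∧ F.det d B < F.det d C ∧
      (B ∈ S ∨ B ∈ Pe)) :
    Fam.card ≤ S.card - 2 + 2 * Pe.card := by
  have hd0 : Fam.Nonempty → d ≠ 0 := by
    rintro ⟨σ, hσ⟩ rfl
    obtain ⟨A, B, C, -, -, -, h, -⟩ := hfam σ hσ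
    simp [det] at h
  have hfam2 : ∀ σ ∈ Fam, ∃ B g, (g = d ∨ g = -d) ∧ F.Lab σ B g ∧
      (∃ ε : ℝ, 0 < ε ∧ B + ε • g ∈ convexHull ℝ (S : Set Pt3)) ∧ (B ∈ S ∨ B ∈ Pe) ∧
      (∃ q ∈ S, F.det d q < F.det d B) ∧ (∃ q ∈ S, F.det d B < F.det d q) := by
    intro σ hσ
    obtain ⟨A, B, C, hs, hA, hC, h1, h2, hB⟩ := hfam σ hσ
    obtain ⟨g, hg, hL, ε, hε, hm⟩ := hs.lab hd h1 h2
    let f : Pt3 →ₗ[ℝ] ℝ := F.X d • F.Y - F.Y d • F.X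
    have hf : ∀ p, f p = F.det d p := by intro p; simp [f, det]
    refine ⟨B, g, hg, hL, ⟨ε, hε, (convex_convexHull ℝ _).openSegment_subset hA hC hm⟩, hB, ?_, ?_⟩
    · by_contra hn
      push Not at hn
      have : convexHull ℝ (S : Set Pt3) ⊆ {p | F.det d B ≤ f p} :=
        convexHull_min (fun q hq => by simpa [hf] using hn q hq) (convex_halfSpace_ge f.isLinear _)
      have := this hA
      simp only [mem_ofPred_eq, hf] at this
      linarith
    · by_contra hn
      push Not at hn
      have : convexHull ℝ (S : Set Pt3) ⊆ {p | f p ≤ F.det d B} :=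
        convexHull_min (fun q hq => by simpa [hf] using hn q hq) (convex_halfSpace_le f.isLinear _)
      have := this hC
      simp only [mem_ofPred_eq, hf] at this
      linarith
  choose! Bf gf hg hL hin hmem hlo hhi using hfam2
  have inj : ∀ σ ∈ Fam, ∀ τ ∈ Fam, Bf σ = Bf τ → gf σ = gf τ → σ = τ := by
    intro σ hσ τ hτ h1 h2
    by_contra hne
    have h3 := hL τ hτ
    rw [← h1, ← h2] at h3
    exact ((hL σ hσ).meet h3).ne_empty (hdis σ hσ τ hτ hne)
  have c1 : (Fam.filter (fun σ => Bf σ ∈ S)).card ≤ S.card - 2 := by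
    rcases (Fam.filter (fun σ => Bf σ ∈ S)).eq_empty_or_nonempty with h0 | ⟨σ0, h0⟩
    · rw [h0]; simp
    rw [Finset.mem_filter] at h0
    have hne : S.Nonempty := ⟨_, h0.2⟩
    obtain ⟨q1, hq1, hmin⟩ := S.exists_min_image (F.det d) hne
    obtain ⟨q2, hq2, hmax⟩ := S.exists_max_image (F.det d) hne
    have hlt : F.det d q1 < F.det d q2 := by
      obtain ⟨q, hq, h⟩ := hlo _ h0.1
      have := hmin q hq
      have := hmax _ h0.2
      linarith
    have hcard : ((S.erase q1).erase q2).card = S.card - 2 := by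
      rw [Finset.card_erase_of_mem, Finset.card_erase_of_mem hq1]; rfl
      rw [Finset.mem_erase]; exact ⟨by rintro rfl; simp at hlt, hq2⟩
    rw [← hcard]
    apply Finset.card_le_card_of_injOn Bf
    · intro σ hσ
      simp only [Finset.coe_filter, mem_ofPred_eq] at hσ
      simp only [Finset.coe_erase, Set.mem_sdiff, mem_singleton_iff]
      refine ⟨⟨hσ.2, ?_⟩, ?_⟩
      · intro h
        obtain ⟨q, hq, h'⟩ := hlo _ hσ.1
        rw [h] at h'
        linarith [hmin q hq]
      · intro h
        obtain ⟨q, hq, h'⟩ := hhi _ hσ.1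
        rw [h] at h'
        linarith [hmax q hq]
    · intro σ hσ τ hτ h
      simp only [Finset.coe_filter, mem_ofPred_eq] at hσ hτ
      apply inj σ hσ.1 τ hτ.1 h
      by_contra hne
      have hopp : gf τ = - gf σ := by
        rcases hg σ hσ.1 with h1 | h1 <;> rcases hg τ hτ.1 with h2 | h2
        · exact absurd (h1.trans h2.symm) hne
        · rw [h1, h2]
        · rw [h1, h2, neg_neg]
        · exact absurd (h1.trans h2.symm) hne
      have hgne : gf σ ≠ 0 := by
        have := hd0 ⟨σ, hσ.1⟩
        rcases hg σ hσ.1 with h1 | h1 <;> rw [h1] <;> simpa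
      obtain ⟨ε1, e1, k1⟩ := hin σ hσ.1
      obtain ⟨ε2, e2, k2⟩ := hin τ hτ.1
      rw [← h, hopp] at k2
      have hB : Bf σ ∈ convexHull ℝ (S : Set Pt3) := subset_convexHull ℝ _ hσ.2
      have scale : ∀ g : Pt3, ∀ a b : ℝ, 0 < a → a ≤ b → Bf σ + b • g ∈ convexHull ℝ (S : Set Pt3) →
          Bf σ + a • g ∈ convexHull ℝ (S : Set Pt3) := by
        intro g a b ha hab hm
        have hb : 0 < b := by linarith
        have := (convex_convexHull ℝ (S : Set Pt3)).add_smul_sub_mem hB hm (t := a / b)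
          ⟨by positivity, by rw [div_le_one hb]; exact hab⟩
        convert this using 2
        rw [add_sub_cancel_left, smul_smul]; congr 1; field_simp
      refine hext (Bf σ) hσ.2 (min ε1 ε2 • gf σ) ?_ (scale _ _ ε1 (by positivity) (by simp) k1) ?_
      · exact smul_ne_zero (by positivity) hgne
      · have := scale _ _ ε2 (lt_min e1 e2) (min_le_right _ _) k2
        rwa [smul_neg, ← sub_eq_add_neg] at this
  have c2 : (Fam.filter (fun σ => ¬ Bf σ ∈ S)).card ≤ 2 * Pe.card := by
    have : (Pe ×ˢ ({d, -d} : Finset Pt3)).card ≤ 2 * Pe.card := by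
      rw [Finset.card_product, mul_comm]
      exact Nat.mul_le_mul_right _ Finset.card_le_two
    refine le_trans ?_ this
    apply Finset.card_le_card_of_injOn (fun σ => (Bf σ, gf σ))
    · intro σ hσ
      simp only [Finset.coe_filter, mem_ofPred_eq] at hσ
      simp only [Finset.coe_product, mem_prod, Finset.mem_coe]
      refine ⟨(hmem σ hσ.1).resolve_left hσ.2, by simpa using hg σ hσ.1⟩
    · intro σ hσ τ hτ h
      simp only [Finset.coe_filter, mem_ofPred_eq] at hσ hτ
      simp only [Prod.mk.injEq] at h
      exact inj σ hσ.1 τ hτ.1 h.1 h.2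
  rw [← Finset.card_filter_add_card_filter_not (s := Fam) (fun σ => Bf σ ∈ S)]
  omega

/-- generic direction -/
theorem generic_dir {F : Frame} {q A C : Pt3} (hq : F.Z q = 0) (hA : F.Z A = 0) (hC : F.Z C = 0)
    (hdet : F.det (A - q) (C - q) ≠ 0) (N : Finset Pt3) (hN : ∀ w ∈ N, F.Z w = 0) :
    ∃ t : ℝ, 0 < t ∧ t < 1 ∧ ∀ w ∈ N, w ≠ 0 → F.det ((1 - t) • A + t • C - q) w ≠ 0 := by
  have fin : (⋃ w ∈ (N : Set Pt3), {t : ℝ | w ≠ 0 ∧ F.det ((1 - t) • A + t • C - q) w = 0}).Finite := by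
    refine Set.Finite.biUnion N.finite_toSet ?_
    intro w hw
    apply Set.Subsingleton.finite
    rintro s ⟨hw0, hs⟩ t ⟨-, ht⟩
    by_contra hne
    have e1 : F.det (C - A) w = 0 := by
      have : (s - t) * F.det (C - A) w = 0 := by
        simp only [det, map_add, map_sub, map_smul, smul_eq_mul] at hs ht ⊢
        linear_combination hs - ht
      exact (mul_eq_zero.1 this).resolve_left (sub_ne_zero.2 hne)
    have e2 : F.det (A - q) w = 0 := by
      simp only [det, map_add, map_sub, map_smul, smul_eq_mul] at hs e1 ⊢
      linear_combination hs - s * e1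
    obtain ⟨a, ha⟩ := F.planar_par (d := w) (w := C - A) (hN w hw) (by simp [hA, hC]) hw0
      (by simp only [det] at e1 ⊢; linear_combination -e1)
    obtain ⟨b, hb⟩ := F.planar_par (d := w) (w := A - q) (hN w hw) (by simp [hA, hq]) hw0
      (by simp only [det] at e2 ⊢; linear_combination -e2)
    apply hdet
    have : C - q = (a + b) • w := by rw [add_smul, ← ha, ← hb]; abel
    rw [this, hb]
    simp only [det, map_smul, smul_eq_mul]; ring
  have inf : (Ioo (0:ℝ) 1).Infinite := Ioo_infinite one_pos
  obtain ⟨t, ht, hn⟩ := (inf.sdiff fin).nonempty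
  refine ⟨t, ht.1, ht.2, fun w hw hw0 h => hn ?_⟩
  simp only [mem_iUnion]
  exact ⟨w, hw, hw0, h⟩

/-- sort a generic slice -/
theorem Slice.sort {F : Frame} {σ : Finset Pt3} {A B C d : Pt3} (h : F.Slice σ A B C)
    (K : Set Pt3) (hA : A ∈ K) (hB : B ∈ K) (hC : C ∈ K)
    (h1 : F.det d (A - B) ≠ 0) (h2 : F.det d (B - C) ≠ 0) (h3 : F.det d (A - C) ≠ 0) :
    ∃ A B C, F.Slice σ A B C ∧ A ∈ K ∧ B ∈ K ∧ C ∈ K ∧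
      F.det d A < F.det d B ∧ F.det d B < F.det d C := by
  have e : ∀ p q, F.det d (p - q) = F.det d p - F.det d q := by
    intro p q; simp only [det, map_sub]; ring
  rw [e, sub_ne_zero] at h1 h2 h3
  rcases lt_or_gt_of_ne h1 with g1 | g1 <;> rcases lt_or_gt_of_ne h2 with g2 | g2 <;>
    rcases lt_or_gt_of_ne h3 with g3 | g3
  · exact ⟨A, B, C, h, hA, hB, hC, g1, g2⟩
  · linarith
  · exact ⟨A, C, B, h.swap.rot, hA, hC, hB, g3, g2⟩
  · exact ⟨C, A, B, h.rot.rot, hC, hA, hB, g3, g1⟩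
  · exact ⟨B, A, C, h.swap, hB, hA, hC, g1, g3⟩
  · exact ⟨B, C, A, h.rot, hB, hC, hA, g2, g3⟩
  · linarith
  · exact ⟨C, B, A, h.rot.swap, hC, hB, hA, g2, g1⟩

end Frame


/-- angles of the polygon vertices, ordered by decreasing height -/
def alpha (m : ℕ) (δ : ℝ) (i : ℕ) : ℝ :=
  if Even i then Real.pi * i / m + δ else Real.pi * (i + 1) / m - δ

structure Cfg (m : ℕ) (S : Finset Pt3) (v1 v2 u1 u2 : Pt3) extends Frame where
  even : Even m
  h16 : 16 ≤ m
  δ : ℝ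
  δpos : 0 < δ
  δlt : δ < Real.pi / m
  hS : S = (Finset.range m).image
    (fun i => toFrame.mk' ((-1) ^ i * Real.sin (alpha m δ i)) (Real.cos (alpha m δ i)) 0)
  h : ℝ
  k : ℝ
  hpos : 0 < h
  kpos : 0 < k
  zv1 : Z v1 = h
  zv2 : Z v2 = h
  zu1 : Z u1 = -k
  zu2 : Z u2 = -k
  yv : Y v1 = Y v2
  xv : X v1 < X v2
  hp : ∀ v, (v = v1 ∨ v = v2) → ∀ u, (u = u1 ∨ u = u2) →
    (k / (h + k)) • v + (h / (h + k)) • u ∈ convexHull ℝ (S : Set Pt3)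

namespace Cfg
variable {m : ℕ} {S : Finset Pt3} {v1 v2 u1 u2 : Pt3} (c : Cfg m S v1 v2 u1 u2)

def α (i : ℕ) : ℝ := alpha m c.δ i

def P (i : ℕ) : Pt3 := c.mk' ((-1) ^ i * Real.sin (c.α i)) (Real.cos (c.α i)) 0

theorem S_eq : S = (Finset.range m).image c.P := c.hS

@[simp] theorem PX (i : ℕ) : c.X (c.P i) = (-1) ^ i * Real.sin (c.α i) := by simp [P]
@[simp] theorem PY (i : ℕ) : c.Y (c.P i) = Real.cos (c.α i) := by simp [P]
@[simp] theorem PZ (i : ℕ) : c.Z (c.P i) = 0 := by simp [P]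

theorem mpos (c : Cfg m S v1 v2 u1 u2) : (0:ℝ) < m := by
  have := c.h16
  exact_mod_cast (by omega : 0 < m)

theorem memS {p : Pt3} : p ∈ S ↔ ∃ i < m, c.P i = p := by
  constructor
  · intro h
    rw [c.S_eq] at h
    simpa using h
  · rintro ⟨i, hi, rfl⟩
    have : c.P i ∈ (Finset.range m).image c.P := Finset.mem_image_of_mem _ (by simpa)
    rwa [← c.S_eq] at this

theorem P_mem {i : ℕ} (hi : i < m) : c.P i ∈ S := c.memS.2 ⟨i, hi, rfl⟩

theorem α_mono : StrictMono c.α := by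
  apply strictMono_nat_of_lt_succ
  intro i
  have hm := c.mpos
  have h1 := c.δpos
  have h2 := c.δlt
  have e : Real.pi * ((i:ℝ) + 1 + 1) / m = Real.pi * i / m + 2 * (Real.pi / m) := by
    field_simp; ring
  unfold α alpha
  rcases Nat.even_or_odd i with hi | hi
  · have : ¬ Even (i + 1) := by simpa [Nat.even_add_one] using hi
    rw [if_pos hi, if_neg this]
    push_cast
    rw [e]
    linarith
  · have hi' : ¬ Even i := by simpa using hi
    have : Even (i + 1) := by simpa [Nat.even_add_one] using hi
    rw [if_neg hi', if_pos this]
    push_cast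
    linarith

theorem α_pos (i : ℕ) : 0 < c.α i := by
  have : c.α 0 = c.δ := by simp [α, alpha]
  have h := c.α_mono.monotone (Nat.zero_le i)
  have := c.δpos
  linarith

theorem α_symm {i : ℕ} (hi : i < m) : c.α (m - 1 - i) = Real.pi - c.α i := by
  have hm := c.mpos
  have he := c.even
  have h1 : ((m - 1 - i : ℕ) : ℝ) = m - 1 - i := by
    rw [Nat.cast_sub (by omega), Nat.cast_sub (by omega)]; simp
  unfold α alpha
  rcases Nat.even_or_odd i with hi' | hi'
  · have : ¬ Even (m - 1 - i) := by
      rw [Nat.not_even_iff_odd]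
      obtain ⟨a, ha⟩ := he
      obtain ⟨b, hb⟩ := hi'
      exact ⟨a - b - 1, by omega⟩
    rw [if_pos hi', if_neg this, h1]
    field_simp; ring
  · have : Even (m - 1 - i) := by
      obtain ⟨a, ha⟩ := he
      obtain ⟨b, hb⟩ := hi'
      exact ⟨a - b - 1, by omega⟩
    have h2 : ¬ Even i := by simpa using hi'
    rw [if_neg h2, if_pos this, h1]
    field_simp; ring

theorem α_lt {i : ℕ} (hi : i < m) : c.α i < Real.pi := by
  have := c.α_symm hi
  have := c.α_pos (m - 1 - i)
  linarith

theorem sin_pos {i : ℕ} (hi : i < m) : 0 < Real.sin (c.α i) :=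
  Real.sin_pos_of_pos_of_lt_pi (c.α_pos i) (c.α_lt hi)

theorem Y_lt {i j : ℕ} (hij : i < j) (hj : j < m) : c.Y (c.P j) < c.Y (c.P i) := by
  rw [PY, PY]
  exact Real.cos_lt_cos_of_nonneg_of_le_pi (c.α_pos i).le (c.α_lt hj).le (c.α_mono hij)

theorem Y_le {i j : ℕ} (hij : i ≤ j) (hj : j < m) : c.Y (c.P j) ≤ c.Y (c.P i) := by
  rcases hij.eq_or_lt with rfl | h
  · rfl
  · exact (c.Y_lt h hj).le

theorem Y_lt_iff {i j : ℕ} (hi : i < m) (hj : j < m) : c.Y (c.P j) < c.Y (c.P i) ↔ i < j := by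
  constructor
  · intro h
    by_contra hn
    exact absurd (c.Y_le (not_lt.1 hn) hi) (not_le.2 h)
  · intro h; exact c.Y_lt h hj

theorem P_inj {i j : ℕ} (hi : i < m) (hj : j < m) (h : c.P i = c.P j) : i = j := by
  rcases lt_trichotomy i j with h1 | h1 | h1
  · have := c.Y_lt h1 hj; rw [h] at this; exact absurd this (lt_irrefl _)
  · exact h1
  · have := c.Y_lt h1 hi; rw [h] at this; exact absurd this (lt_irrefl _)

theorem card_S (c : Cfg m S v1 v2 u1 u2) : S.card = m := by
  have : ((Finset.range m).image c.P).card = m := by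
    rw [Finset.card_image_of_injOn, Finset.card_range]
    intro i hi j hj h
    exact c.P_inj (by simpa using hi) (by simpa using hj) h
  rwa [← c.S_eq] at this

theorem S_Z {p : Pt3} (hp : p ∈ S) : c.Z p = 0 := by
  obtain ⟨i, _, rfl⟩ := c.memS.1 hp
  simp

theorem S_circ {p : Pt3} (hp : p ∈ S) : c.X p ^ 2 + c.Y p ^ 2 = 1 := by
  obtain ⟨i, _, rfl⟩ := c.memS.1 hp
  rw [PX, PY, mul_pow, ← pow_mul, mul_comm i 2, pow_mul]
  simp [Real.sin_sq_add_cos_sq]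

theorem conv_Z {p : Pt3} (hp : p ∈ convexHull ℝ (S : Set Pt3)) : c.Z p = 0 := by
  have : convexHull ℝ (S : Set Pt3) ⊆ {p | c.Z p = 0} :=
    convexHull_min (fun q hq => c.S_Z hq) (convex_hyperplane c.Z.isLinear _)
  exact this hp

/-- a linear inequality valid on the polygon vertices is valid on its hull -/
theorem conv_le (c : Cfg m S v1 v2 u1 u2) (f : Pt3 →ₗ[ℝ] ℝ) (r : ℝ) (hf : ∀ q ∈ S, f q ≤ r) {p : Pt3}
    (hp : p ∈ convexHull ℝ (S : Set Pt3)) : f p ≤ r := by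
  have : convexHull ℝ (S : Set Pt3) ⊆ {p | f p ≤ r} :=
    convexHull_min (fun q hq => hf q hq) (convex_halfSpace_le f.isLinear _)
  exact this hp

theorem conv_circ {p : Pt3} (hp : p ∈ convexHull ℝ (S : Set Pt3)) : c.X p ^ 2 + c.Y p ^ 2 ≤ 1 := by
  have h := c.conv_le (c.X p • c.X + c.Y p • c.Y) ((c.X p ^ 2 + c.Y p ^ 2 + 1) / 2) (by
    intro q hq
    have := c.S_circ hq
    simp only [LinearMap.add_apply, LinearMap.smul_apply, smul_eq_mul]
    nlinarith [sq_nonneg (c.X p - c.X q), sq_nonneg (c.Y p - c.Y q)]) hp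
  simp only [LinearMap.add_apply, LinearMap.smul_apply, smul_eq_mul] at h
  nlinarith

theorem S_ext (c : Cfg m S v1 v2 u1 u2) {q w : Pt3} (hq : q ∈ S) (hw : w ≠ 0) (h1 : q + w ∈ convexHull ℝ (S : Set Pt3))
    (h2 : q - w ∈ convexHull ℝ (S : Set Pt3)) : False := by
  apply hw
  have z1 := c.conv_Z h1
  have a := c.conv_circ h1
  have b := c.conv_circ h2
  have d := c.S_circ hq
  have z2 := c.S_Z hq
  simp only [map_add, map_sub] at a b z1
  have e1 : c.X w = 0 := by nlinarith [sq_nonneg (c.X w), sq_nonneg (c.Y w)]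
  have e2 : c.Y w = 0 := by nlinarith [sq_nonneg (c.X w), sq_nonneg (c.Y w)]
  apply c.inj <;> simp <;> linarith

/-! orientation of triples -/
def θ (i : ℕ) : ℝ := (-1) ^ i * c.α i

theorem X_θ (i : ℕ) : c.X (c.P i) = Real.sin (c.θ i) := by
  rw [PX, θ]
  rcases neg_one_pow_eq_or ℝ i with h | h <;> rw [h] <;> simp

theorem Y_θ (i : ℕ) : c.Y (c.P i) = Real.cos (c.θ i) := by
  rw [PY, θ]
  rcases neg_one_pow_eq_or ℝ i with h | h <;> rw [h] <;> simp

theorem θ_abs {i : ℕ} (hi : i < m) : -Real.pi < c.θ i ∧ c.θ i < Real.pi := by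
  have h1 := c.α_pos i
  have h2 := c.α_lt hi
  have := Real.pi_pos
  rw [θ]
  rcases neg_one_pow_eq_or ℝ i with h | h <;> rw [h] <;> constructor <;> linarith

def D (i j l : ℕ) : ℝ := c.det (c.P j - c.P i) (c.P l - c.P i)

theorem D_formula (i j l : ℕ) : c.D i j l = 4 * (Real.sin ((c.θ j - c.θ i) / 2) *
    Real.sin ((c.θ l - c.θ i) / 2) * Real.sin ((c.θ j - c.θ l) / 2)) := by
  unfold D Frame.det
  simp only [map_sub, X_θ, Y_θ]
  set x := (c.θ j - c.θ i) / 2 with hx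
  set y := (c.θ l - c.θ i) / 2 with hy
  have e2 : c.θ j = c.θ i + 2 * x := by rw [hx]; ring
  have e3 : c.θ l = c.θ i + 2 * y := by rw [hy]; ring
  have f3 : (c.θ j - c.θ l) / 2 = x - y := by rw [hx, hy]; ring
  rw [f3]
  have g1 : (Real.sin (c.θ j) - Real.sin (c.θ i)) * (Real.cos (c.θ l) - Real.cos (c.θ i)) -
      (Real.cos (c.θ j) - Real.cos (c.θ i)) * (Real.sin (c.θ l) - Real.sin (c.θ i)) =
      Real.sin (c.θ j - c.θ l) + Real.sin (c.θ l - c.θ i) - Real.sin (c.θ j - c.θ i) := by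
    simp only [Real.sin_sub]; ring
  rw [g1]
  have k1 : c.θ j - c.θ l = 2 * (x - y) := by rw [hx, hy]; ring
  have k2 : c.θ l - c.θ i = 2 * y := by rw [hy]; ring
  have k3 : c.θ j - c.θ i = 2 * x := by rw [hx]; ring
  rw [k1, k2, k3, Real.sin_two_mul, Real.sin_two_mul, Real.sin_two_mul, Real.sin_sub, Real.cos_sub]
  have s1 := Real.sin_sq_add_cos_sq x
  have s2 := Real.sin_sq_add_cos_sq y
  linear_combination 2 * Real.sin x * Real.cos x * s2 - 2 * Real.sin y * Real.cos y * s1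

theorem half_sin {x y : ℝ} (hx : -Real.pi < x ∧ x < Real.pi) (hy : -Real.pi < y ∧ y < Real.pi) :
    (x < y → 0 < Real.sin ((y - x) / 2)) ∧ (y < x → Real.sin ((y - x) / 2) < 0) := by
  constructor
  · intro h
    apply Real.sin_pos_of_pos_of_lt_pi <;> linarith
  · intro h
    apply Real.sin_neg_of_neg_of_neg_pi_lt <;> linarith

theorem D_pos {i j l : ℕ} (hi : i < m) (hj : j < m) (hl : l < m) (h1 : c.θ i < c.θ l)
    (h2 : c.θ l < c.θ j) : 0 < c.D i j l := by
  rw [D_formula]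
  have a1 := (half_sin (c.θ_abs hi) (c.θ_abs hj)).1 (h1.trans h2)
  have a2 := (half_sin (c.θ_abs hi) (c.θ_abs hl)).1 h1
  have a3 := (half_sin (c.θ_abs hl) (c.θ_abs hj)).1 h2
  positivity

theorem D_rot (i j l : ℕ) : c.D j l i = c.D i j l := by
  unfold D Frame.det; simp only [map_sub]; ring
theorem D_swap (i j l : ℕ) : c.D j i l = - c.D i j l := by
  unfold D Frame.det; simp only [map_sub]; ring

theorem θ_even {i : ℕ} (hi : Even i) : c.θ i = c.α i := by simp [θ, hi.neg_one_pow]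
theorem θ_odd {i : ℕ} (hi : Odd i) : c.θ i = - c.α i := by simp [θ, hi.neg_one_pow]

/-- consecutive triples -/
theorem D_cons {i : ℕ} (hi : i + 2 < m) : 0 < (-1) ^ i * c.D i (i+1) (i+2) := by
  have a1 := c.α_pos i
  have a2 := c.α_pos (i+1)
  have a3 := c.α_mono (show i < i + 2 by omega)
  rcases Nat.even_or_odd i with h | h
  · have e1 := c.θ_even h
    have e2 := c.θ_odd (h.add_one)
    have e3 := c.θ_even (h.add even_two)
    have := c.D_pos (i := i+1) (j := i+2) (l := i) (by omega) (by omega) (by omega)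
      (by linarith) (by linarith)
    rw [h.neg_one_pow, one_mul, ← D_rot]; exact this
  · have e1 := c.θ_odd h
    have e2 := c.θ_even (h.add_one)
    have e3 := c.θ_odd (h.add_even even_two)
    have := c.D_pos (i := i+2) (j := i+1) (l := i) (by omega) (by omega) (by omega)
      (by linarith) (by linarith)
    rw [h.neg_one_pow, ← D_rot]
    rw [D_swap] at this
    linarith

/-- side chords are supporting -/
theorem D_supp {i l : ℕ} (hi : i + 2 < m) (hl : l < m) : (-1) ^ i * c.D i (i+2) l ≤ 0 := by
  have a1 := c.α_pos i
  have a2 := c.α_pos l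
  have a3 := c.α_mono (show i < i + 2 by omega)
  rcases eq_or_ne l i with rfl | n1
  · simp [D, Frame.det]
  rcases eq_or_ne l (i+2) with rfl | n2
  · simp [D, Frame.det]; ring_nf; simp
  rcases Nat.even_or_odd i with h | h
  · have e1 := c.θ_even h
    have e3 := c.θ_even (h.add even_two)
    rw [h.neg_one_pow, one_mul]
    have : c.θ l < c.θ i ∨ c.θ (i+2) < c.θ l := by
      rcases Nat.even_or_odd l with h' | h'
      · rw [e1, e3, c.θ_even h', c.α_mono.lt_iff_lt, c.α_mono.lt_iff_lt]
        obtain ⟨a, rfl⟩ := h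
        obtain ⟨b, rfl⟩ := h'
        omega
      · left; rw [e1, c.θ_odd h']; linarith
    rcases this with g | g
    · have := c.D_pos (i := l) (j := i+2) (l := i) (by omega) (by omega) (by omega) g (by linarith)
      rw [D_swap, ← D_rot, D_rot, D_rot] at this
      rw [← D_rot, D_swap]
      have e := c.D_rot i (i+2) l
      have e' := c.D_swap (i+2) l i
      have e2 := c.D_rot l i (i+2)
      have e2' := c.D_rot (i+2) l i
      linarith
    · have := c.D_pos (i := i) (j := l) (l := i+2) (by omega) (by omega) (by omega) (by linarith) g
      have e := c.D_rot i (i+2) l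
      have e' := c.D_swap (i+2) i l
      have e2 := c.D_rot i l (i+2)
      have e2' := c.D_rot (i+2) i l
      linarith
  · have e1 := c.θ_odd h
    have e3 := c.θ_odd (h.add_even even_two)
    rw [h.neg_one_pow]
    have : c.θ l < c.θ (i+2) ∨ c.θ i < c.θ l := by
      rcases Nat.even_or_odd l with h' | h'
      · right; rw [e1, c.θ_even h']; linarith
      · rw [e1, e3, c.θ_odd h', neg_lt_neg_iff, neg_lt_neg_iff, c.α_mono.lt_iff_lt,
          c.α_mono.lt_iff_lt]
        obtain ⟨a, rfl⟩ := h
        obtain ⟨b, rfl⟩ := h'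
        omega
    rcases this with g | g
    · have := c.D_pos (i := l) (j := i) (l := i+2) (by omega) (by omega) (by omega) g (by linarith)
      have e := c.D_rot l i (i+2)
      linarith
    · have := c.D_pos (i := i+2) (j := l) (l := i) (by omega) (by omega) (by omega) (by linarith) g
      have e := c.D_rot (i+2) l i
      have e2 := c.D_rot l i (i+2)
      have e3 := c.D_rot i (i+2) l
      linarith

theorem D_first {l : ℕ} (hl : l < m) : 0 ≤ c.D 0 1 l := by
  have hm := c.h16
  have a0 := c.α_pos 0
  have a1 := c.α_pos 1
  rcases eq_or_ne l 0 with rfl | n1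
  · simp [D, Frame.det]
  rcases eq_or_ne l 1 with rfl | n2
  · simp [D, Frame.det]; ring_nf; simp
  have e0 := c.θ_even (i := 0) (by simp)
  have e1 := c.θ_odd (i := 1) (by simp)
  rcases Nat.even_or_odd l with h' | h'
  · have e := c.θ_even h'
    have := c.α_mono (show 0 < l by omega)
    have := c.D_pos (i := 1) (j := l) (l := 0) (by omega) (by omega) (by omega)
      (by linarith) (by linarith)
    have e := c.D_rot 0 1 l
    linarith
  · have e := c.θ_odd h'
    have := c.α_mono (show 1 < l by omega)
    have := c.D_pos (i := l) (j := 0) (l := 1) (by omega) (by omega) (by omega)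
      (by linarith) (by linarith)
    have e := c.D_rot l 0 1
    linarith

theorem D_last {l : ℕ} (hl : l < m) : c.D (m-2) (m-1) l ≤ 0 := by
  have hm := c.h16
  have ev := c.even
  have o2 : Even (m-2) := by obtain ⟨a, ha⟩ := ev; exact ⟨a - 1, by omega⟩
  have o1 : Odd (m-1) := by obtain ⟨a, ha⟩ := ev; exact ⟨a - 1, by omega⟩
  have a0 := c.α_pos (m-2)
  have a1 := c.α_pos (m-1)
  have al := c.α_pos l
  rcases eq_or_ne l (m-2) with rfl | n1
  · simp [D, Frame.det]
  rcases eq_or_ne l (m-1) with rfl | n2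
  · simp [D, Frame.det]; ring_nf; simp
  have e0 := c.θ_even o2
  have e1 := c.θ_odd o1
  have h1 : c.θ (m-1) < c.θ l ∧ c.θ l < c.θ (m-2) := by
    have := c.α_mono (show l < m-2 by omega)
    have := c.α_mono (show l < m-1 by omega)
    rcases Nat.even_or_odd l with h' | h'
    · rw [c.θ_even h']; constructor <;> linarith
    · rw [c.θ_odd h']; constructor <;> linarith
  have := c.D_pos (i := m-1) (j := m-2) (l := l) (by omega) (by omega) (by omega) h1.1 h1.2
  rw [D_swap] at this
  linarith

end Cfg


namespace Cfg
variable {m : ℕ} {S : Finset Pt3} {v1 v2 u1 u2 : Pt3} (c : Cfg m S v1 v2 u1 u2)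

def apex (_c : Cfg m S v1 v2 u1 u2) (i : ℕ) : Pt3 := if Even i then v2 else v1

theorem apex_cases (i : ℕ) : (c.apex i = v1 ∧ c.apex (i+1) = v2 ∧ (-1:ℝ) ^ i = -1) ∨
    (c.apex i = v2 ∧ c.apex (i+1) = v1 ∧ (-1:ℝ) ^ i = 1) := by
  unfold apex
  rcases Nat.even_or_odd i with h | h
  · have h2 : ¬ Even (i+1) := by simpa [Nat.even_add_one] using h
    right; simp [h, h2]
  · have h2 : Even (i+1) := by simpa [Nat.even_add_one] using h
    have h3 : ¬ Even i := by simpa using h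
    left; simp [h, h2, h3]

theorem apex_Z (i : ℕ) : c.Z (c.apex i) = c.h := by
  rcases c.apex_cases i with h | h <;> rw [h.1]
  · exact c.zv1
  · exact c.zv2

theorem apex_Y (i : ℕ) : c.Y (c.apex i) = c.Y v1 := by
  rcases c.apex_cases i with h | h <;> rw [h.1]
  exact c.yv.symm

theorem apex_X (i : ℕ) : (-1:ℝ) ^ i * (c.X (c.apex (i+1)) - c.X (c.apex i)) < 0 := by
  have := c.xv
  rcases c.apex_cases i with h | h <;> rw [h.1, h.2.1, h.2.2] <;> linarith

def Lt (i : ℕ) : Finset Pt3 := {v1, v2, c.P i, c.P (i+1)}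
def Tt (i : ℕ) : Finset Pt3 := {c.apex i, c.P i, c.P (i+1), c.P (i+2)}

theorem Lt_tet4 {i : ℕ} (hi : i + 1 < m) : Tet4 v1 v2 (c.P i) (c.P (i+1)) := by
  intro w x y z h0 h1
  have hX := congrArg c.X h1
  have hY := congrArg c.Y h1
  have hZ := congrArg c.Z h1
  simp only [map_add, map_smul, smul_eq_mul, c.zv1, c.zv2, map_zero, ← c.yv, c.PZ] at hX hY hZ
  have a1 : w + x = 0 := by
    have : (w + x) * c.h = 0 := by linarith
    exact (mul_eq_zero.1 this).resolve_right c.hpos.ne'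
  have hlt := c.Y_lt (show i < i + 1 by omega) hi
  have hy : y = 0 := by
    have : y * (c.Y (c.P i) - c.Y (c.P (i+1))) = 0 := by
      linear_combination hY - c.Y v1 * a1 - c.Y (c.P (i+1)) * h0 + c.Y (c.P (i+1)) * a1
    exact (mul_eq_zero.1 this).resolve_right (by linarith)
  have hz : z = 0 := by linarith
  have hw : w = 0 := by
    have : w * (c.X v2 - c.X v1) = 0 := by
      rw [hy, hz] at hX
      linear_combination -hX + c.X v2 * a1
    exact (mul_eq_zero.1 this).resolve_right (by linarith [c.xv])
  exact ⟨hw, by linarith, hy, hz⟩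

theorem tet4_planar {v A B C : Pt3} (hv : c.Z v ≠ 0) (hA : c.Z A = 0) (hB : c.Z B = 0)
    (hC : c.Z C = 0) (hd : c.det (B - A) (C - A) ≠ 0) : Tet4 v A B C := by
  intro w x y z h0 h1
  have hX := congrArg c.X h1
  have hY := congrArg c.Y h1
  have hZ := congrArg c.Z h1
  simp only [map_add, map_smul, smul_eq_mul, map_zero, hA, hB, hC] at hX hY hZ
  have hw : w = 0 := by
    have : w * c.Z v = 0 := by linarith
    exact (mul_eq_zero.1 this).resolve_right hv
  subst hw
  have hx : x = - y - z := by linarith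
  subst hx
  have hz : z = 0 := by
    have : z * c.det (B - A) (C - A) = 0 := by
      simp only [Frame.det, map_sub]
      linear_combination (c.X B - c.X A) * hY - (c.Y B - c.Y A) * hX
    exact (mul_eq_zero.1 this).resolve_right hd
  have hy : y = 0 := by
    have : y * c.det (B - A) (C - A) = 0 := by
      simp only [Frame.det, map_sub]
      linear_combination -(c.X C - c.X A) * hY + (c.Y C - c.Y A) * hX
    exact (mul_eq_zero.1 this).resolve_right hd
  subst hz hy
  simp

theorem D_cons_ne {i : ℕ} (hi : i + 2 < m) : c.D i (i+1) (i+2) ≠ 0 := by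
  intro h
  have := c.D_cons hi
  rw [h] at this; simp at this

theorem Tt_tet4 {i : ℕ} (hi : i + 2 < m) : Tet4 (c.apex i) (c.P i) (c.P (i+1)) (c.P (i+2)) :=
  c.tet4_planar (by rw [c.apex_Z]; exact c.hpos.ne') (by simp) (by simp) (by simp) (c.D_cons_ne hi)

theorem Lt_tet {i : ℕ} (hi : i + 1 < m) : IsTet (c.Lt i) := (c.Lt_tet4 hi).isTet
theorem Tt_tet {i : ℕ} (hi : i + 2 < m) : IsTet (c.Tt i) := (c.Tt_tet4 hi).isTet

def GY (j : ℕ) : Pt3 →ₗ[ℝ] ℝ := c.h • c.Y - (c.Y v1 - c.Y (c.P j)) • c.Z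

theorem GY_P (j l : ℕ) : c.GY j (c.P l) = c.h * c.Y (c.P l) := by
  simp [GY]
theorem GY_v1 (j : ℕ) : c.GY j v1 = c.h * c.Y (c.P j) := by
  simp [GY, c.zv1]; ring
theorem GY_v2 (j : ℕ) : c.GY j v2 = c.h * c.Y (c.P j) := by
  simp [GY, c.zv2, ← c.yv]; ring
theorem GY_apex (i j : ℕ) : c.GY j (c.apex i) = c.h * c.Y (c.P j) := by
  rcases c.apex_cases i with h | h <;> rw [h.1]
  · exact c.GY_v1 j
  · exact c.GY_v2 j

def GE (j a : ℕ) : Pt3 →ₗ[ℝ] ℝ :=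
  (-1:ℝ) ^ j • (c.X (c.P (a+1) - c.P a) • c.Y - c.Y (c.P (a+1) - c.P a) • c.X -
    (c.det (c.P (a+1) - c.P a) (c.apex j - c.P a) / c.h) • c.Z)
def cE (j a : ℕ) : ℝ := (-1) ^ j * c.det (c.P (a+1) - c.P a) (c.P a)

theorem GE_P (j a l : ℕ) : c.GE j a (c.P l) = c.cE j a + (-1) ^ j * c.D a (a+1) l := by
  simp only [GE, cE, D, Frame.det, LinearMap.smul_apply, LinearMap.sub_apply, c.PZ, smul_eq_mul,
    map_sub]
  ring
theorem GE_Pa (j a : ℕ) : c.GE j a (c.P a) = c.cE j a := by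
  rw [GE_P]; simp [D, Frame.det]
theorem GE_Pa1 (j a : ℕ) : c.GE j a (c.P (a+1)) = c.cE j a := by
  rw [GE_P]; simp only [D, Frame.det]; ring
theorem GE_apex (j a : ℕ) : c.GE j a (c.apex j) = c.cE j a := by
  have := c.hpos.ne'
  simp only [GE, cE, Frame.det, LinearMap.smul_apply, LinearMap.sub_apply, smul_eq_mul,
    map_sub, c.apex_Z]
  field_simp
  ring
theorem GE_other {j a : ℕ} (ha : a + 1 < m) : c.GE j a (c.apex (j+1)) < c.cE j a := by
  have h1 := c.apex_X j
  have h2 := c.Y_lt (show a < a + 1 by omega) ha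
  have h3 := c.GE_apex j a
  have h4 : c.GE j a (c.apex (j+1)) - c.GE j a (c.apex j) =
      ((-1) ^ j * (c.X (c.apex (j+1)) - c.X (c.apex j))) * (c.Y (c.P a) - c.Y (c.P (a+1))) := by
    simp only [GE, Frame.det, LinearMap.smul_apply, LinearMap.sub_apply, smul_eq_mul,
      map_sub, c.apex_Z, c.apex_Y]
    ring
  have : ((-1) ^ j * (c.X (c.apex (j+1)) - c.X (c.apex j))) * (c.Y (c.P a) - c.Y (c.P (a+1))) < 0 :=
    mul_neg_of_neg_of_pos h1 (by linarith)
  linarith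

theorem Lt_eq (i j : ℕ) : c.Lt i = {c.apex j, c.apex (j+1), c.P i, c.P (i+1)} := by
  rcases c.apex_cases j with h | h <;> rw [h.1, h.2.1, Lt]
  ext x; simp; tauto

/-- interiors disjoint -/
def Dj (σ τ : Finset Pt3) : Prop :=
  interior (convexHull ℝ (σ : Set Pt3)) ∩ interior (convexHull ℝ (τ : Set Pt3)) = ∅

theorem Dj.symm {σ τ : Finset Pt3} (h : Dj σ τ) : Dj τ σ := by
  unfold Dj; rw [inter_comm]; exact h

theorem LL {i j : ℕ} (hij : i < j) (hj : j + 1 < m) : Dj (c.Lt j) (c.Lt i) := by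
  have hh := c.hpos
  have m1 := fun l (h1 : l ≤ j) => mul_le_mul_of_nonneg_left (c.Y_le h1 (by omega)) hh.le
  have m2 := mul_lt_mul_of_pos_left (c.Y_lt (show j < j + 1 by omega) hj) hh
  apply sep_disjoint (c.Lt_tet hj) (c.GY j) (c.h * c.Y (c.P j))
  · intro p hp
    simp only [Lt, Finset.mem_insert, Finset.mem_singleton] at hp
    rcases hp with rfl | rfl | rfl | rfl
    · rw [GY_v1]
    · rw [GY_v2]
    · rw [GY_P]
    · rw [GY_P]; exact m2.le
  · exact ⟨c.P (j+1), by simp [Lt], by rw [GY_P]; exact m2⟩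
  · intro p hp
    simp only [Lt, Finset.mem_insert, Finset.mem_singleton] at hp
    rcases hp with rfl | rfl | rfl | rfl
    · rw [GY_v1]
    · rw [GY_v2]
    · rw [GY_P]; exact m1 _ (by omega)
    · rw [GY_P]; exact m1 _ (by omega)

theorem LT_below {i j : ℕ} (hij : j + 2 ≤ i) (hi : i + 1 < m) : Dj (c.Lt i) (c.Tt j) := by
  have hh := c.hpos
  have m1 := fun l (h1 : l ≤ i) => mul_le_mul_of_nonneg_left (c.Y_le h1 (by omega)) hh.le
  have m2 := mul_lt_mul_of_pos_left (c.Y_lt (show i < i + 1 by omega) hi) hh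
  apply sep_disjoint (c.Lt_tet hi) (c.GY i) (c.h * c.Y (c.P i))
  · intro p hp
    simp only [Lt, Finset.mem_insert, Finset.mem_singleton] at hp
    rcases hp with rfl | rfl | rfl | rfl
    · rw [GY_v1]
    · rw [GY_v2]
    · rw [GY_P]
    · rw [GY_P]; exact m2.le
  · exact ⟨c.P (i+1), by simp [Lt], by rw [GY_P]; exact m2⟩
  · intro p hp
    simp only [Tt, Finset.mem_insert, Finset.mem_singleton] at hp
    rcases hp with rfl | rfl | rfl | rfl
    · rw [GY_apex]
    · rw [GY_P]; exact m1 _ (by omega)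
    · rw [GY_P]; exact m1 _ (by omega)
    · rw [GY_P]; exact m1 _ (by omega)

theorem LT_above {i j : ℕ} (hij : i + 1 ≤ j) (hj : j + 2 < m) : Dj (c.Tt j) (c.Lt i) := by
  have hh := c.hpos
  have m1 := fun l (h1 : l ≤ j) => mul_le_mul_of_nonneg_left (c.Y_le h1 (by omega)) hh.le
  have m2 := fun l (h1 : j < l) (h2 : l < m) => mul_lt_mul_of_pos_left (c.Y_lt h1 h2) hh
  apply sep_disjoint (c.Tt_tet hj) (c.GY j) (c.h * c.Y (c.P j))
  · intro p hp
    simp only [Tt, Finset.mem_insert, Finset.mem_singleton] at hp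
    rcases hp with rfl | rfl | rfl | rfl
    · rw [GY_apex]
    · rw [GY_P]
    · rw [GY_P]; exact (m2 _ (by omega) (by omega)).le
    · rw [GY_P]; exact (m2 _ (by omega) (by omega)).le
  · exact ⟨c.P (j+1), by simp [Tt], by rw [GY_P]; exact m2 _ (by omega) (by omega)⟩
  · intro p hp
    simp only [Lt, Finset.mem_insert, Finset.mem_singleton] at hp
    rcases hp with rfl | rfl | rfl | rfl
    · rw [GY_v1]
    · rw [GY_v2]
    · rw [GY_P]; exact m1 _ (by omega)
    · rw [GY_P]; exact m1 _ (by omega)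

theorem TT_far {i j : ℕ} (hij : i + 2 ≤ j) (hj : j + 2 < m) : Dj (c.Tt j) (c.Tt i) := by
  have hh := c.hpos
  have m1 := fun l (h1 : l ≤ j) => mul_le_mul_of_nonneg_left (c.Y_le h1 (by omega)) hh.le
  have m2 := fun l (h1 : j < l) (h2 : l < m) => mul_lt_mul_of_pos_left (c.Y_lt h1 h2) hh
  apply sep_disjoint (c.Tt_tet hj) (c.GY j) (c.h * c.Y (c.P j))
  · intro p hp
    simp only [Tt, Finset.mem_insert, Finset.mem_singleton] at hp
    rcases hp with rfl | rfl | rfl | rfl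
    · rw [GY_apex]
    · rw [GY_P]
    · rw [GY_P]; exact (m2 _ (by omega) (by omega)).le
    · rw [GY_P]; exact (m2 _ (by omega) (by omega)).le
  · exact ⟨c.P (j+1), by simp [Tt], by rw [GY_P]; exact m2 _ (by omega) (by omega)⟩
  · intro p hp
    simp only [Tt, Finset.mem_insert, Finset.mem_singleton] at hp
    rcases hp with rfl | rfl | rfl | rfl
    · rw [GY_apex]
    · rw [GY_P]; exact m1 _ (by omega)
    · rw [GY_P]; exact m1 _ (by omega)
    · rw [GY_P]; exact m1 _ (by omega)

theorem LT_same {j : ℕ} (hj : j + 2 < m) : Dj (c.Lt j) (c.Tt j) := by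
  have g := c.GE_other (j := j) (a := j) (by omega)
  have hd := c.D_cons hj
  apply sep_disjoint (c.Lt_tet (by omega)) (c.GE j j) (c.cE j j)
  · intro p hp
    rw [c.Lt_eq j j] at hp
    simp only [Finset.mem_insert, Finset.mem_singleton] at hp
    rcases hp with rfl | rfl | rfl | rfl
    · rw [GE_apex]
    · exact g.le
    · rw [GE_Pa]
    · rw [GE_Pa1]
  · exact ⟨c.apex (j+1), by rw [c.Lt_eq j j]; simp, g⟩
  · intro p hp
    simp only [Tt, Finset.mem_insert, Finset.mem_singleton] at hp
    rcases hp with rfl | rfl | rfl | rfl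
    · rw [GE_apex]
    · rw [GE_Pa]
    · rw [GE_Pa1]
    · rw [GE_P]; linarith

theorem LT_next {j : ℕ} (hj : j + 2 < m) : Dj (c.Lt (j+1)) (c.Tt j) := by
  have g := c.GE_other (j := j) (a := j+1) (by omega)
  have hd := c.D_cons hj
  apply sep_disjoint (c.Lt_tet (by omega)) (c.GE j (j+1)) (c.cE j (j+1))
  · intro p hp
    rw [c.Lt_eq (j+1) j] at hp
    simp only [Finset.mem_insert, Finset.mem_singleton] at hp
    rcases hp with rfl | rfl | rfl | rfl
    · rw [GE_apex]
    · exact g.le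
    · rw [GE_Pa]
    · rw [GE_Pa1]
  · exact ⟨c.apex (j+1), by rw [c.Lt_eq (j+1) j]; simp, g⟩
  · intro p hp
    simp only [Tt, Finset.mem_insert, Finset.mem_singleton] at hp
    rcases hp with rfl | rfl | rfl | rfl
    · rw [GE_apex]
    · rw [GE_P, D_rot]; linarith
    · rw [GE_Pa]
    · rw [GE_Pa1]

theorem TT_next {j : ℕ} (hj : j + 3 < m) : Dj (c.Tt (j+1)) (c.Tt j) := by
  have g := c.GE_other (j := j) (a := j+1) (by omega)
  have hd := c.D_cons (i := j) (by omega)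
  have hd' := c.D_cons (i := j+1) (by omega)
  rw [pow_succ] at hd'
  apply sep_disjoint (c.Tt_tet (by omega)) (c.GE j (j+1)) (c.cE j (j+1))
  · intro p hp
    simp only [Tt, Finset.mem_insert, Finset.mem_singleton] at hp
    rcases hp with rfl | rfl | rfl | rfl
    · exact g.le
    · rw [GE_Pa]
    · rw [GE_Pa1]
    · rw [GE_P]; linarith
  · exact ⟨c.apex (j+1), by simp [Tt], g⟩
  · intro p hp
    simp only [Tt, Finset.mem_insert, Finset.mem_singleton] at hp
    rcases hp with rfl | rfl | rfl | rfl
    · rw [GE_apex]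
    · rw [GE_P, D_rot]; linarith
    · rw [GE_Pa]
    · rw [GE_Pa1]

theorem all_LT {i j : ℕ} (hi : i + 1 < m) (hj : j + 2 < m) : Dj (c.Lt i) (c.Tt j) := by
  rcases lt_trichotomy i j with h | rfl | h
  · exact (c.LT_above (by omega) hj).symm
  · exact c.LT_same hj
  · rcases Nat.eq_or_lt_of_le (show j + 1 ≤ i by omega) with rfl | h'
    · exact c.LT_next hj
    · exact c.LT_below (by omega) hi

theorem all_TT {i j : ℕ} (hij : i < j) (hj : j + 2 < m) : Dj (c.Tt j) (c.Tt i) := by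
  rcases Nat.eq_or_lt_of_le (show i + 1 ≤ j by omega) with rfl | h'
  · exact c.TT_next hj
  · exact c.TT_far (by omega) hj

end Cfg


namespace Cfg
variable {m : ℕ} {S : Finset Pt3} {v1 v2 u1 u2 : Pt3} (c : Cfg m S v1 v2 u1 u2)

def InTri (A B C s : Pt3) : Prop :=
  ∃ x y z : ℝ, 0 ≤ x ∧ 0 ≤ y ∧ 0 ≤ z ∧ x + y + z = 1 ∧ s = x • A + y • B + z • C

theorem inTri_of_det {A B C s : Pt3} (k : ℝ) (hA : c.Z A = 0) (hB : c.Z B = 0) (hC : c.Z C = 0)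
    (hs : c.Z s = 0) (h1 : 0 ≤ k * c.det (B - A) (s - A)) (h2 : 0 ≤ k * c.det (C - B) (s - B))
    (h3 : 0 ≤ k * c.det (A - C) (s - C)) (h0 : 0 < k * c.det (B - A) (C - A)) :
    InTri A B C s := by
  set Δ := c.det (B - A) (C - A) with hΔ
  have hk : k ≠ 0 := by rintro rfl; simp at h0
  have hd : Δ ≠ 0 := by intro h; rw [h] at h0; simp at h0
  refine ⟨k * c.det (C - B) (s - B) / (k * Δ), k * c.det (A - C) (s - C) / (k * Δ),
    k * c.det (B - A) (s - A) / (k * Δ), by positivity, by positivity, by positivity, ?_, ?_⟩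
  · field_simp
    rw [hΔ]; simp only [Frame.det, map_sub]; ring
  · apply c.inj
    · simp only [map_add, map_smul, smul_eq_mul]
      field_simp
      rw [hΔ]; simp only [Frame.det, map_sub]; ring
    · simp only [map_add, map_smul, smul_eq_mul]
      field_simp
      rw [hΔ]; simp only [Frame.det, map_sub]; ring
    · simp [hA, hB, hC, hs]

theorem supp_conv {j : ℕ} (hj : j + 2 < m) {s : Pt3} (hs : s ∈ convexHull ℝ (S : Set Pt3)) :
    (-1) ^ j * c.det (c.P (j+2) - c.P j) (s - c.P j) ≤ 0 := by
  have := c.conv_le ((-1:ℝ) ^ j • (c.X (c.P (j+2) - c.P j) • c.Y - c.Y (c.P (j+2) - c.P j) • c.X))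
    ((-1) ^ j * c.det (c.P (j+2) - c.P j) (c.P j)) (by
      intro q hq
      obtain ⟨l, hl, rfl⟩ := c.memS.1 hq
      have := c.D_supp hj hl
      simp only [D, Frame.det, LinearMap.smul_apply, LinearMap.sub_apply, smul_eq_mul, map_sub] at this ⊢
      linarith) hs
  simp only [Frame.det, LinearMap.smul_apply, LinearMap.sub_apply, smul_eq_mul, map_sub] at this ⊢
  linarith

theorem inTri {j : ℕ} (hj : j + 2 < m) {s γ : Pt3} (hs : s ∈ convexHull ℝ (S : Set Pt3))
    (hY : c.Y s = c.Y γ) (hX : 0 ≤ (-1) ^ j * (c.X s - c.X γ))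
    (h1 : 0 ≤ (-1) ^ j * c.det (c.P (j+1) - c.P j) (γ - c.P j))
    (h2 : 0 ≤ (-1) ^ j * c.det (c.P (j+2) - c.P (j+1)) (γ - c.P (j+1))) :
    InTri (c.P j) (c.P (j+1)) (c.P (j+2)) s := by
  have y1 := c.Y_lt (show j < j + 1 by omega) (by omega)
  have y2 := c.Y_lt (show j + 1 < j + 2 by omega) (by omega)
  have m1 := mul_nonneg hX (show 0 ≤ c.Y (c.P j) - c.Y (c.P (j+1)) by linarith)
  have m2 := mul_nonneg hX (show 0 ≤ c.Y (c.P (j+1)) - c.Y (c.P (j+2)) by linarith)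
  refine c.inTri_of_det ((-1) ^ j) (by simp) (by simp) (by simp) (c.conv_Z hs) ?_ ?_ ?_ (c.D_cons hj)
  · simp only [Frame.det, map_sub, hY] at h1 ⊢
    linarith
  · simp only [Frame.det, map_sub, hY] at h2 ⊢
    linarith
  · have := c.supp_conv hj hs
    simp only [Frame.det, map_sub] at this ⊢
    linarith

theorem inTri_fwd {j : ℕ} (hj : j + 2 < m) {s : Pt3} {r : ℝ} (h0 : 0 ≤ r) (h1 : r ≤ 1)
    (hs : s ∈ convexHull ℝ (S : Set Pt3))
    (hY : c.Y s = c.Y ((1 - r) • c.P j + r • c.P (j+1)))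
    (hX : 0 ≤ (-1) ^ j * (c.X s - c.X ((1 - r) • c.P j + r • c.P (j+1)))) :
    InTri (c.P j) (c.P (j+1)) (c.P (j+2)) s := by
  have hd := mul_nonneg (c.D_cons hj).le (show 0 ≤ 1 - r by linarith)
  apply c.inTri hj hs hY hX
  · apply le_of_eq
    simp only [Frame.det, map_sub, map_add, map_smul, smul_eq_mul]; ring
  · refine hd.trans (le_of_eq ?_)
    simp only [D, Frame.det, map_sub, map_add, map_smul, smul_eq_mul]; ring

theorem inTri_bwd {j : ℕ} (hj : j + 2 < m) {s : Pt3} {r : ℝ} (h0 : 0 ≤ r) (h1 : r ≤ 1)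
    (hs : s ∈ convexHull ℝ (S : Set Pt3))
    (hY : c.Y s = c.Y ((1 - r) • c.P (j+1) + r • c.P (j+2)))
    (hX : 0 ≤ (-1) ^ j * (c.X s - c.X ((1 - r) • c.P (j+1) + r • c.P (j+2)))) :
    InTri (c.P j) (c.P (j+1)) (c.P (j+2)) s := by
  have hd := mul_nonneg (c.D_cons hj).le h0
  apply c.inTri hj hs hY hX
  · refine hd.trans (le_of_eq ?_)
    simp only [D, Frame.det, map_sub, map_add, map_smul, smul_eq_mul]; ring
  · apply le_of_eq
    simp only [Frame.det, map_sub, map_add, map_smul, smul_eq_mul]; ring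

theorem first_conv {s : Pt3} (hs : s ∈ convexHull ℝ (S : Set Pt3)) :
    0 ≤ c.det (c.P 1 - c.P 0) (s - c.P 0) := by
  have := c.conv_le (-(c.X (c.P 1 - c.P 0) • c.Y - c.Y (c.P 1 - c.P 0) • c.X))
    (-c.det (c.P 1 - c.P 0) (c.P 0)) (by
      intro q hq
      obtain ⟨l, hl, rfl⟩ := c.memS.1 hq
      have := c.D_first hl
      simp only [D, Frame.det, LinearMap.neg_apply, LinearMap.smul_apply, LinearMap.sub_apply, smul_eq_mul, map_sub] at this ⊢
      linarith) hs
  simp only [Frame.det, LinearMap.neg_apply, LinearMap.smul_apply, LinearMap.sub_apply, smul_eq_mul, map_sub] at this ⊢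
  linarith

theorem last_conv {s : Pt3} (hs : s ∈ convexHull ℝ (S : Set Pt3)) :
    c.det (c.P (m-1) - c.P (m-2)) (s - c.P (m-2)) ≤ 0 := by
  have := c.conv_le ((c.X (c.P (m-1) - c.P (m-2)) • c.Y - c.Y (c.P (m-1) - c.P (m-2)) • c.X))
    (c.det (c.P (m-1) - c.P (m-2)) (c.P (m-2))) (by
      intro q hq
      obtain ⟨l, hl, rfl⟩ := c.memS.1 hq
      have := c.D_last hl
      simp only [D, Frame.det, LinearMap.smul_apply, LinearMap.sub_apply, smul_eq_mul, map_sub] at this ⊢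
      linarith) hs
  simp only [Frame.det, LinearMap.smul_apply, LinearMap.sub_apply, smul_eq_mul, map_sub] at this ⊢
  linarith

theorem side_left {i : ℕ} (hi : i + 1 < m) {s : Pt3} {r : ℝ} (h0 : 0 ≤ r) (h1 : r ≤ 1)
    (hs : s ∈ convexHull ℝ (S : Set Pt3))
    (hY : c.Y s = c.Y ((1 - r) • c.P i + r • c.P (i+1)))
    (hX : c.X s - c.X ((1 - r) • c.P i + r • c.P (i+1)) < 0) :
    ∃ j, j + 2 < m ∧ c.apex j = v1 ∧ InTri (c.P j) (c.P (j+1)) (c.P (j+2)) s := by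
  rcases Nat.even_or_odd i with h | h
  · rcases Nat.eq_zero_or_pos i with rfl | hpos
    · exfalso
      have a := c.first_conv hs
      have y := c.Y_lt (show 0 < 1 by omega) hi
      have b := mul_neg_of_neg_of_pos hX (show 0 < c.Y (c.P 0) - c.Y (c.P 1) by linarith)
      simp only [Frame.det, map_sub, map_add, map_smul, smul_eq_mul, hY, zero_add] at a b
      linarith
    · obtain ⟨j, rfl⟩ : ∃ j, i = j + 1 := ⟨i - 1, by omega⟩
      have hj : ¬ Even j := by simpa [Nat.even_add_one] using h
      refine ⟨j, hi, by simp [apex, hj], c.inTri_bwd hi h0 h1 hs hY ?_⟩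
      rw [(Nat.not_even_iff_odd.1 hj).neg_one_pow]; linarith
  · have hi2 : i + 2 < m := by
      obtain ⟨a, ha⟩ := c.even
      obtain ⟨b, hb⟩ := h
      omega
    have hj : ¬ Even i := by simpa using h
    refine ⟨i, hi2, by simp [apex, hj], c.inTri_fwd hi2 h0 h1 hs hY ?_⟩
    rw [h.neg_one_pow]; linarith

theorem side_right {i : ℕ} (hi : i + 1 < m) {s : Pt3} {r : ℝ} (h0 : 0 ≤ r) (h1 : r ≤ 1)
    (hs : s ∈ convexHull ℝ (S : Set Pt3))
    (hY : c.Y s = c.Y ((1 - r) • c.P i + r • c.P (i+1)))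
    (hX : 0 < c.X s - c.X ((1 - r) • c.P i + r • c.P (i+1))) :
    ∃ j, j + 2 < m ∧ c.apex j = v2 ∧ InTri (c.P j) (c.P (j+1)) (c.P (j+2)) s := by
  rcases Nat.even_or_odd i with h | h
  · rcases Nat.eq_or_lt_of_le (show i + 2 ≤ m by omega) with he | hi2
    · exfalso
      have e1 : m - 2 = i := by omega
      have e2 : m - 1 = i + 1 := by omega
      have a := c.last_conv hs
      rw [e1, e2] at a
      have y := c.Y_lt (show i < i + 1 by omega) hi
      have b := mul_pos hX (show 0 < c.Y (c.P i) - c.Y (c.P (i+1)) by linarith)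
      simp only [Frame.det, map_sub, map_add, map_smul, smul_eq_mul, hY] at a b
      linarith
    · refine ⟨i, hi2, by simp [apex, h], c.inTri_fwd hi2 h0 h1 hs hY ?_⟩
      rw [h.neg_one_pow]; linarith
  · obtain ⟨j, rfl⟩ : ∃ j, i = j + 1 := ⟨i - 1, by obtain ⟨b, hb⟩ := h; omega⟩
    have hj : Even j := by
      have : ¬ Even (j+1) := by simpa using h
      simpa [Nat.even_add_one] using this
    refine ⟨j, hi, by simp [apex, hj], c.inTri_bwd hi h0 h1 hs hY ?_⟩
    rw [hj.neg_one_pow]; linarith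

theorem find_cell {y : ℝ} (h0 : y ≤ c.Y (c.P 0)) (h1 : c.Y (c.P (m-1)) ≤ y) :
    ∃ i, i + 1 < m ∧ c.Y (c.P (i+1)) ≤ y ∧ y ≤ c.Y (c.P i) := by
  have hm := c.h16
  have key : ∀ n, n + 1 < m → c.Y (c.P (n+1)) ≤ y →
      ∃ i, i + 1 < m ∧ c.Y (c.P (i+1)) ≤ y ∧ y ≤ c.Y (c.P i) := by
    intro n
    induction n with
    | zero => intro h h'; exact ⟨0, h, h', h0⟩
    | succ n ih =>
      intro h h'
      by_cases hc : c.Y (c.P (n+1)) ≤ y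
      · exact ih (by omega) hc
      · exact ⟨n+1, h, h', (not_le.1 hc).le⟩
  apply key (m-2) (by omega)
  rwa [show m - 2 + 1 = m - 1 by omega]

theorem find_gamma {s : Pt3} (hs : s ∈ convexHull ℝ (S : Set Pt3)) :
    ∃ (i : ℕ) (r : ℝ), i + 1 < m ∧ 0 ≤ r ∧ r ≤ 1 ∧ c.Y s = c.Y ((1 - r) • c.P i + r • c.P (i+1)) := by
  have hm := c.h16
  obtain ⟨i, hi, h1, h2⟩ := c.find_cell (y := c.Y s)
    (c.conv_le c.Y _ (by
      intro q hq
      obtain ⟨l, hl, rfl⟩ := c.memS.1 hq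
      exact c.Y_le (Nat.zero_le _) hl) hs)
    (by
      have := c.conv_le (-c.Y) (-c.Y (c.P (m-1))) (by
        intro q hq
        obtain ⟨l, hl, rfl⟩ := c.memS.1 hq
        simpa only [LinearMap.neg_apply, neg_le_neg_iff] using c.Y_le (show l ≤ m - 1 by omega) (by omega)) hs
      simpa only [LinearMap.neg_apply, neg_le_neg_iff] using this)
  have hlt := c.Y_lt (show i < i + 1 by omega) hi
  have hd : 0 < c.Y (c.P i) - c.Y (c.P (i+1)) := by linarith
  refine ⟨i, (c.Y (c.P i) - c.Y s) / (c.Y (c.P i) - c.Y (c.P (i+1))), hi,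
    div_nonneg (by linarith) hd.le, by rw [div_le_one hd]; linarith, ?_⟩
  simp only [map_add, map_smul, smul_eq_mul]
  field_simp
  ring

theorem cover_Tt {j : ℕ} {s x : Pt3} {a b : ℝ} (ha : 0 ≤ a) (hb : 0 ≤ b) (hab : b + a = 1)
    (hs : InTri (c.P j) (c.P (j+1)) (c.P (j+2)) s) (hx : x = b • s + a • c.apex j) :
    x ∈ convexHull ℝ (c.Tt j : Set Pt3) := by
  obtain ⟨x1, x2, x3, h1, h2, h3, hsum, rfl⟩ := hs
  have := mem_conv_four (a := c.apex j) (b := c.P j) (c := c.P (j+1)) (d := c.P (j+2)) ha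
    (mul_nonneg hb h1) (mul_nonneg hb h2) (mul_nonneg hb h3) (by linear_combination b * hsum + hab)
  rw [Tt]
  convert this using 1
  rw [hx]; module

theorem covering {x : Pt3} (hx : x ∈ convexHull ℝ ((S ∪ {v1, v2} : Finset Pt3) : Set Pt3)) :
    (∃ i, i + 1 < m ∧ x ∈ convexHull ℝ (c.Lt i : Set Pt3)) ∨
    (∃ i, i + 2 < m ∧ x ∈ convexHull ℝ (c.Tt i : Set Pt3)) := by
  have hm := c.h16
  have hne : (S : Set Pt3).Nonempty := ⟨c.P 0, c.P_mem (by omega)⟩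
  rw [Finset.coe_union, convexHull_union hne (by simp)] at hx
  obtain ⟨s, hs, V, hV, hx⟩ := mem_convexJoin.1 hx
  rw [Finset.coe_insert, Finset.coe_singleton, convexHull_pair] at hV
  obtain ⟨b, a, hb, ha, hab, rfl⟩ := hx
  obtain ⟨μ', μ, h1, h2, h3, rfl⟩ := hV
  obtain rfl : μ' = 1 - μ := by linarith
  obtain ⟨i, r, hi, r0, r1, hY⟩ := c.find_gamma hs
  set γ := (1 - r) • c.P i + r • c.P (i+1) with hγ
  have hγS : γ ∈ convexHull ℝ (S : Set Pt3) :=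
    convex_convexHull ℝ _ (subset_convexHull ℝ _ (c.P_mem (by omega)))
      (subset_convexHull ℝ _ (c.P_mem hi)) (by linarith) r0 (by ring)
  have hL : 0 < c.X v2 - c.X v1 := by linarith [c.xv]
  set t := (c.X s - c.X γ) / (c.X v2 - c.X v1) with ht
  have hst : s = γ + t • (v2 - v1) := by
    apply c.inj
    · simp only [map_add, map_smul, map_sub, smul_eq_mul, ht]; field_simp; ring
    · simp only [map_add, map_smul, map_sub, smul_eq_mul, hY, c.yv]; ring
    · simp only [map_add, map_smul, map_sub, smul_eq_mul, c.conv_Z hs, c.conv_Z hγS, c.zv1, c.zv2]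
      ring
  have part : ∀ κ : ℝ, 0 ≤ κ → κ ≤ 1 → γ + (κ * t) • (v2 - v1) ∈ convexHull ℝ (S : Set Pt3) := by
    intro κ k0 k1
    have := convex_convexHull ℝ _ hγS hs (show 0 ≤ 1 - κ by linarith) k0 (by ring)
    convert this using 1
    rw [hst]; module
  rcases hb.eq_or_lt with rfl | hb
  · obtain rfl : a = 1 := by linarith
    left
    refine ⟨0, by omega, ?_⟩
    have := mem_conv_four (a := v1) (b := v2) (c := c.P 0) (d := c.P (0+1)) h1 h2 le_rfl le_rfl
      (by linarith)
    rw [Lt]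
    convert this using 1
    module
  set ν := a * μ + b * t with hν
  have hμ : 0 ≤ a * μ := mul_nonneg ha h2
  have hμ' : 0 ≤ a * (1 - μ) := mul_nonneg ha h1
  rcases lt_or_ge ν 0 with hneg | hν0
  · right
    have hbt : b * t < 0 := by linarith
    have ht0 : t < 0 := by by_contra h; have := mul_nonneg hb.le (not_lt.1 h); linarith
    have hκ : ν / (b * t) * t = ν / b := by have := ht0.ne; field_simp
    have hm' := part (ν / (b * t)) (div_nonneg_of_nonpos hneg.le hbt.le)
      (by rw [div_le_one_of_neg hbt]; linarith)
    rw [hκ] at hm'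
    obtain ⟨j, hj, hap, htri⟩ := c.side_left hi r0 r1 hm'
      (by rw [← hγ]; simp only [map_add, map_smul, map_sub, smul_eq_mul, c.yv]; ring)
      (by
        rw [← hγ]; simp only [map_add, map_smul, map_sub, smul_eq_mul]
        have := mul_neg_of_neg_of_pos (div_neg_of_neg_of_pos hneg hb) hL
        linarith)
    refine ⟨j, hj, c.cover_Tt ha hb.le hab htri ?_⟩
    have e1 : b • ((ν / b) • (v2 - v1)) = ν • (v2 - v1) := by
      rw [smul_smul, mul_div_cancel₀ _ hb.ne']
    rw [hap, hst, smul_add b γ, smul_add b γ, e1, hν]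
    module
  rcases le_or_gt ν a with hνa | hgt
  · left
    refine ⟨i, hi, ?_⟩
    have := mem_conv_four (a := v1) (b := v2) (c := c.P i) (d := c.P (i+1))
      (show 0 ≤ a - ν by linarith) hν0 (mul_nonneg hb.le (show 0 ≤ 1 - r by linarith))
      (mul_nonneg hb.le r0) (by linarith)
    rw [Lt]
    convert this using 1
    rw [hst, hγ, hν]
    module
  · right
    have hge : ν - a ≤ b * t := by linarith
    have hbt : 0 < b * t := by linarith
    have ht0 : 0 < t := by by_contra h; have := mul_nonneg hb.le (neg_nonneg.2 (not_lt.1 h)); linarith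
    have hκ : (ν - a) / (b * t) * t = (ν - a) / b := by field_simp
    have hm' := part ((ν - a) / (b * t)) (div_nonneg (by linarith) hbt.le)
      (by rw [div_le_one hbt]; linarith)
    rw [hκ] at hm'
    obtain ⟨j, hj, hap, htri⟩ := c.side_right hi r0 r1 hm'
      (by rw [← hγ]; simp only [map_add, map_smul, map_sub, smul_eq_mul, c.yv]; ring)
      (by
        rw [← hγ]; simp only [map_add, map_smul, map_sub, smul_eq_mul]
        have := mul_pos (div_pos (sub_pos.2 hgt) hb) hL
        linarith)
    refine ⟨j, hj, c.cover_Tt ha hb.le hab htri ?_⟩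
    have e1 : b • (((ν - a) / b) • (v2 - v1)) = (ν - a) • (v2 - v1) := by
      rw [smul_smul, mul_div_cancel₀ _ hb.ne']
    rw [hap, hst, smul_add b γ, smul_add b γ, e1, hν]
    module

/-- dissection of the upper half -/
theorem upper (c : Cfg m S v1 v2 u1 u2) : ∃ D : Finset (Finset Pt3), D.card = 2 * m - 3 ∧
    (∀ σ ∈ D, IsTet σ ∧ σ ⊆ S ∪ {v1, v2}) ∧
    (∀ σ ∈ D, ∀ τ ∈ D, σ ≠ τ → Dj σ τ) ∧
    convexHull ℝ ((S ∪ {v1, v2} : Finset Pt3) : Set Pt3) ⊆ ⋃ σ ∈ D, convexHull ℝ (σ : Set Pt3) := by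
  have hm := c.h16
  let I := (Finset.range (m-1)).disjSum (Finset.range (m-2))
  let f : ℕ ⊕ ℕ → Finset Pt3 := Sum.elim c.Lt c.Tt
  have tet : ∀ x ∈ I, IsTet (f x) := by
    rintro (i | i) hx
    · simp only [I, Finset.inl_mem_disjSum, Finset.mem_range] at hx
      exact c.Lt_tet (by omega)
    · simp only [I, Finset.inr_mem_disjSum, Finset.mem_range] at hx
      exact c.Tt_tet (by omega)
  have dj : ∀ x ∈ I, ∀ y ∈ I, x ≠ y → Dj (f x) (f y) := by
    rintro (i | i) hx (j | j) hy hne <;>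
    simp only [I, Finset.inl_mem_disjSum, Finset.inr_mem_disjSum, Finset.mem_range] at hx hy
    · have : i ≠ j := by rintro rfl; exact hne rfl
      rcases lt_or_gt_of_ne this with h | h
      · exact (c.LL h (by omega)).symm
      · exact c.LL h (by omega)
    · exact c.all_LT (by omega) (by omega)
    · exact (c.all_LT (by omega) (by omega)).symm
    · have : i ≠ j := by rintro rfl; exact hne rfl
      rcases lt_or_gt_of_ne this with h | h
      · exact (c.all_TT h (by omega)).symm
      · exact c.all_TT h (by omega)
  have inj : Set.InjOn f I := by
    intro x hx y hy h
    by_contra hne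
    have := dj x hx y hy hne
    rw [← h, Dj, inter_self] at this
    exact (interior_tet_nonempty (tet x hx)).ne_empty this
  refine ⟨I.image f, ?_, ?_, ?_, ?_⟩
  · rw [Finset.card_image_of_injOn inj, Finset.card_disjSum, Finset.card_range, Finset.card_range]
    omega
  · intro σ hσ
    obtain ⟨x, hx, rfl⟩ := Finset.mem_image.1 hσ
    refine ⟨tet x hx, ?_⟩
    rcases x with i | i <;>
    simp only [I, Finset.inl_mem_disjSum, Finset.inr_mem_disjSum, Finset.mem_range] at hx
    · have a1 := c.P_mem (i := i) (by omega)
      have a2 := c.P_mem (i := i+1) (by omega)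
      intro p hp
      simp only [f, Sum.elim_inl, Lt, Finset.mem_insert, Finset.mem_singleton] at hp
      rcases hp with rfl | rfl | rfl | rfl <;> simp [a1, a2]
    · have a1 := c.P_mem (i := i) (by omega)
      have a2 := c.P_mem (i := i+1) (by omega)
      have a3 := c.P_mem (i := i+2) (by omega)
      intro p hp
      simp only [f, Sum.elim_inr, Tt, Finset.mem_insert, Finset.mem_singleton] at hp
      rcases hp with rfl | rfl | rfl | rfl
      · rcases c.apex_cases i with h | h <;> rw [h.1] <;> simp
      all_goals simp [a1, a2, a3]
  · intro σ hσ τ hτ hne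
    obtain ⟨x, hx, rfl⟩ := Finset.mem_image.1 hσ
    obtain ⟨y, hy, rfl⟩ := Finset.mem_image.1 hτ
    exact dj x hx y hy (by rintro rfl; exact hne rfl)
  · intro x hx
    simp only [mem_iUnion]
    rcases c.covering hx with ⟨i, hi, h⟩ | ⟨i, hi, h⟩
    · exact ⟨c.Lt i, Finset.mem_image.2 ⟨Sum.inl i, by simp [I]; omega, rfl⟩, h⟩
    · exact ⟨c.Tt i, Finset.mem_image.2 ⟨Sum.inr i, by simp [I]; omega, rfl⟩, h⟩

end Cfg


namespace Frame
variable (F : Frame)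

theorem indep_det {A B C : Pt3} (hA : F.Z A = 0) (hB : F.Z B = 0) (hC : F.Z C = 0)
    (h : ∀ x y z : ℝ, x + y + z = 0 → x • A + y • B + z • C = 0 → x = 0 ∧ y = 0 ∧ z = 0) :
    F.det (B - A) (C - A) ≠ 0 := by
  intro h0
  by_cases hBA : B - A = 0
  · have := (h (-1) 1 0 (by norm_num) (by
      rw [sub_eq_zero] at hBA; rw [hBA]; module)).1
    norm_num at this
  · obtain ⟨l, hl⟩ := F.planar_par (by simp [hA, hB]) (by simp [hA, hC]) hBA h0
    have := (h (l - 1) (-l) 1 (by ring) (by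
      have : C = l • (B - A) + A := by rw [← hl]; abel
      rw [this]; module)).2.2
    norm_num at this

theorem slice_apex {v A B C : Pt3} (h : Tet4 v A B C) (hv : 0 < F.Z v) (hA : F.Z A = 0)
    (hB : F.Z B = 0) (hC : F.Z C = 0) : F.Slice {v, A, B, C} A B C := by
  refine ⟨hA, hB, hC, ?_, ?_⟩
  · refine F.indep_det hA hB hC fun x y z h1 h2 => ?_
    have := h 0 x y z (by linarith) (by rw [← h2]; module)
    exact this.2
  · intro a b c ha hb hc hs
    obtain ⟨w1, w2, w3, w4, ws, he⟩ := h.span F.e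
    have hw1 : 0 < w1 := by
      have := congrArg F.Z he
      simp only [map_add, map_smul, smul_eq_mul, hA, hB, hC, Frame.e, F.Z_mk] at this
      by_contra hn
      nlinarith
    exact h.cone (x1 := 0) (by linarith) (by module) ws he (Or.inr ⟨rfl, hw1⟩) (Or.inl ha)
      (Or.inl hb) (Or.inl hc)

theorem slice_mixed {v u a b : Pt3} (h : Tet4 v u a b) {p1 p2 x1 x2 x3 y1 y2 y3 : ℝ}
    (hp1 : 0 < p1) (hp2 : 0 < p2) (hp : p1 + p2 = 1)
    (hx1 : 0 ≤ x1) (hx2 : 0 ≤ x2) (hx3 : 0 < x3) (hx : x1 + x2 + x3 = 1)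
    (hy1 : 0 ≤ y1) (hy2 : 0 ≤ y2) (hy3 : 0 < y3) (hy : y1 + y2 + y3 = 1)
    (zp : F.Z (p1 • v + p2 • u) = 0) (zx : F.Z (x1 • v + x2 • u + x3 • a) = 0)
    (zy : F.Z (y1 • v + y2 • u + y3 • b) = 0) :
    F.Slice {v, u, a, b} (p1 • v + p2 • u) (x1 • v + x2 • u + x3 • a)
      (y1 • v + y2 • u + y3 • b) := by
  refine ⟨zp, zx, zy, F.indep_det zp zx zy fun x y z h1 h2 => ?_, ?_⟩
  · have := h (x * p1 + y * x1 + z * y1) (x * p2 + y * x2 + z * y2) (y * x3) (z * y3)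
      (by linear_combination x * hp + y * hx + z * hy + h1) (by rw [← h2]; module)
    have hy0 : y = 0 := (mul_eq_zero.1 this.2.2.1).resolve_right hx3.ne'
    have hz0 : z = 0 := (mul_eq_zero.1 this.2.2.2).resolve_right hy3.ne'
    subst hy0; subst hz0
    exact ⟨by linarith, rfl, rfl⟩
  · intro a' b' c' ha hb hc hs
    obtain ⟨w1, w2, w3, w4, ws, he⟩ := h.span F.e
    exact h.cone (x1 := a' * p1 + b' * x1 + c' * y1) (x2 := a' * p2 + b' * x2 + c' * y2)
      (x3 := b' * x3) (x4 := c' * y3)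
      (by linear_combination a' * hp + b' * hx + c' * hy + hs) (by module) ws he
      (Or.inl (by positivity)) (Or.inl (by positivity)) (Or.inl (by positivity))
      (Or.inl (by positivity))

end Frame

namespace Cfg
variable {m : ℕ} {S : Finset Pt3} {v1 v2 u1 u2 : Pt3} (c : Cfg m S v1 v2 u1 u2)

/-- the crossing point of the segment `v u` with the plane of the polygon -/
def pp (v u : Pt3) : Pt3 := (c.k / (c.h + c.k)) • v + (c.h / (c.h + c.k)) • u

theorem pp_conv {v u : Pt3} (hv : v = v1 ∨ v = v2) (hu : u = u1 ∨ u = u2) :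
    c.pp v u ∈ convexHull ℝ (S : Set Pt3) := c.hp v hv u hu

theorem zv {v : Pt3} (hv : v = v1 ∨ v = v2) : c.Z v = c.h := by
  rcases hv with rfl | rfl
  · exact c.zv1
  · exact c.zv2

theorem zu {v : Pt3} (hv : v = u1 ∨ v = u2) : c.Z v = -c.k := by
  rcases hv with rfl | rfl
  · exact c.zu1
  · exact c.zu2

theorem v_notS (c : Cfg m S v1 v2 u1 u2) {v : Pt3} (hv : v = v1 ∨ v = v2) : v ∉ S := fun h => by
  have := c.S_Z h; rw [c.zv hv] at this; exact c.hpos.ne' this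

theorem u_notS (c : Cfg m S v1 v2 u1 u2) {v : Pt3} (hv : v = u1 ∨ v = u2) : v ∉ S := fun h => by
  have := c.S_Z h; rw [c.zu hv] at this; linarith [c.kpos]

theorem vu_ne (c : Cfg m S v1 v2 u1 u2) {v u : Pt3} (hv : v = v1 ∨ v = v2) (hu : u = u1 ∨ u = u2) : v ≠ u := fun h => by
  have h1 := c.zv hv; rw [h, c.zu hu] at h1; linarith [c.kpos, c.hpos]

theorem v_ne (c : Cfg m S v1 v2 u1 u2) : v1 ≠ v2 := fun h => by
  exact absurd (congrArg c.X h) c.xv.ne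

/-- classes -/
def IsA (v1 v2 u1 u2 : Pt3) (σ : Finset Pt3) : Prop :=
  (v1 ∈ σ ∨ v2 ∈ σ) ∧ ¬ (v1 ∈ σ ∧ v2 ∈ σ) ∧ u1 ∉ σ ∧ u2 ∉ σ
def IsL (v1 v2 u1 u2 : Pt3) (σ : Finset Pt3) : Prop :=
  v1 ∈ σ ∧ v2 ∈ σ ∧ u1 ∉ σ ∧ u2 ∉ σ
def IsM (v1 v2 u1 u2 : Pt3) (σ : Finset Pt3) : Prop :=
  (v1 ∈ σ ∨ v2 ∈ σ) ∧ (u1 ∈ σ ∨ u2 ∈ σ)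

abbrev VV (S : Finset Pt3) (v1 v2 u1 u2 : Pt3) : Finset Pt3 := S ∪ {v1, v2, u1, u2}

variable {T : Finset (Finset Pt3)}

theorem mem_cases (hT : IsTriangulation (VV S v1 v2 u1 u2) T) {σ : Finset Pt3} (hσ : σ ∈ T)
    {p : Pt3} (hp : p ∈ σ) : p ∈ S ∨ (p = v1 ∨ p = v2) ∨ (p = u1 ∨ p = u2) := by
  have := (hT.1.1 σ hσ).2 (Finset.mem_coe.2 hp)
  simp only [VV, Finset.coe_union, Finset.mem_coe, Set.mem_union, Finset.mem_insert,
    Finset.mem_singleton] at this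
  tauto

theorem avSlice (c : Cfg m S v1 v2 u1 u2) (hT : IsTriangulation (VV S v1 v2 u1 u2) T)
    {σ : Finset Pt3} (hσ : σ ∈ T)
    (hA : IsA v1 v2 u1 u2 σ) : ∃ v A B C, (v = v1 ∨ v = v2) ∧ σ = {v, A, B, C} ∧ A ∈ S ∧ B ∈ S ∧
      C ∈ S ∧ Tet4 v A B C ∧ c.Slice σ A B C := by
  obtain ⟨h1, h2, h3, h4⟩ := hA
  have key : ∀ v, (v = v1 ∨ v = v2) → v ∈ σ → ∃ v A B C, (v = v1 ∨ v = v2) ∧ σ = {v, A, B, C} ∧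
      A ∈ S ∧ B ∈ S ∧ C ∈ S ∧ Tet4 v A B C ∧ c.Slice σ A B C := by
    intro v hv hvσ
    obtain ⟨A, B, C, hs, ht⟩ := tet_single (hT.1.1 σ hσ).1 hvσ
    have hd := ht.distinct
    have inS : ∀ p ∈ σ, p ≠ v → p ∈ S := by
      intro p hp hpv
      rcases mem_cases hT hσ hp with h | h | h
      · exact h
      · exfalso
        rcases hv with rfl | rfl <;> rcases h with rfl | rfl <;> simp_all
      · rcases h with rfl | rfl <;> contradiction
    have hA := inS A (by simp [hs]) (Ne.symm hd.1)
    have hB := inS B (by simp [hs]) (Ne.symm hd.2.1)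
    have hC := inS C (by simp [hs]) (Ne.symm hd.2.2.1)
    refine ⟨v, A, B, C, hv, hs, hA, hB, hC, ht, ?_⟩
    rw [hs]
    exact c.slice_apex ht (by rw [c.zv hv]; exact c.hpos) (c.S_Z hA) (c.S_Z hB) (c.S_Z hC)
  rcases h1 with h | h
  · exact key v1 (Or.inl rfl) h
  · exact key v2 (Or.inr rfl) h

/-- projected vertex of a mixed tetrahedron -/
def pj (v u r : Pt3) : Pt3 := if c.Z r = 0 then r else if 0 < c.Z r then c.pp r u else c.pp v r

theorem pj_S {v u r : Pt3} (hr : r ∈ S) : c.pj v u r = r := by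
  simp [pj, c.S_Z hr]

theorem pj_v {v u r : Pt3} (hr : r = v1 ∨ r = v2) : c.pj v u r = c.pp r u := by
  simp [pj, c.zv hr, c.hpos, c.hpos.ne']

theorem pj_u {v u r : Pt3} (hr : r = u1 ∨ r = u2) : c.pj v u r = c.pp v r := by
  simp [pj, c.zu hr, c.kpos.le, c.kpos.ne']

theorem pj_weights {v u r : Pt3}
    (hr : r ∈ S ∨ (r = v1 ∨ r = v2) ∨ (r = u1 ∨ r = u2)) :
    ∃ x1 x2 x3 : ℝ, 0 ≤ x1 ∧ 0 ≤ x2 ∧ 0 < x3 ∧ x1 + x2 + x3 = 1 ∧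
      c.pj v u r = x1 • v + x2 • u + x3 • r := by
  have hh := c.hpos
  have hk := c.kpos
  have hhk : c.h + c.k ≠ 0 := by positivity
  rcases hr with hr | hr | hr
  · exact ⟨0, 0, 1, le_rfl, le_rfl, one_pos, by norm_num, by rw [c.pj_S hr]; module⟩
  · exact ⟨0, c.h / (c.h + c.k), c.k / (c.h + c.k), le_rfl, by positivity, by positivity,
      by field_simp; ring, by rw [c.pj_v hr, pp]; module⟩
  · exact ⟨c.k / (c.h + c.k), 0, c.h / (c.h + c.k), by positivity, le_rfl, by positivity,
      by field_simp; ring, by rw [c.pj_u hr, pp]; module⟩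

theorem pp_Z {v u : Pt3} (hv : v = v1 ∨ v = v2) (hu : u = u1 ∨ u = u2) : c.Z (c.pp v u) = 0 :=
  c.conv_Z (c.pp_conv hv hu)

theorem pj_conv {v u r : Pt3} (hv : v = v1 ∨ v = v2) (hu : u = u1 ∨ u = u2)
    (hr : r ∈ S ∨ (r = v1 ∨ r = v2) ∨ (r = u1 ∨ r = u2)) :
    c.pj v u r ∈ convexHull ℝ (S : Set Pt3) := by
  rcases hr with hr | hr | hr
  · rw [c.pj_S hr]; exact subset_convexHull ℝ _ hr
  · rw [c.pj_v hr]; exact c.pp_conv hr hu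
  · rw [c.pj_u hr]; exact c.pp_conv hv hr

theorem mixSlice {v u a b : Pt3} (hv : v = v1 ∨ v = v2) (hu : u = u1 ∨ u = u2)
    (ha : a ∈ S ∨ (a = v1 ∨ a = v2) ∨ (a = u1 ∨ a = u2))
    (hb : b ∈ S ∨ (b = v1 ∨ b = v2) ∨ (b = u1 ∨ b = u2)) (ht : Tet4 v u a b) :
    c.Slice {v, u, a, b} (c.pp v u) (c.pj v u a) (c.pj v u b) := by
  have hh := c.hpos
  have hk := c.kpos
  obtain ⟨x1, x2, x3, hx1, hx2, hx3, hx, ex⟩ := c.pj_weights (v := v) (u := u) ha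
  obtain ⟨y1, y2, y3, hy1, hy2, hy3, hy, ey⟩ := c.pj_weights (v := v) (u := u) hb
  have zx := c.conv_Z (c.pj_conv hv hu ha)
  have zy := c.conv_Z (c.pj_conv hv hu hb)
  rw [ex] at zx
  rw [ey] at zy
  rw [ex, ey]
  exact c.slice_mixed ht (by positivity) (by positivity) (by field_simp; ring) hx1 hx2 hx3 hx
    hy1 hy2 hy3 hy (c.pp_Z hv hu) zx zy

theorem generic (c : Cfg m S v1 v2 u1 u2) (K : Finset Pt3) (hK : ∀ p ∈ K, c.Z p = 0) :
    ∃ d, c.Z d = 0 ∧ ∀ p ∈ K, ∀ q ∈ K, p ≠ q → c.det d (p - q) ≠ 0 := by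
  have hm := c.h16
  have h0 := c.D_cons (i := 0) (by omega)
  obtain ⟨t, -, -, ht⟩ := c.generic_dir (c.PZ 0) (c.PZ 1) (c.PZ 2)
    (show c.det (c.P 1 - c.P 0) (c.P 2 - c.P 0) ≠ 0 by
      simp only [pow_zero, one_mul, zero_add] at h0; exact h0.ne')
    ((K ×ˢ K).image fun z => z.1 - z.2) (by
      intro w hw
      obtain ⟨z, hz, rfl⟩ := Finset.mem_image.1 hw
      rw [Finset.mem_product] at hz
      simp [hK _ hz.1, hK _ hz.2])
  refine ⟨_, ?_, fun p hp q hq hpq => ht _ (Finset.mem_image.2 ⟨(p, q), by simp [hp, hq], rfl⟩)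
    (sub_ne_zero.2 hpq)⟩
  simp

theorem slice_distinct {F : Frame} {σ : Finset Pt3} {A B C : Pt3} (h : F.Slice σ A B C) :
    A ≠ B ∧ B ≠ C ∧ A ≠ C := by
  obtain ⟨-, -, -, h, -⟩ := h
  refine ⟨?_, ?_, ?_⟩ <;> rintro rfl <;> apply h <;> simp [Frame.det] <;> ring

/-- basic counting -/
theorem count_I (c : Cfg m S v1 v2 u1 u2) (hT : IsTriangulation (VV S v1 v2 u1 u2) T)
    (Pe : Finset Pt3) (hPe : ∀ p ∈ Pe, p ∈ convexHull ℝ (S : Set Pt3)) (Fam : Finset (Finset Pt3))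
    (hF : Fam ⊆ T) (hs : ∀ σ ∈ Fam, ∃ A B C, A ∈ S ∪ Pe ∧ B ∈ S ∪ Pe ∧ C ∈ S ∪ Pe ∧
      c.Slice σ A B C) : Fam.card ≤ m - 2 + 2 * Pe.card := by
  have hK : ∀ p ∈ S ∪ Pe, p ∈ convexHull ℝ (S : Set Pt3) := by
    intro p hp
    rcases Finset.mem_union.1 hp with h | h
    · exact subset_convexHull ℝ _ h
    · exact hPe p h
  obtain ⟨d, hd, hg⟩ := c.generic (S ∪ Pe) fun p hp => c.conv_Z (hK p hp)
  rw [← c.card_S]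
  refine Frame.count_lab hd (fun q hq w hw => c.S_ext hq hw) Fam
    (fun σ hσ τ hτ hne => hT.1.2.1 σ (hF hσ) τ (hF hτ) hne) ?_
  intro σ hσ
  obtain ⟨A, B, C, hA, hB, hC, hsl⟩ := hs σ hσ
  have hd := slice_distinct hsl
  obtain ⟨A, B, C, h1, h2, h3, h4, h5, h6⟩ := hsl.sort (d := d) ((S ∪ Pe : Finset Pt3) : Set Pt3)
    hA hB hC (hg _ hA _ hB hd.1) (hg _ hB _ hC hd.2.1) (hg _ hA _ hC hd.2.2)
  exact ⟨A, B, C, h1, hK _ h2, hK _ h4, h5, h6, Finset.mem_union.1 h3⟩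

/-- counting with one extra mixed tetrahedron -/
theorem count_III (c : Cfg m S v1 v2 u1 u2) (hT : IsTriangulation (VV S v1 v2 u1 u2) T)
    {S' : Finset Pt3} (hS' : S' ⊆ S) (Fam : Finset (Finset Pt3))
    (hF : Fam ⊆ T) (hs : ∀ σ ∈ Fam, ∃ A B C, A ∈ S' ∧ B ∈ S' ∧ C ∈ S' ∧ c.Slice σ A B C)
    {σ0 : Finset Pt3} (hσ0 : σ0 ∈ T) (hn : σ0 ∉ Fam) {p q A : Pt3} (hsl : c.Slice σ0 p A q)
    (hp : p ∈ convexHull ℝ (S' : Set Pt3)) (hA : A ∈ convexHull ℝ (S' : Set Pt3)) (hq : q ∈ S') :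
    Fam.card + 1 ≤ S'.card - 2 := by
  have hdet : c.det (p - q) (A - q) ≠ 0 := by
    have := hsl.rot.rot.2.2.2.1
    exact this
  obtain ⟨t, ht0, ht1, ht⟩ := c.generic_dir (hsl.2.2.1) hsl.1 hsl.2.1 hdet
    ((S' ×ˢ S').image fun z => z.1 - z.2) (by
      intro w hw
      obtain ⟨z, hz, rfl⟩ := Finset.mem_image.1 hw
      rw [Finset.mem_product] at hz
      simp [c.S_Z (hS' hz.1), c.S_Z (hS' hz.2)])
  have hg : ∀ a ∈ S', ∀ b ∈ S', a ≠ b → c.det ((1 - t) • p + t • A - q) (a - b) ≠ 0 :=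
    fun a ha b hb hab => ht _ (Finset.mem_image.2 ⟨(a, b), by simp [ha, hb], rfl⟩)
      (sub_ne_zero.2 hab)
  set d := (1 - t) • p + t • A - q with hd
  have hZd : c.Z d = 0 := by simp [hd, hsl.1, hsl.2.1, hsl.2.2.1]
  have mono : convexHull ℝ (S' : Set Pt3) ⊆ convexHull ℝ (S : Set Pt3) :=
    convexHull_mono (by exact_mod_cast hS')
  rw [← Finset.card_insert_of_notMem hn]
  have := Frame.count_lab (S := S') (Pe := ∅) hZd
    (fun q hq w hw h1 h2 => c.S_ext (hS' hq) hw (mono h1) (mono h2)) (insert σ0 Fam)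
    (fun σ hσ τ hτ hne => hT.1.2.1 σ (by
        rcases Finset.mem_insert.1 hσ with rfl | h
        · exact hσ0
        · exact hF h) τ (by
        rcases Finset.mem_insert.1 hτ with rfl | h
        · exact hσ0
        · exact hF h) hne) ?_
  · simpa using this
  intro σ hσ
  rcases Finset.mem_insert.1 hσ with rfl | hσ
  · have e1 : c.det d p = c.det d q - t * c.det (p - q) (A - q) := by
      simp only [hd, Frame.det, map_sub, map_add, map_smul, smul_eq_mul]; ring
    have e2 : c.det d A = c.det d q + (1 - t) * c.det (p - q) (A - q) := by
      simp only [hd, Frame.det, map_sub, map_add, map_smul, smul_eq_mul]; ring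
    rcases lt_or_gt_of_ne hdet with hneg | hpos
    · have h1 := mul_neg_of_pos_of_neg ht0 hneg
      have h2 := mul_neg_of_pos_of_neg (sub_pos.2 ht1) hneg
      exact ⟨A, q, p, hsl.rot, hA, hp, by rw [e2]; linarith, by rw [e1]; linarith, Or.inl hq⟩
    · have h1 := mul_pos ht0 hpos
      have h2 := mul_pos (sub_pos.2 ht1) hpos
      exact ⟨p, q, A, hsl.rot.rot.swap, hp, hA, by rw [e1]; linarith, by rw [e2]; linarith, Or.inl hq⟩
  · obtain ⟨A, B, C, hA, hB, hC, hsl⟩ := hs σ hσ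
    have hd := slice_distinct hsl
    obtain ⟨A, B, C, h1, h2, h3, h4, h5, h6⟩ := hsl.sort (d := d) (S' : Set Pt3)
      hA hB hC (hg _ hA _ hB hd.1) (hg _ hB _ hC hd.2.1) (hg _ hA _ hC hd.2.2)
    exact ⟨A, B, C, h1, subset_convexHull ℝ _ h2, subset_convexHull ℝ _ h4, h5, h6, Or.inl h3⟩

end Cfg


theorem Tet4.swap34 {a b c d : Pt3} (h : Tet4 a b c d) : Tet4 a b d c := by
  intro w x y z h1 h2
  have := h w x z y (by linarith) (by rw [← h2]; abel)
  tauto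

theorem tet_triple {σ : Finset Pt3} (h : IsTet σ) {a b q : Pt3} (ha : a ∈ σ) (hb : b ∈ σ)
    (hq : q ∈ σ) (hab : a ≠ b) (haq : a ≠ q) (hbq : b ≠ q) :
    ∃ d, σ = {a, b, d, q} ∧ Tet4 a b d q := by
  obtain ⟨x, y, hs, ht⟩ := tet_pair h ha hb hab
  rw [hs] at hq
  simp only [Finset.mem_insert, Finset.mem_singleton] at hq
  rcases hq with rfl | rfl | rfl | rfl
  · exact absurd rfl haq
  · exact absurd rfl hbq
  · refine ⟨y, ?_, ht.swap34⟩
    rw [hs]; ext z; simp only [Finset.mem_insert, Finset.mem_singleton]; tauto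
  · exact ⟨x, hs, ht⟩

namespace Cfg
variable {m : ℕ} {S : Finset Pt3} {v1 v2 u1 u2 : Pt3} (c : Cfg m S v1 v2 u1 u2)
variable {T : Finset (Finset Pt3)}

def prs (v1 v2 u1 u2 : Pt3) (T : Finset (Finset Pt3)) : Finset (Pt3 × Pt3) :=
  (({v1, v2} : Finset Pt3) ×ˢ ({u1, u2} : Finset Pt3)).filter
    (fun z => ∃ σ ∈ T, z.1 ∈ σ ∧ z.2 ∈ σ)

theorem mem_prs {v u : Pt3} : (v, u) ∈ prs v1 v2 u1 u2 T ↔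
    ((v = v1 ∨ v = v2) ∧ (u = u1 ∨ u = u2)) ∧ ∃ σ ∈ T, v ∈ σ ∧ u ∈ σ := by
  simp [prs]

theorem IsM.pair {σ : Finset Pt3} (h : IsM v1 v2 u1 u2 σ) :
    ∃ v u, (v = v1 ∨ v = v2) ∧ (u = u1 ∨ u = u2) ∧ v ∈ σ ∧ u ∈ σ := by
  obtain ⟨h1, h2⟩ := h
  rcases h1 with h1 | h1 <;> rcases h2 with h2 | h2
  · exact ⟨_, _, Or.inl rfl, Or.inl rfl, h1, h2⟩
  · exact ⟨_, _, Or.inl rfl, Or.inr rfl, h1, h2⟩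
  · exact ⟨_, _, Or.inr rfl, Or.inl rfl, h1, h2⟩
  · exact ⟨_, _, Or.inr rfl, Or.inr rfl, h1, h2⟩

theorem bound1 (c : Cfg m S v1 v2 u1 u2) (hT : IsTriangulation (VV S v1 v2 u1 u2) T) :
    (T.filter fun σ => IsA v1 v2 u1 u2 σ ∨ IsM v1 v2 u1 u2 σ).card ≤
      m - 2 + 2 * (prs v1 v2 u1 u2 T).card := by
  have h := c.count_I hT ((prs v1 v2 u1 u2 T).image fun z => c.pp z.1 z.2) ?_
    (T.filter fun σ => IsA v1 v2 u1 u2 σ ∨ IsM v1 v2 u1 u2 σ) (Finset.filter_subset _ _) ?_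
  · have := Finset.card_image_le (s := prs v1 v2 u1 u2 T) (f := fun z => c.pp z.1 z.2)
    omega
  · intro p hp
    obtain ⟨⟨v, u⟩, hz, rfl⟩ := Finset.mem_image.1 hp
    have := mem_prs.1 hz
    exact c.pp_conv this.1.1 this.1.2
  · intro σ hσ
    obtain ⟨hσ, h | h⟩ := Finset.mem_filter.1 hσ
    · obtain ⟨v, A, B, C, -, -, hA, hB, hC, -, hs⟩ := c.avSlice hT hσ h
      exact ⟨A, B, C, Finset.mem_union_left _ hA, Finset.mem_union_left _ hB,
        Finset.mem_union_left _ hC, hs⟩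
    · obtain ⟨v, u, hv, hu, hvs, hus⟩ := h.pair
      obtain ⟨a, b, hs, ht⟩ := tet_pair (hT.1.1 σ hσ).1 hvs hus (c.vu_ne hv hu)
      have haσ : a ∈ σ := by simp [hs]
      have hbσ : b ∈ σ := by simp [hs]
      have ha := mem_cases hT hσ haσ
      have hb := mem_cases hT hσ hbσ
      have mp : ∀ v u, (v = v1 ∨ v = v2) → (u = u1 ∨ u = u2) → v ∈ σ → u ∈ σ →
          c.pp v u ∈ S ∪ (prs v1 v2 u1 u2 T).image fun z => c.pp z.1 z.2 := by
        intro v u hv hu h1 h2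
        exact Finset.mem_union_right _ (Finset.mem_image.2
          ⟨(v, u), mem_prs.2 ⟨⟨hv, hu⟩, σ, hσ, h1, h2⟩, rfl⟩)
      have mj : ∀ r ∈ σ, c.pj v u r ∈ S ∪ (prs v1 v2 u1 u2 T).image fun z => c.pp z.1 z.2 := by
        intro r hr
        rcases mem_cases hT hσ hr with h | h | h
        · rw [c.pj_S h]; exact Finset.mem_union_left _ h
        · rw [c.pj_v h]; exact mp _ _ h hu hr hus
        · rw [c.pj_u h]; exact mp _ _ hv h hvs hr
      refine ⟨_, _, _, mp v u hv hu hvs hus, mj a haσ, mj b hbσ, ?_⟩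
      have := c.mixSlice hv hu ha hb ht
      rwa [← hs] at this

theorem bound2 (c : Cfg m S v1 v2 u1 u2) (hT : IsTriangulation (VV S v1 v2 u1 u2) T) :
    (T.filter (IsA v1 v2 u1 u2)).card ≤ m - 2 := by
  have h := c.count_I hT ∅ (by simp) (T.filter (IsA v1 v2 u1 u2)) (Finset.filter_subset _ _) ?_
  · simpa using h
  · intro σ hσ
    obtain ⟨hσ, h⟩ := Finset.mem_filter.1 hσ
    obtain ⟨v, A, B, C, -, -, hA, hB, hC, -, hs⟩ := c.avSlice hT hσ h
    exact ⟨A, B, C, Finset.mem_union_left _ hA, Finset.mem_union_left _ hB,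
        Finset.mem_union_left _ hC, hs⟩

theorem mix_q (c : Cfg m S v1 v2 u1 u2) (hT : IsTriangulation (VV S v1 v2 u1 u2) T)
    {σ : Finset Pt3} (hσ : σ ∈ T) {v u q : Pt3} (hv : v = v1 ∨ v = v2) (hu : u = u1 ∨ u = u2)
    (hvs : v ∈ σ) (hus : u ∈ σ) (hq : q ∈ S) (hqs : q ∈ σ) : ∃ a, σ = {v, u, a, q} ∧
      c.Slice σ (c.pp v u) (c.pj v u a) q ∧ Tet4 v u a q := by
  obtain ⟨a, hs, ht⟩ := tet_triple (hT.1.1 σ hσ).1 hvs hus hqs (c.vu_ne hv hu)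
    (fun h => c.v_notS hv (h ▸ hq)) (fun h => c.u_notS hu (h ▸ hq))
  have ha := mem_cases hT hσ (show a ∈ σ by simp [hs])
  have := c.mixSlice hv hu ha (Or.inl hq) ht
  rw [← hs, c.pj_S hq] at this
  exact ⟨a, hs, this, ht⟩

theorem bound3 (c : Cfg m S v1 v2 u1 u2) (hT : IsTriangulation (VV S v1 v2 u1 u2) T)
    {σ : Finset Pt3} (hσ : σ ∈ T) (hM : IsM v1 v2 u1 u2 σ) {q : Pt3} (hq : q ∈ S) (hqs : q ∈ σ) :
    (T.filter (IsA v1 v2 u1 u2)).card + 1 ≤ m - 2 := by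
  obtain ⟨v, u, hv, hu, hvs, hus⟩ := hM.pair
  obtain ⟨a, hs, hsl, -⟩ := c.mix_q hT hσ hv hu hvs hus hq hqs
  have ha := mem_cases hT hσ (show a ∈ σ by simp [hs])
  rw [← c.card_S]
  refine c.count_III hT (subset_refl S) _ (Finset.filter_subset _ _) ?_ hσ ?_ hsl
    (c.pp_conv hv hu) (c.pj_conv hv hu ha) hq
  · intro σ hσ
    obtain ⟨hσ, h⟩ := Finset.mem_filter.1 hσ
    obtain ⟨v, A, B, C, -, -, hA, hB, hC, -, hs⟩ := c.avSlice hT hσ h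
    exact ⟨A, B, C, hA, hB, hC, hs⟩
  · intro h
    have := (Finset.mem_filter.1 h).2
    rcases hM.2 with h | h
    · exact this.2.2.1 h
    · exact this.2.2.2 h

/-! chord through two polygon vertices -/

theorem line_conv {q q' : Pt3} (hq : q ∈ S) (hq' : q' ∈ S) (hne : q ≠ q') {s : Pt3}
    (hs : s ∈ convexHull ℝ (S : Set Pt3)) (h : c.det (q' - q) (s - q) = 0) :
    ∃ l : ℝ, 0 ≤ l ∧ l ≤ 1 ∧ s = q + l • (q' - q) := by
  obtain ⟨l, hl⟩ := c.planar_par (by simp [c.S_Z hq, c.S_Z hq'])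
    (by simp [c.conv_Z hs, c.S_Z hq]) (sub_ne_zero.2 (Ne.symm hne)) h
  have es : s = q + l • (q' - q) := by rw [← hl]; abel
  have h1 := c.S_circ hq
  have h2 := c.S_circ hq'
  have h3 := c.conv_circ hs
  have hpos : 0 < (c.X q' - c.X q) ^ 2 + (c.Y q' - c.Y q) ^ 2 := by
    by_contra hn
    have hx : (c.X q' - c.X q) ^ 2 = 0 := by nlinarith [sq_nonneg (c.X q' - c.X q), sq_nonneg (c.Y q' - c.Y q)]
    have hy : (c.Y q' - c.Y q) ^ 2 = 0 := by nlinarith [sq_nonneg (c.X q' - c.X q), sq_nonneg (c.Y q' - c.Y q)]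
    exact hne (c.inj _ _ (by have := pow_eq_zero_iff (two_ne_zero) |>.1 hx; linarith)
      (by have := pow_eq_zero_iff (two_ne_zero) |>.1 hy; linarith)
      (by rw [c.S_Z hq, c.S_Z hq']))
  rw [es] at h3
  simp only [map_add, map_smul, map_sub, smul_eq_mul] at h3
  have key : l * (l - 1) * ((c.X q' - c.X q) ^ 2 + (c.Y q' - c.Y q) ^ 2) ≤ 0 := by
    linear_combination h3 + (l - 1) * h1 - l * h2
  have key2 : l * (l - 1) ≤ 0 := by
    by_contra hn
    have := mul_pos (not_le.1 hn) hpos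
    linarith
  exact ⟨l, by nlinarith, by nlinarith, es⟩

theorem half_conv {q q' : Pt3} (hq : q ∈ S) (hq' : q' ∈ S) (hne : q ≠ q') (sg : ℝ) (hsg : sg ≠ 0)
    {x : Pt3} (hx : x ∈ convexHull ℝ (S : Set Pt3)) (hgx : 0 ≤ sg * c.det (q' - q) (x - q)) :
    x ∈ convexHull ℝ ((S.filter fun p => 0 ≤ sg * c.det (q' - q) (p - q) : Finset Pt3) : Set Pt3) := by
  set g : Pt3 → ℝ := fun p => sg * c.det (q' - q) (p - q) with hg
  set L := S.filter fun p => 0 ≤ g p with hL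
  have gq : g q = 0 := by simp [hg, Frame.det]
  have gq' : g q' = 0 := by simp [hg, Frame.det]; right; ring
  have gaff : ∀ a b : ℝ, ∀ x y, a + b = 1 → g (a • x + b • y) = a * g x + b * g y := by
    intro a b x y hab
    have : a = 1 - b := by linarith
    subst this
    simp only [hg, Frame.det, map_sub, map_add, map_smul, smul_eq_mul]; ring
  have hqL : q ∈ L := by simp [hL, hq, gq]
  have hqL' : q' ∈ L := by simp [hL, hq', gq']
  by_cases hR : (S.filter fun p => ¬ 0 ≤ g p) = ∅
  · have : S = L := by
      rw [hL, Finset.filter_true_of_mem]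
      intro p hp
      by_contra hn
      have : p ∈ S.filter fun p => ¬ 0 ≤ g p := by simp only [Finset.mem_filter]; exact ⟨hp, hn⟩
      rw [hR] at this
      simp at this
    rw [← this]; exact hx
  have hne' : ((S.filter fun p => ¬ 0 ≤ g p : Finset Pt3) : Set Pt3).Nonempty := by
    rw [Finset.coe_nonempty]; exact Finset.nonempty_iff_ne_empty.2 hR
  have hSU : (S : Set Pt3) = (L : Set Pt3) ∪ ((S.filter fun p => ¬ 0 ≤ g p : Finset Pt3) : Set Pt3) := by
    rw [← Finset.coe_union, hL, Finset.filter_union_filter_not_eq]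
  have hx' := hx
  rw [hSU, convexHull_union ⟨q, hqL⟩ hne', mem_convexJoin] at hx'
  obtain ⟨a, ha, b, hb, s, t, hs, ht, hst, rfl⟩ := hx'
  have gb : g b < 0 := by
    have : b ∈ {p | g p < 0} := by
      refine convexHull_min ?_ ?_ hb
      · intro p hp
        simp only [Finset.coe_filter, mem_ofPred_eq, not_le] at hp
        exact hp.2
      · intro x hx y hy a b ha hb hab
        simp only [mem_ofPred_eq] at *
        rw [gaff a b x y hab]
        rcases ha.eq_or_lt with rfl | ha
        · have : b = 1 := by linarith
          subst this; linarith
        · nlinarith [mul_neg_of_pos_of_neg ha hx, mul_nonneg hb (neg_nonneg.2 hy.le)]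
    exact this
  have gx := gaff s t a b hst
  have hgx' : 0 ≤ g (s • a + t • b) := hgx
  rw [gx] at hgx'
  rcases ht.eq_or_lt with rfl | ht
  · have : s = 1 := by linarith
    subst this; simpa using ha
  have ga : 0 < s * g a := by nlinarith [mul_neg_of_pos_of_neg ht gb]
  have spos : 0 < s := by
    rcases hs.eq_or_lt with rfl | h
    · simp at ga
    · exact h
  have ga' : 0 < g a := by by_contra hn; nlinarith
  -- crossing point
  have hden : 0 < g a - g b := by linarith
  set r : ℝ := g a / (g a - g b) with hr
  have hr0 : 0 < r := by positivity
  have hr1 : r < 1 := by rw [hr, div_lt_one hden]; linarith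
  have hrg : r * (g a - g b) = g a := by rw [hr]; field_simp
  have mL : convexHull ℝ (L : Set Pt3) ⊆ convexHull ℝ (S : Set Pt3) :=
    convexHull_mono (by rw [hSU]; exact subset_union_left)
  have mR : convexHull ℝ ((S.filter fun p => ¬ 0 ≤ g p : Finset Pt3) : Set Pt3) ⊆
      convexHull ℝ (S : Set Pt3) := convexHull_mono (by
        rw [Finset.coe_subset]; exact Finset.filter_subset _ _)
  have hz : (1 - r) • a + r • b ∈ convexHull ℝ (S : Set Pt3) :=
    convex_convexHull ℝ _ (mL ha) (mR hb) (by linarith) hr0.le (by ring)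
  have gz : g ((1 - r) • a + r • b) = 0 := by
    rw [gaff _ _ _ _ (by ring)]; linarith
  obtain ⟨l, l0, l1, el⟩ := c.line_conv hq hq' hne hz (by
    have : sg * c.det (q' - q) ((1 - r) • a + r • b - q) = 0 := gz
    exact (mul_eq_zero.1 this).resolve_left hsg)
  have hzL : (1 - r) • a + r • b ∈ convexHull ℝ (L : Set Pt3) := by
    rw [el, show q + l • (q' - q) = (1 - l) • q + l • q' by module]
    exact convex_convexHull ℝ _ (subset_convexHull ℝ _ hqL) (subset_convexHull ℝ _ hqL')
      (by linarith) l0 (by ring)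
  have htr : t ≤ r := by
    rw [hr, le_div_iff₀ hden]
    have : s = 1 - t := by linarith
    subst this
    nlinarith
  have := convex_convexHull ℝ (L : Set Pt3) ha hzL
    (show 0 ≤ 1 - t / r by rw [sub_nonneg, div_le_one hr0]; exact htr)
    (show 0 ≤ t / r by positivity) (by ring)
  convert this using 1
  have : s = 1 - t := by linarith
  subst this
  rw [smul_add, smul_smul, smul_smul, ← add_assoc, ← add_smul]
  congr 2
  · field_simp; ring
  · field_simp

end Cfg


namespace Cfg
variable {m : ℕ} {S : Finset Pt3} {v1 v2 u1 u2 : Pt3} (c : Cfg m S v1 v2 u1 u2)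
variable {T : Finset (Finset Pt3)}

theorem start_tet {V : Finset Pt3} (hT : IsTriangulation V T) {M p : Pt3}
    (hM : M ∈ convexHull ℝ (V : Set Pt3)) (hp : p ∈ convexHull ℝ (V : Set Pt3)) :
    ∃ τ ∈ T, ∃ η : ℝ, 0 < η ∧ η < 1 ∧ M ∈ convexHull ℝ (τ : Set Pt3) ∧
      (1 - η) • M + η • p ∈ convexHull ℝ (τ : Set Pt3) := by
  have h1 : ∀ τ ∈ T, ∀ᶠ x in 𝓝 M, x ∈ convexHull ℝ (τ : Set Pt3) →
      M ∈ convexHull ℝ (τ : Set Pt3) := by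
    intro τ _
    by_cases h : M ∈ convexHull ℝ (τ : Set Pt3)
    · exact Eventually.of_forall fun _ _ => h
    · have hc : IsClosed (convexHull ℝ (τ : Set Pt3)) := Set.Finite.isClosed_convexHull ℝ (Finset.finite_toSet τ)
      filter_upwards [hc.isOpen_compl.mem_nhds h] with x hx hx'
      exact absurd hx' hx
  have h2 := (eventually_all_finset T).2 h1
  have hcont : Tendsto (fun η : ℝ => (1 - η) • M + η • p) (𝓝[>] 0) (𝓝 M) := by
    have : Continuous fun η : ℝ => (1 - η) • M + η • p := by fun_prop
    have := this.tendsto 0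
    simp only [sub_zero, one_smul, zero_smul, add_zero] at this
    exact this.mono_left nhdsWithin_le_nhds
  have h3 := hcont.eventually h2
  have h4 : ∀ᶠ η in 𝓝[>] (0:ℝ), 0 < η ∧ η < 1 := Ioo_mem_nhdsGT one_pos
  obtain ⟨η, h5, h6, h7⟩ := (h3.and h4).exists
  have hx : (1 - η) • M + η • p ∈ convexHull ℝ (V : Set Pt3) :=
    convex_convexHull ℝ _ hM hp (by linarith) h6.le (by ring)
  rw [← hT.1.2.2] at hx
  simp only [mem_iUnion] at hx
  obtain ⟨τ, hτ, hx⟩ := hx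
  exact ⟨τ, hτ, η, h6, h7, h5 τ hτ hx, hx⟩

theorem top_mem (c : Cfg m S v1 v2 u1 u2) (hT : IsTriangulation (VV S v1 v2 u1 u2) T)
    {τ : Finset Pt3} (hτ : τ ∈ T)
    {a b : ℝ} (ha : 0 < a) (hb : 0 < b) (hab : a + b = 1)
    (h : a • v1 + b • v2 ∈ convexHull ℝ (τ : Set Pt3)) : v1 ∈ τ ∧ v2 ∈ τ := by
  rw [Finset.mem_convexHull'] at h
  obtain ⟨w, w0, w1, hw⟩ := h
  have hh := c.hpos
  have hk := c.kpos
  have hxv := c.xv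
  have hZle : ∀ p ∈ τ, c.Z p ≤ c.h := by
    intro p hp
    rcases mem_cases hT hτ hp with h | h | h
    · rw [c.S_Z h]; exact hh.le
    · rw [c.zv h]
    · rw [c.zu h]; linarith
  have hs : ∑ p ∈ τ, w p * (c.h - c.Z p) = 0 := by
    have e := congrArg c.Z hw
    simp only [map_sum, map_smul, smul_eq_mul, map_add, c.zv1, c.zv2] at e
    simp only [mul_sub, Finset.sum_sub_distrib, ← Finset.sum_mul, w1]
    rw [e]; linear_combination (-c.h) * hab
  have hz := (Finset.sum_eq_zero_iff_of_nonneg (fun p hp =>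
    mul_nonneg (w0 p hp) (sub_nonneg.2 (hZle p hp)))).1 hs
  have hv : ∀ p ∈ τ, w p ≠ 0 → p = v1 ∨ p = v2 := by
    intro p hp hwp
    have h0 := (mul_eq_zero.1 (hz p hp)).resolve_left hwp
    rcases mem_cases hT hτ hp with h | h | h
    · rw [c.S_Z h] at h0; linarith
    · exact h
    · rw [c.zu h] at h0; linarith
  have e := congrArg c.X hw
  simp only [map_sum, map_smul, smul_eq_mul, map_add] at e
  constructor
  · by_contra hn
    have : ∑ p ∈ τ, w p * c.X p = ∑ p ∈ τ, w p * c.X v2 := by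
      refine Finset.sum_congr rfl fun p hp => ?_
      by_cases hwp : w p = 0
      · simp [hwp]
      · rcases hv p hp hwp with rfl | rfl
        · exact absurd hp hn
        · rfl
    rw [this, ← Finset.sum_mul, w1] at e
    have hb' : b = 1 - a := by linarith
    subst hb'
    have := mul_pos ha (sub_pos.2 hxv)
    linarith
  · by_contra hn
    have : ∑ p ∈ τ, w p * c.X p = ∑ p ∈ τ, w p * c.X v1 := by
      refine Finset.sum_congr rfl fun p hp => ?_
      by_cases hwp : w p = 0
      · simp [hwp]
      · rcases hv p hp hwp with rfl | rfl
        · rfl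
        · exact absurd hp hn
    rw [this, ← Finset.sum_mul, w1] at e
    have hb' : a = 1 - b := by linarith
    subst hb'
    have := mul_pos hb (sub_pos.2 hxv)
    linarith

theorem no_cross (c : Cfg m S v1 v2 u1 u2) (hT : IsTriangulation (VV S v1 v2 u1 u2) T)
    {σ τ : Finset Pt3} (hσ : σ ∈ T) (hτ : τ ∈ T) {v u : Pt3} (hv : v ∈ σ) (hu : u ∈ σ) {ε : ℝ}
    (h0 : 0 < ε) (h1 : ε ≤ 1) (h : (1 - ε) • v + ε • c.pp v u ∈ convexHull ℝ (τ : Set Pt3)) :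
    u ∈ convexHull ℝ (τ : Set Pt3) := by
  have hh := c.hpos
  have hk := c.kpos
  have hq : 0 < c.h / (c.h + c.k) := by positivity
  have hq1 : c.k / (c.h + c.k) = 1 - c.h / (c.h + c.k) := by field_simp; ring
  have hq2 : 0 < c.k / (c.h + c.k) := by positivity
  refine (face_ext hT hσ hτ (subset_convexHull ℝ _ hv) (subset_convexHull ℝ _ hu)
    (z := (1 - ε) • v + ε • c.pp v u) ?_ h).2
  refine ⟨1 - ε * (c.h / (c.h + c.k)), ε * (c.h / (c.h + c.k)), ?_, by positivity, by ring, ?_⟩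
  · nlinarith
  · rw [pp, hq1]; module

theorem ext_mid (c : Cfg m S v1 v2 u1 u2) {p x y : Pt3} (hp : p ∈ S)
    (hx : x ∈ convexHull ℝ (S : Set Pt3)) (hy : y ∈ convexHull ℝ (S : Set Pt3)) (hxy : x ≠ y)
    {r : ℝ} (h0 : 0 < r) (h1 : r < 1) (h : p = (1 - r) • x + r • y) : False := by
  refine c.S_ext (w := (r * (1 - r)) • (y - x)) hp ?_ ?_ ?_
  · rw [Ne, smul_eq_zero, sub_eq_zero]
    have := mul_pos h0 (sub_pos.2 h1)
    rintro (h | h)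
    · linarith
    · exact hxy h.symm
  · have := convex_convexHull ℝ (S : Set Pt3) hx hy (sq_nonneg (1 - r))
      (show 0 ≤ r * (2 - r) by nlinarith) (by ring)
    convert this using 1
    rw [h]; module
  · have := convex_convexHull ℝ (S : Set Pt3) hx hy
      (show 0 ≤ (1 - r) * (1 + r) by nlinarith) (sq_nonneg r) (by ring)
    convert this using 1
    rw [h]; module

theorem chord_cross (c : Cfg m S v1 v2 u1 u2) (hT : IsTriangulation (VV S v1 v2 u1 u2) T)
    {σ τ : Finset Pt3} (hσ : σ ∈ T) (hτ : τ ∈ T) {q q' : Pt3} (hq : q ∈ S) (hq' : q' ∈ S)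
    (hne : q ≠ q') (hqτ : q ∈ τ) (hqτ' : q' ∈ τ) {x y : Pt3}
    (hx : x ∈ convexHull ℝ (S : Set Pt3)) (hy : y ∈ convexHull ℝ (S : Set Pt3))
    (hxσ : x ∈ convexHull ℝ (σ : Set Pt3)) (hyσ : y ∈ convexHull ℝ (σ : Set Pt3))
    (h : c.det (q' - q) (x - q) * c.det (q' - q) (y - q) < 0) : q ∈ σ ∧ q' ∈ σ := by
  set gx := c.det (q' - q) (x - q) with hgx
  set gy := c.det (q' - q) (y - q) with hgy
  have hxy : x ≠ y := by
    rintro rfl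
    nlinarith [mul_self_nonneg gx]
  have hd : gx - gy ≠ 0 := by
    intro h0
    have : gx = gy := by linarith
    rw [this] at h
    nlinarith [mul_self_nonneg gy]
  set r := gx / (gx - gy) with hr
  have hr' : r * (gx - gy) = gx := by rw [hr]; field_simp
  have hr0 : 0 < r ∧ r < 1 := by
    rcases lt_or_gt_of_ne hd with h1 | h1
    · have hx0 : gx < 0 := by by_contra hn; nlinarith
      have hy0 : 0 < gy := by by_contra hn; nlinarith
      exact ⟨div_pos_of_neg_of_neg hx0 h1, by rw [hr, div_lt_one_of_neg h1]; linarith⟩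
    · have hx0 : 0 < gx := by by_contra hn; nlinarith
      have hy0 : gy < 0 := by by_contra hn; nlinarith
      exact ⟨div_pos hx0 h1, by rw [hr, div_lt_one h1]; linarith⟩
  have hz : (1 - r) • x + r • y ∈ convexHull ℝ (S : Set Pt3) :=
    convex_convexHull ℝ _ hx hy (by linarith) hr0.1.le (by ring)
  have hzσ : (1 - r) • x + r • y ∈ convexHull ℝ (σ : Set Pt3) :=
    convex_convexHull ℝ _ hxσ hyσ (by linarith) hr0.1.le (by ring)
  have gz : c.det (q' - q) ((1 - r) • x + r • y - q) = 0 := by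
    have : c.det (q' - q) ((1 - r) • x + r • y - q) = (1 - r) * gx + r * gy := by
      simp only [hgx, hgy, Frame.det, map_sub, map_add, map_smul, smul_eq_mul]; ring
    rw [this]; linarith
  obtain ⟨l, l0, l1, el⟩ := c.line_conv hq hq' hne hz gz
  rcases l0.eq_or_lt with rfl | l0
  · exact (c.ext_mid hq hx hy hxy hr0.1 hr0.2 (by rw [el]; module)).elim
  rcases l1.eq_or_lt with rfl | l1
  · exact (c.ext_mid hq' hx hy hxy hr0.1 hr0.2 (by rw [el]; module)).elim
  have := face_ext hT hτ hσ (subset_convexHull ℝ _ hqτ) (subset_convexHull ℝ _ hqτ')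
    (z := (1 - r) • x + r • y) ⟨1 - l, l, by linarith, l0, by ring, by rw [el]; module⟩ hzσ
  exact ⟨face_vertex hT hτ hσ hqτ this.1, face_vertex hT hτ hσ hqτ' this.2⟩

theorem side_count (c : Cfg m S v1 v2 u1 u2) (hT : IsTriangulation (VV S v1 v2 u1 u2) T)
    (hno : ∀ σ ∈ T, IsM v1 v2 u1 u2 σ → ¬ (v1 ∈ σ ∧ v2 ∈ σ))
    {τ : Finset Pt3} (hτ : τ ∈ T) {q q' : Pt3} (hq : q ∈ S) (hq' : q' ∈ S)
    (hne : q ≠ q') (hqτ : q ∈ τ) (hqτ' : q' ∈ τ) {v : Pt3} (hv : v = v1 ∨ v = v2)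
    {σ : Finset Pt3} (hσ : σ ∈ T) (hvs : v ∈ σ) (hus : u1 ∈ σ)
    {sg : ℝ} (hsg : sg = c.det (q' - q) (c.pp v u1 - q)) (hsg0 : sg ≠ 0) :
    (T.filter fun ρ => IsA v1 v2 u1 u2 ρ ∧ ∀ x ∈ ρ, x ∈ S →
      0 ≤ sg * c.det (q' - q) (x - q)).card + 1 ≤
    (S.filter fun p => 0 ≤ sg * c.det (q' - q) (p - q)).card - 2 := by
  have hM : IsM v1 v2 u1 u2 σ := ⟨by rcases hv with rfl | rfl <;> tauto, Or.inl hus⟩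
  have hn2 := hno σ hσ hM
  have hu : u1 = u1 ∨ u1 = u2 := Or.inl rfl
  -- a polygon vertex of σ
  have hex : ∃ q0 ∈ S, q0 ∈ σ := by
    obtain ⟨a, b, hs, ht⟩ := tet_pair (hT.1.1 σ hσ).1 hvs hus (c.vu_ne hv hu)
    have hd := ht.distinct
    have key : ∀ r ∈ σ, r ≠ v → r ≠ u1 → r ∈ S ∨ r = u2 := by
      intro r hr h1 h2
      rcases mem_cases hT hσ hr with h | h | h
      · exact Or.inl h
      · exfalso
        rcases hv with rfl | rfl <;> rcases h with rfl | rfl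
        · exact h1 rfl
        · exact hn2 ⟨hvs, hr⟩
        · exact hn2 ⟨hr, hvs⟩
        · exact h1 rfl
      · rcases h with h | h
        · exact absurd h h2
        · exact Or.inr h
    have haσ : a ∈ σ := by simp [hs]
    have hbσ : b ∈ σ := by simp [hs]
    rcases key a haσ hd.2.1.symm hd.2.2.2.1.symm with h | h
    · exact ⟨a, h, haσ⟩
    rcases key b hbσ hd.2.2.1.symm hd.2.2.2.2.1.symm with h' | h'
    · exact ⟨b, h', hbσ⟩
    · exact absurd (h.trans h'.symm) hd.2.2.2.2.2
  obtain ⟨q0, hq0, hq0σ⟩ := hex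
  obtain ⟨a, hs, hsl, ht⟩ := c.mix_q hT hσ hv hu hvs hus hq0 hq0σ
  have haσ : a ∈ σ := by simp [hs]
  have ha := mem_cases hT hσ haσ
  have hd := ht.distinct
  have gq : c.det (q' - q) (q - q) = 0 := by simp [Frame.det]
  have gq' : c.det (q' - q) (q' - q) = 0 := by simp [Frame.det]; ring
  have conv_pp : c.pp v u1 ∈ convexHull ℝ (σ : Set Pt3) := by
    have hh := c.hpos
    have hk := c.kpos
    exact convex_convexHull ℝ _ (subset_convexHull ℝ _ hvs) (subset_convexHull ℝ _ hus)
      (by positivity) (by positivity) (by field_simp; ring)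
  have conv_pj : c.pj v u1 a ∈ convexHull ℝ (σ : Set Pt3) := by
    obtain ⟨x1, x2, x3, h1, h2, h3, h4, h5⟩ := c.pj_weights (v := v) (u := u1) ha
    rw [h5, hs]
    have := mem_conv_four (a := v) (b := u1) (c := a) (d := q0) h1 h2 h3.le (le_refl 0) (by linarith)
    convert this using 1; module
  have qq : q ∈ σ → q' ∈ σ → (q0 = q ∨ q0 = q') ∧ (a = q ∨ a = q') := by
    intro h1 h2
    have n1 : ∀ r ∈ S, r ≠ v ∧ r ≠ u1 := fun r hr =>
      ⟨fun h => c.v_notS hv (h ▸ hr), fun h => c.u_notS hu (h ▸ hr)⟩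
    have := n1 q hq
    have := n1 q' hq'
    rw [hs] at h1 h2
    simp only [Finset.mem_insert, Finset.mem_singleton] at h1 h2
    grind
  have sgsq : 0 < sg * sg := mul_self_pos.2 hsg0
  have neg_mul : ∀ y, sg * y < 0 → sg * y < 0 := fun y h => h
  have g0 : 0 ≤ sg * c.det (q' - q) (q0 - q) := by
    by_contra hn
    have := c.chord_cross hT hσ hτ hq hq' hne hqτ hqτ' (c.pp_conv hv hu)
      (subset_convexHull ℝ _ hq0) conv_pp (subset_convexHull ℝ _ hq0σ)
      (by rw [← hsg]; exact not_le.1 hn)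
    rcases (qq this.1 this.2).1 with h | h
    · rw [h, gq] at hn; simp at hn
    · rw [h, gq'] at hn; simp at hn
  have ga : 0 ≤ sg * c.det (q' - q) (c.pj v u1 a - q) := by
    by_contra hn
    have := c.chord_cross hT hσ hτ hq hq' hne hqτ hqτ' (c.pp_conv hv hu)
      (c.pj_conv hv hu ha) conv_pp conv_pj
      (by rw [← hsg]; exact not_le.1 hn)
    rcases (qq this.1 this.2).2 with h | h
    · rw [h, c.pj_S hq, gq] at hn; simp at hn
    · rw [h, c.pj_S hq', gq'] at hn; simp at hn
  refine c.count_III hT (Finset.filter_subset _ _) _ (Finset.filter_subset _ _) ?_ hσ ?_ hsl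
    (c.half_conv hq hq' hne sg hsg0 (c.pp_conv hv hu) (by rw [← hsg]; exact sgsq.le))
    (c.half_conv hq hq' hne sg hsg0 (c.pj_conv hv hu ha) ga)
    (Finset.mem_filter.2 ⟨hq0, g0⟩)
  · intro ρ hρ
    obtain ⟨hρ, h1, h2⟩ := Finset.mem_filter.1 hρ
    obtain ⟨w, A, B, C, -, hs', hA, hB, hC, -, hsl'⟩ := c.avSlice hT hρ h1
    refine ⟨A, B, C, ?_, ?_, ?_, hsl'⟩
    · exact Finset.mem_filter.2 ⟨hA, h2 A (by simp [hs']) hA⟩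
    · exact Finset.mem_filter.2 ⟨hB, h2 B (by simp [hs']) hB⟩
    · exact Finset.mem_filter.2 ⟨hC, h2 C (by simp [hs']) hC⟩
  · intro h
    exact (Finset.mem_filter.1 h).2.1.2.2.1 hus

theorem bound4 (c : Cfg m S v1 v2 u1 u2) (hT : IsTriangulation (VV S v1 v2 u1 u2) T)
    (hno : ∀ σ ∈ T, IsM v1 v2 u1 u2 σ → ¬ (v1 ∈ σ ∧ v2 ∈ σ))
    (hall1 : ∃ σ ∈ T, v1 ∈ σ ∧ u1 ∈ σ) (hall2 : ∃ σ ∈ T, v2 ∈ σ ∧ u1 ∈ σ) :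
    (T.filter (IsA v1 v2 u1 u2)).card + 4 ≤ m := by
  obtain ⟨σ1, hσ1, hv1, hu1⟩ := hall1
  obtain ⟨σ2, hσ2, hv2, hu2⟩ := hall2
  have hh := c.hpos
  have hk := c.kpos
  have hu : u1 = u1 ∨ u1 = u2 := Or.inl rfl
  have hw1 : v1 = v1 ∨ v1 = v2 := Or.inl rfl
  have hw2 : v2 = v1 ∨ v2 = v2 := Or.inr rfl
  have inV : ∀ p ∈ VV S v1 v2 u1 u2, p ∈ convexHull ℝ ((VV S v1 v2 u1 u2 : Finset Pt3) : Set Pt3) :=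
    fun p hp => subset_convexHull ℝ _ hp
  have monoS : convexHull ℝ (S : Set Pt3) ⊆
      convexHull ℝ ((VV S v1 v2 u1 u2 : Finset Pt3) : Set Pt3) :=
    convexHull_mono (by rw [Finset.coe_subset]; exact Finset.subset_union_left)
  have p11 := c.pp_conv hw1 hu
  have p21 := c.pp_conv hw2 hu
  obtain ⟨τ, hτ, η, η0, η1, hM, hη⟩ := start_tet hT
    (M := (1/2 : ℝ) • v1 + (1/2 : ℝ) • v2)
    (p := (1/2 : ℝ) • c.pp v1 u1 + (1/2 : ℝ) • c.pp v2 u1)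
    (convex_convexHull ℝ _ (inV v1 (by simp [VV])) (inV v2 (by simp [VV])) (by norm_num)
      (by norm_num) (by norm_num))
    (convex_convexHull ℝ _ (monoS p11) (monoS p21) (by norm_num) (by norm_num) (by norm_num))
  obtain ⟨hv1τ, hv2τ⟩ := c.top_mem hT hτ (by norm_num) (by norm_num) (by norm_num) hM
  have hnu : u1 ∉ τ ∧ u2 ∉ τ := by
    constructor
    · intro h; exact hno τ hτ ⟨Or.inl hv1τ, Or.inl h⟩ ⟨hv1τ, hv2τ⟩
    · intro h; exact hno τ hτ ⟨Or.inl hv1τ, Or.inr h⟩ ⟨hv1τ, hv2τ⟩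
  obtain ⟨q, q', hs, ht⟩ := tet_pair (hT.1.1 τ hτ).1 hv1τ hv2τ c.v_ne
  have hd := ht.distinct
  have key : ∀ r ∈ τ, r ≠ v1 → r ≠ v2 → r ∈ S := by
    intro r hr h1 h2
    rcases mem_cases hT hτ hr with h | h | h
    · exact h
    · rcases h with h | h <;> contradiction
    · rcases h with rfl | rfl <;> tauto
  have hqτ : q ∈ τ := by simp [hs]
  have hqτ' : q' ∈ τ := by simp [hs]
  have hq := key q hqτ hd.2.1.symm hd.2.2.2.1.symm
  have hq' := key q' hqτ' hd.2.2.1.symm hd.2.2.2.2.1.symm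
  have hne := hd.2.2.2.2.2
  have hu1τ : u1 ∉ convexHull ℝ (τ : Set Pt3) := by
    intro h
    have : u1 ∈ {p | 0 ≤ c.Z p} := by
      refine convexHull_min ?_ ?_ h
      · intro p hp
        simp only [mem_ofPred_eq]
        rcases mem_cases hT hτ hp with h | h | h
        · rw [c.S_Z h]
        · rw [c.zv h]; exact hh.le
        · rcases h with rfl | rfl <;> tauto
      · exact convex_halfSpace_ge c.Z.isLinear 0
    simp only [mem_ofPred_eq, c.zu1] at this
    linarith
  have hη' := hη
  rw [hs] at hη'
  obtain ⟨a, b, x, y, ha, hb, hx, hy, hsum, heq⟩ := ht.conv_weights hη'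
  have eZ := congrArg c.Z heq
  have eY := congrArg c.Y heq
  have Zp1 := c.pp_Z hw1 hu
  have Zp2 := c.pp_Z hw2 hu
  have Yp : c.Y (c.pp v2 u1) = c.Y (c.pp v1 u1) := by
    simp only [pp, map_add, map_smul, smul_eq_mul, c.yv]
  simp only [map_add, map_smul, smul_eq_mul, Zp1, Zp2, c.zv1, c.zv2, c.S_Z hq, c.S_Z hq'] at eZ
  simp only [map_add, map_smul, smul_eq_mul, Yp, c.yv] at eY
  have hab : a + b = 1 - η := by
    have : (a + b) * c.h = (1 - η) * c.h := by linarith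
    exact mul_right_cancel₀ hh.ne' this
  have hxy : x + y = η := by linarith
  have hL : 0 < c.X v2 - c.X v1 := sub_pos.2 c.xv
  set s := (x / η) • q + (y / η) • q' with hsdef
  have sτ : s ∈ convexHull ℝ (τ : Set Pt3) :=
    convex_convexHull ℝ _ (subset_convexHull ℝ _ hqτ) (subset_convexHull ℝ _ hqτ')
      (by positivity) (by positivity) (by field_simp; exact hxy)
  have Zs : c.Z s = 0 := by simp [hsdef, c.S_Z hq, c.S_Z hq']
  have Ys : c.Y s = c.Y (c.pp v1 u1) := by
    simp only [hsdef, map_add, map_smul, smul_eq_mul]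
    have : x * c.Y q + y * c.Y q' = η * c.Y (c.pp v1 u1) := by
      have hab' : a = 1 - η - b := by linarith
      subst hab'
      linarith
    field_simp
    linarith
  have gs : c.det (q' - q) (s - q) = 0 := by
    have hx' : x = η - y := by linarith
    simp only [hsdef, Frame.det, map_sub, map_add, map_smul, smul_eq_mul, hx']
    field_simp
    ring
  obtain ⟨l1, hl1⟩ : ∃ l1 : ℝ, c.pp v1 u1 = s + l1 • (v2 - v1) := by
    refine ⟨(c.X (c.pp v1 u1) - c.X s) / (c.X v2 - c.X v1), c.inj _ _ ?_ ?_ ?_⟩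
    · simp only [map_add, map_smul, map_sub, smul_eq_mul]; field_simp; ring
    · simp only [map_add, map_smul, map_sub, smul_eq_mul, c.yv, Ys]; ring
    · simp only [map_add, map_smul, map_sub, smul_eq_mul, c.zv1, c.zv2, Zs, Zp1]; ring
  have hl2 : c.pp v2 u1 = s + (l1 + c.k / (c.h + c.k)) • (v2 - v1) := by
    have : c.pp v2 u1 = c.pp v1 u1 + (c.k / (c.h + c.k)) • (v2 - v1) := by
      simp only [pp]; module
    rw [this, hl1]; module
  set l2 := l1 + c.k / (c.h + c.k) with hl2d
  have l1neg : l1 < 0 := by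
    by_contra hn
    have hn := not_lt.1 hn
    have h1 : 0 < 1 / (1 + l1) := by positivity
    refine hu1τ (c.no_cross hT hσ1 hτ hv1 hu1 (ε := 1 / (1 + l1)) h1
      (by rw [div_le_one (by linarith)]; linarith) ?_)
    have := convex_convexHull ℝ (τ : Set Pt3) sτ (subset_convexHull ℝ _ hv2τ) h1.le
      (show 0 ≤ l1 / (1 + l1) by positivity) (by field_simp)
    convert this using 1
    rw [hl1]
    have : l1 / (1 + l1) = 1 - 1 / (1 + l1) := by field_simp; ring
    rw [this]
    have h3 : (1 / (1 + l1)) * l1 = 1 - 1 / (1 + l1) := by field_simp; ring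
    rw [smul_add, smul_smul, h3]; module
  have l2pos : 0 < l2 := by
    by_contra hn
    have hn := not_lt.1 hn
    have hp : 0 < 1 - l2 := by linarith
    have h1 : 0 < 1 / (1 - l2) := by positivity
    refine hu1τ (c.no_cross hT hσ2 hτ hv2 hu2 (ε := 1 / (1 - l2)) h1
      (by rw [div_le_one (by linarith)]; linarith) ?_)
    have := convex_convexHull ℝ (τ : Set Pt3) sτ (subset_convexHull ℝ _ hv1τ) h1.le
      (show 0 ≤ 1 - 1 / (1 - l2) by rw [sub_nonneg, div_le_one hp]; linarith) (by ring)
    convert this using 1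
    rw [hl2]
    have h3 : (1 / (1 - l2)) * l2 = 1 / (1 - l2) - 1 := by field_simp; ring
    rw [smul_add, smul_smul, h3]; module
  have hdetv : c.det (q' - q) (v2 - v1) ≠ 0 := by
    intro h0
    have h1 : (c.Y q' - c.Y q) * (c.X v2 - c.X v1) = 0 := by
      simp only [Frame.det, map_sub, c.yv] at h0; linarith
    have h2 := (mul_eq_zero.1 h1).resolve_right hL.ne'
    obtain ⟨i, hi, rfl⟩ := c.memS.1 hq
    obtain ⟨j, hj, rfl⟩ := c.memS.1 hq'
    rcases lt_trichotomy i j with h | rfl | h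
    · have := c.Y_lt h hj; linarith
    · exact hne rfl
    · have := c.Y_lt h hi; linarith
  set κ := c.det (q' - q) (v2 - v1) with hκ
  have g1 : c.det (q' - q) (c.pp v1 u1 - q) = l1 * κ := by
    rw [hl1]
    have : c.det (q' - q) (s + l1 • (v2 - v1) - q) = c.det (q' - q) (s - q) + l1 * κ := by
      simp only [hκ, Frame.det, map_sub, map_add, map_smul, smul_eq_mul]; ring
    rw [this, gs, zero_add]
  have g2 : c.det (q' - q) (c.pp v2 u1 - q) = l2 * κ := by
    rw [hl2]
    have : c.det (q' - q) (s + l2 • (v2 - v1) - q) = c.det (q' - q) (s - q) + l2 * κ := by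
      simp only [hκ, Frame.det, map_sub, map_add, map_smul, smul_eq_mul]; ring
    rw [this, gs, zero_add]
  have c1 := c.side_count hT hno hτ hq hq' hne hqτ hqτ' hw1 hσ1 hv1 hu1 g1.symm
    (mul_ne_zero l1neg.ne hdetv)
  have c2 := c.side_count hT hno hτ hq hq' hne hqτ hqτ' hw2 hσ2 hv2 hu2 g2.symm
    (mul_ne_zero l2pos.ne' hdetv)
  have hκ2 : 0 < κ ^ 2 := by positivity
  have hneg : l1 * l2 < 0 := mul_neg_of_neg_of_pos l1neg l2pos
  -- sizes
  have cardLR : (S.filter fun p => 0 ≤ l1 * κ * c.det (q' - q) (p - q)).card +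
      (S.filter fun p => 0 ≤ l2 * κ * c.det (q' - q) (p - q)).card ≤ m + 2 := by
    rw [← Finset.card_union_add_card_inter]
    refine Nat.add_le_add ?_ ?_
    · refine le_trans ?_ c.card_S.le
      exact Finset.card_le_card (Finset.union_subset (Finset.filter_subset _ _) (Finset.filter_subset _ _))
    · refine le_trans (Finset.card_le_card (t := {q, q'}) ?_) Finset.card_le_two
      intro p hp
      simp only [Finset.mem_inter, Finset.mem_filter] at hp
      obtain ⟨⟨hpS, h1⟩, -, h2⟩ := hp
      have g0 : c.det (q' - q) (p - q) = 0 := by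
        by_contra h0
        have h3 : 0 < (κ * c.det (q' - q) (p - q)) ^ 2 := by positivity
        have h4 := mul_nonneg h1 h2
        have h5 := mul_neg_of_neg_of_pos hneg h3
        linarith
      obtain ⟨l, l0, l1, el⟩ := c.line_conv hq hq' hne (subset_convexHull ℝ _ hpS) g0
      simp only [Finset.mem_insert, Finset.mem_singleton]
      rcases l0.eq_or_lt with rfl | l0
      · left; rw [el]; module
      rcases l1.eq_or_lt with rfl | l1
      · right; rw [el]; module
      exact (c.ext_mid hpS (subset_convexHull ℝ _ hq) (subset_convexHull ℝ _ hq') hne l0 l1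
        (by rw [el]; module)).elim
  have cover : T.filter (IsA v1 v2 u1 u2) ⊆
      (T.filter fun ρ => IsA v1 v2 u1 u2 ρ ∧ ∀ x ∈ ρ, x ∈ S →
        0 ≤ l1 * κ * c.det (q' - q) (x - q)) ∪
      (T.filter fun ρ => IsA v1 v2 u1 u2 ρ ∧ ∀ x ∈ ρ, x ∈ S →
        0 ≤ l2 * κ * c.det (q' - q) (x - q)) := by
    intro ρ hρ
    obtain ⟨hρ, hA⟩ := Finset.mem_filter.1 hρ
    by_contra hn
    simp only [Finset.mem_union, Finset.mem_filter, not_or, not_and, not_forall, not_le] at hn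
    obtain ⟨x, hxρ, hxS, hx⟩ := hn.1 hρ hA
    obtain ⟨y, hyρ, hyS, hy⟩ := hn.2 hρ hA
    have hprod : c.det (q' - q) (x - q) * c.det (q' - q) (y - q) < 0 := by
      have h1 := mul_pos_of_neg_of_neg hx hy
      have h2 : 0 < (l1 * l2) * κ ^ 2 * (c.det (q' - q) (x - q) * c.det (q' - q) (y - q)) := by
        linarith
      have h3 := mul_neg_of_neg_of_pos hneg hκ2
      by_contra h4
      have := mul_nonneg (neg_nonneg.2 h3.le) (not_lt.1 h4)
      linarith
    obtain ⟨hqρ, hqρ'⟩ := c.chord_cross hT hρ hτ hq hq' hne hqτ hqτ' (subset_convexHull ℝ _ hxS)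
      (subset_convexHull ℝ _ hyS) (subset_convexHull ℝ _ hxρ) (subset_convexHull ℝ _ hyρ) hprod
    obtain ⟨w, A, B, C, hw, hs', hA, hB, hC, -, -⟩ := c.avSlice hT hρ hA
    have n1 : ∀ r ∈ S, r ≠ w := fun r hr h => c.v_notS hw (h ▸ hr)
    have gq : c.det (q' - q) (q - q) = 0 := by simp [Frame.det]
    have gq' : c.det (q' - q) (q' - q) = 0 := by simp [Frame.det]; ring
    have sub : ({x, y, q, q'} : Finset Pt3) ⊆ {A, B, C} := by
      intro r hr
      have hrS : r ∈ S ∧ r ∈ ρ := by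
        simp only [Finset.mem_insert, Finset.mem_singleton] at hr
        rcases hr with rfl | rfl | rfl | rfl <;> exact ⟨by assumption, by assumption⟩
      have := hrS.2
      rw [hs', Finset.mem_insert] at this
      exact this.resolve_left (n1 r hrS.1)
    have hc := Finset.card_le_card sub
    have d1 : x ≠ y := by rintro rfl; nlinarith [mul_self_nonneg (c.det (q' - q) (x - q))]
    have d2 : x ≠ q := by rintro rfl; rw [gq] at hprod; simp at hprod
    have d3 : x ≠ q' := by rintro rfl; rw [gq'] at hprod; simp at hprod
    have d4 : y ≠ q := by rintro rfl; rw [gq] at hprod; simp at hprod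
    have d5 : y ≠ q' := by rintro rfl; rw [gq'] at hprod; simp at hprod
    have : ({x, y, q, q'} : Finset Pt3).card = 4 := by
      simp [d1, d2, d3, d4, d5, hne]
    have := Finset.card_le_three (a := A) (b := B) (c := C)
    omega
  have := (Finset.card_le_card cover).trans (Finset.card_union_le _ _)
  omega

end Cfg


namespace Cfg
variable {m : ℕ} {S : Finset Pt3} {v1 v2 u1 u2 : Pt3} (c : Cfg m S v1 v2 u1 u2)
variable {T : Finset (Finset Pt3)}

/-- slope of a vertex as seen from the edge `v1 v2` -/
def Φ (r : Pt3) : ℝ := (c.Y r - c.Y v1) / (c.h - c.Z r)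

theorem sector {r r' : Pt3} (ht : Tet4 v1 v2 r r') (hr : c.Z r < c.h) (hr' : c.Z r' < c.h) {φ : ℝ}
    (h : (φ - c.Φ r) * (φ - c.Φ r') < 0) :
    ∀ᶠ η in 𝓝[>] (0:ℝ), ((1/2:ℝ) • v1 + (1/2:ℝ) • v2) + η • c.mk' 0 φ (-1) ∈
      interior (convexHull ℝ (({v1, v2, r, r'} : Finset Pt3) : Set Pt3)) := by
  obtain ⟨w1, w2, w3, w4, ws, he⟩ := ht.span (c.mk' 0 φ (-1))
  have eY := congrArg c.Y he
  have eZ := congrArg c.Z he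
  simp only [map_add, map_smul, smul_eq_mul, c.Y_mk, c.Z_mk, c.zv1, c.zv2, ← c.yv] at eY eZ
  have hw : w1 = - w2 - w3 - w4 := by linarith
  subst hw
  have d1 : 0 < c.h - c.Z r := sub_pos.2 hr
  have d2 : 0 < c.h - c.Z r' := sub_pos.2 hr'
  have e1 : c.Y r - c.Y v1 = c.Φ r * (c.h - c.Z r) := by rw [Φ]; field_simp
  have e2 : c.Y r' - c.Y v1 = c.Φ r' * (c.h - c.Z r') := by rw [Φ]; field_simp
  set A := w3 * (c.h - c.Z r) with hA
  set B := w4 * (c.h - c.Z r') with hB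
  have s1 : A + B = 1 := by rw [hA, hB]; linarith
  have s2 : A * c.Φ r + B * c.Φ r' = φ := by
    have : w3 * (c.Y r - c.Y v1) + w4 * (c.Y r' - c.Y v1) = φ := by linarith
    rw [e1, e2] at this
    rw [hA, hB]; linarith
  have hAB : 0 < A ∧ 0 < B := by
    have hB1 : B = 1 - A := by linarith
    have f1 : φ - c.Φ r = (1 - A) * (c.Φ r' - c.Φ r) := by rw [← s2, hB1]; ring
    have f2 : φ - c.Φ r' = -A * (c.Φ r' - c.Φ r) := by rw [← s2, hB1]; ring
    rw [f1, f2] at h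
    have h' : 0 < ((1 - A) * A) * (c.Φ r' - c.Φ r) ^ 2 := by linarith
    have h2 : 0 < (1 - A) * A := by
      by_contra hn
      have := mul_nonneg (neg_nonneg.2 (not_lt.1 hn)) (sq_nonneg (c.Φ r' - c.Φ r))
      linarith
    constructor
    · by_contra hn; nlinarith
    · rw [hB1]; by_contra hn; nlinarith
  have p3 : 0 < w3 := by
    by_contra hn
    have := mul_nonneg (neg_nonneg.2 (not_lt.1 hn)) d1.le
    linarith [hAB.1]
  have p4 : 0 < w4 := by
    by_contra hn
    have := mul_nonneg (neg_nonneg.2 (not_lt.1 hn)) d2.le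
    linarith [hAB.2]
  exact ht.cone (x1 := 1/2) (x2 := 1/2) (x3 := 0) (x4 := 0) (by norm_num) (by module) ws he
    (Or.inl (by norm_num)) (Or.inl (by norm_num)) (Or.inr ⟨rfl, p3⟩) (Or.inr ⟨rfl, p4⟩)

theorem sector_unique (hT : IsTriangulation (VV S v1 v2 u1 u2) T) {σ τ : Finset Pt3}
    (hσ : σ ∈ T) (hτ : τ ∈ T) {r r' s s' : Pt3} (eσ : σ = {v1, v2, r, r'})
    (eτ : τ = {v1, v2, s, s'}) (h1 : Tet4 v1 v2 r r') (h2 : Tet4 v1 v2 s s')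
    (hr : c.Z r < c.h) (hr' : c.Z r' < c.h) (hs : c.Z s < c.h) (hs' : c.Z s' < c.h) {φ : ℝ}
    (h : (φ - c.Φ r) * (φ - c.Φ r') < 0) (h' : (φ - c.Φ s) * (φ - c.Φ s') < 0) : σ = τ := by
  by_contra hne
  obtain ⟨η, ha, hb⟩ := ((c.sector h1 hr hr' h).and (c.sector h2 hs hs' h')).exists
  have := hT.1.2.1 σ hσ τ hτ hne
  rw [eσ, eτ] at this
  have hmem := Set.mem_inter ha hb
  rw [this] at hmem
  exact absurd hmem (Set.notMem_empty _)

theorem Z_lt_of {r : Pt3} (hr : r ∈ S ∨ (r = u1 ∨ r = u2)) : c.Z r < c.h := by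
  rcases hr with h | h
  · rw [c.S_Z h]; exact c.hpos
  · rw [c.zu h]; linarith [c.hpos, c.kpos]

theorem Φ_S {r : Pt3} (hr : r ∈ convexHull ℝ (S : Set Pt3)) : c.Φ r = (c.Y r - c.Y v1) / c.h := by
  rw [Φ, c.conv_Z hr, sub_zero]

theorem Φ_u {u : Pt3} (hu : u = u1 ∨ u = u2) : c.Φ u = c.Φ (c.pp v1 u) := by
  have hh := c.hpos
  have hk := c.kpos
  rw [c.Φ_S (c.pp_conv (Or.inl rfl) hu), Φ, c.zu hu, pp]
  simp only [map_add, map_smul, smul_eq_mul]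
  rw [sub_neg_eq_add]
  field_simp
  ring

theorem Φ_mono {i j : ℕ} (hij : i < j) (hj : j < m) : c.Φ (c.P j) < c.Φ (c.P i) := by
  rw [c.Φ_S (subset_convexHull ℝ _ (c.P_mem hj)),
    c.Φ_S (subset_convexHull ℝ _ (c.P_mem (hij.trans hj)))]
  have := c.Y_lt hij hj
  exact div_lt_div_of_pos_right (by linarith) c.hpos

theorem Φ_mono_le {i j : ℕ} (hij : i ≤ j) (hj : j < m) : c.Φ (c.P j) ≤ c.Φ (c.P i) := by
  rcases hij.eq_or_lt with rfl | h
  · exact le_rfl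
  · exact (c.Φ_mono h hj).le

theorem Y_conv {p : Pt3} (hp : p ∈ convexHull ℝ (S : Set Pt3)) :
    c.Y (c.P (m - 1)) ≤ c.Y p ∧ c.Y p ≤ c.Y (c.P 0) := by
  have hm := c.h16
  constructor
  · have := c.conv_le (-c.Y) (-c.Y (c.P (m-1))) (by
      intro q hq
      obtain ⟨i, hi, rfl⟩ := c.memS.1 hq
      have := c.Y_le (show i ≤ m - 1 by omega) (by omega)
      rw [LinearMap.neg_apply]; linarith) hp
    rw [LinearMap.neg_apply] at this; linarith
  · exact c.conv_le c.Y _ (by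
      intro q hq
      obtain ⟨i, hi, rfl⟩ := c.memS.1 hq
      exact c.Y_le (Nat.zero_le i) hi) hp

theorem Φ_range {r : Pt3} (hr : r ∈ S ∨ (r = u1 ∨ r = u2)) :
    c.Φ (c.P (m - 1)) ≤ c.Φ r ∧ c.Φ r ≤ c.Φ (c.P 0) := by
  have hm := c.h16
  have key : ∀ p ∈ convexHull ℝ (S : Set Pt3), c.Φ (c.P (m - 1)) ≤ c.Φ p ∧ c.Φ p ≤ c.Φ (c.P 0) := by
    intro p hp
    rw [c.Φ_S hp, c.Φ_S (subset_convexHull ℝ _ (c.P_mem (show m - 1 < m by omega))),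
      c.Φ_S (subset_convexHull ℝ _ (c.P_mem (show 0 < m by omega)))]
    have := c.Y_conv hp
    exact ⟨div_le_div_of_nonneg_right (by linarith) c.hpos.le,
      div_le_div_of_nonneg_right (by linarith) c.hpos.le⟩
  rcases hr with h | h
  · exact key r (subset_convexHull ℝ _ h)
  · rw [c.Φ_u h]; exact key _ (c.pp_conv (Or.inl rfl) h)

theorem Φ_ne {r r' : Pt3} (ht : Tet4 v1 v2 r r') (hr : c.Z r < c.h) (hr' : c.Z r' < c.h) :
    c.Φ r ≠ c.Φ r' := by
  intro h
  obtain ⟨w1, w2, w3, w4, ws, he⟩ := ht.span (c.mk' 0 (c.Φ r + 1) (-1))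
  have eY := congrArg c.Y he
  have eZ := congrArg c.Z he
  simp only [map_add, map_smul, smul_eq_mul, c.Y_mk, c.Z_mk, c.zv1, c.zv2, ← c.yv] at eY eZ
  have hw : w1 = - w2 - w3 - w4 := by linarith
  subst hw
  have d1 : 0 < c.h - c.Z r := sub_pos.2 hr
  have d2 : 0 < c.h - c.Z r' := sub_pos.2 hr'
  have e1 : c.Y r - c.Y v1 = c.Φ r * (c.h - c.Z r) := by rw [Φ]; field_simp
  have e2 : c.Y r' - c.Y v1 = c.Φ r * (c.h - c.Z r') := by rw [h, Φ]; field_simp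
  have h1 : w3 * (c.Y r - c.Y v1) + w4 * (c.Y r' - c.Y v1) = c.Φ r + 1 := by linarith
  have h2 : w3 * (c.h - c.Z r) + w4 * (c.h - c.Z r') = 1 := by linarith
  rw [e1, e2] at h1
  have : c.Φ r * (w3 * (c.h - c.Z r) + w4 * (c.h - c.Z r')) = c.Φ r + 1 := by linarith
  rw [h2] at this
  linarith

/-- short tetrahedra at the edge `v1 v2` -/
def AA (T : Finset (Finset Pt3)) : Finset ℕ :=
  (Finset.range (m - 1)).filter fun i => ({v1, v2, c.P i, c.P (i + 1)} : Finset Pt3) ∈ T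

theorem L_form (hT : IsTriangulation (VV S v1 v2 u1 u2) T) {σ : Finset Pt3} (hσ : σ ∈ T)
    (hL : IsL v1 v2 u1 u2 σ) : ∃ i j, i < j ∧ j < m ∧ σ = {v1, v2, c.P i, c.P j} ∧
      Tet4 v1 v2 (c.P i) (c.P j) := by
  obtain ⟨h1, h2, h3, h4⟩ := hL
  obtain ⟨q, q', hs, ht⟩ := tet_pair (hT.1.1 σ hσ).1 h1 h2 c.v_ne
  have hd := ht.distinct
  have key : ∀ r ∈ σ, r ≠ v1 → r ≠ v2 → r ∈ S := by
    intro r hr h1 h2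
    rcases mem_cases hT hσ hr with h | h | h
    · exact h
    · rcases h with h | h <;> contradiction
    · rcases h with rfl | rfl <;> tauto
  have hq := key q (by simp [hs]) hd.2.1.symm hd.2.2.2.1.symm
  have hq' := key q' (by simp [hs]) hd.2.2.1.symm hd.2.2.2.2.1.symm
  obtain ⟨i, hi, rfl⟩ := c.memS.1 hq
  obtain ⟨j, hj, rfl⟩ := c.memS.1 hq'
  rcases lt_trichotomy i j with h | rfl | h
  · exact ⟨i, j, h, hj, hs, ht⟩
  · exact absurd rfl hd.2.2.2.2.2
  · refine ⟨j, i, h, hi, ?_, ht.swap34⟩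
    rw [hs]; ext z; simp only [Finset.mem_insert, Finset.mem_singleton]; tauto

theorem cnt (c : Cfg m S v1 v2 u1 u2) (hT : IsTriangulation (VV S v1 v2 u1 u2) T)
    (B : Finset ℕ) (hB : B ⊆ Finset.range (m - 1))
    (hlost : ∀ σ ∈ T, ∀ i j, i < j → j < m → σ = {v1, v2, c.P i, c.P j} →
      Tet4 v1 v2 (c.P i) (c.P j) → ∀ g, i ≤ g → g < j → g ∈ B) :
    2 * (T.filter (IsL v1 v2 u1 u2)).card ≤ B.card + (c.AA T).card := by
  have hm := c.h16
  set L := T.filter (IsL v1 v2 u1 u2) with hL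
  have ex : ∀ σ, ∃ i j, σ ∈ L → i < j ∧ j < m ∧ σ = {v1, v2, c.P i, c.P j} ∧
      Tet4 v1 v2 (c.P i) (c.P j) := by
    intro σ
    by_cases h : σ ∈ L
    · obtain ⟨h1, h2⟩ := Finset.mem_filter.1 h
      obtain ⟨i, j, h⟩ := c.L_form hT h1 h2
      exact ⟨i, j, fun _ => h⟩
    · exact ⟨0, 0, fun h' => absurd h' h⟩
  choose I J hIJ using ex
  have memT : ∀ σ ∈ L, σ ∈ T := fun σ h => (Finset.mem_filter.1 h).1
  have uniq : ∀ σ ∈ L, ∀ τ ∈ L, ∀ g, I σ ≤ g → g < J σ → I τ ≤ g → g < J τ → σ = τ := by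
    intro σ hσ τ hτ g a1 a2 b1 b2
    obtain ⟨h1, h2, h3, h4⟩ := hIJ σ hσ
    obtain ⟨k1, k2, k3, k4⟩ := hIJ τ hτ
    have zz : ∀ i, c.Z (c.P i) < c.h := fun i => by rw [c.PZ]; exact c.hpos
    have mid : ∀ i j, i ≤ g → g < j → j < m →
        ((c.Φ (c.P g) + c.Φ (c.P (g+1))) / 2 - c.Φ (c.P i)) *
          ((c.Φ (c.P g) + c.Φ (c.P (g+1))) / 2 - c.Φ (c.P j)) < 0 := by
      intro i j hi hj hjm
      have e1 := c.Φ_mono_le hi (by omega)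
      have e2 := c.Φ_mono_le (show g + 1 ≤ j by omega) hjm
      have e3 := c.Φ_mono (show g < g + 1 by omega) (by omega)
      exact mul_neg_of_neg_of_pos (by linarith) (by linarith)
    exact c.sector_unique hT (memT σ hσ) (memT τ hτ) h3 k3 h4 k4 (zz _) (zz _) (zz _) (zz _)
      (mid _ _ a1 a2 h2) (mid _ _ b1 b2 k2)
  have hsum : ∑ σ ∈ L, (J σ - I σ) ≤ B.card := by
    have : (L.biUnion fun σ => Finset.Ico (I σ) (J σ)).card = ∑ σ ∈ L, (J σ - I σ) := by
      rw [Finset.card_biUnion]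
      · simp
      · intro σ hσ τ hτ hne
        rw [Function.onFun, Finset.disjoint_left]
        intro g h1 h2
        rw [Finset.mem_Ico] at h1 h2
        exact hne (uniq σ hσ τ hτ g h1.1 h1.2 h2.1 h2.2)
    rw [← this]
    apply Finset.card_le_card
    intro g hg
    obtain ⟨σ, hσ, hg⟩ := Finset.mem_biUnion.1 hg
    rw [Finset.mem_Ico] at hg
    obtain ⟨h1, h2, h3, h4⟩ := hIJ σ hσ
    exact hlost σ (memT σ hσ) _ _ h1 h2 h3 h4 g hg.1 hg.2
  have hshort : (L.filter fun σ => J σ = I σ + 1).card ≤ (c.AA T).card := by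
    apply Finset.card_le_card_of_injOn I
    · intro σ hσ
      obtain ⟨hσ, h⟩ := Finset.mem_filter.1 (Finset.mem_coe.1 hσ)
      obtain ⟨h1, h2, h3, h4⟩ := hIJ σ hσ
      rw [h] at h2 h3
      simp only [AA, Finset.coe_filter, mem_ofPred_eq, Finset.mem_range]
      exact ⟨by omega, h3 ▸ memT σ hσ⟩
    · intro σ hσ τ hτ heq
      obtain ⟨hσ, h⟩ := Finset.mem_filter.1 (Finset.mem_coe.1 hσ)
      obtain ⟨hτ, k⟩ := Finset.mem_filter.1 (Finset.mem_coe.1 hτ)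
      rw [(hIJ σ hσ).2.2.1, (hIJ τ hτ).2.2.1, h, k, heq]
  have : ∑ σ ∈ L, 2 ≤ ∑ σ ∈ L, ((J σ - I σ) + if J σ = I σ + 1 then 1 else 0) := by
    refine Finset.sum_le_sum fun σ hσ => ?_
    have := (hIJ σ hσ).1
    split_ifs with h <;> omega
  rw [Finset.sum_add_distrib, ← Finset.card_filter, Finset.sum_const, smul_eq_mul] at this
  omega

theorem cnt0 (c : Cfg m S v1 v2 u1 u2) (hT : IsTriangulation (VV S v1 v2 u1 u2) T) :
    2 * (T.filter (IsL v1 v2 u1 u2)).card ≤ m - 1 + (c.AA T).card := by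
  have := c.cnt hT (Finset.range (m-1)) (subset_refl _) (fun σ _ i j _ hj _ _ g _ hg =>
    Finset.mem_range.2 (by omega))
  simpa using this

theorem cnt1 (c : Cfg m S v1 v2 u1 u2) (hT : IsTriangulation (VV S v1 v2 u1 u2) T)
    (hl : ∃ σ ∈ T, v1 ∈ σ ∧ v2 ∈ σ ∧ (u1 ∈ σ ∨ u2 ∈ σ)) :
    2 * (T.filter (IsL v1 v2 u1 u2)).card + 1 ≤ m - 1 + (c.AA T).card := by
  have hm := c.h16
  obtain ⟨σ, hσ, h1, h2, h3⟩ := hl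
  obtain ⟨u, hu, huσ⟩ : ∃ u, (u = u1 ∨ u = u2) ∧ u ∈ σ := by
    rcases h3 with h | h
    · exact ⟨_, Or.inl rfl, h⟩
    · exact ⟨_, Or.inr rfl, h⟩
  obtain ⟨r, hs, ht⟩ := tet_triple (hT.1.1 σ hσ).1 h1 h2 huσ c.v_ne (c.vu_ne (Or.inl rfl) hu)
    (c.vu_ne (Or.inr rfl) hu)
  have hd := ht.distinct
  have hr : r ∈ S ∨ (r = u1 ∨ r = u2) := by
    rcases mem_cases hT hσ (show r ∈ σ by simp [hs]) with h | h | h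
    · exact Or.inl h
    · rcases h with rfl | rfl <;> tauto
    · exact Or.inr h
  have zr := c.Z_lt_of hr
  have zu := c.Z_lt_of (Or.inr hu)
  have hne := c.Φ_ne ht zr zu
  have rr := c.Φ_range hr
  have ru := c.Φ_range (Or.inr hu)
  obtain ⟨lo, hi, hlo, hhi, hlohi, hbet⟩ : ∃ lo hi : ℝ, c.Φ (c.P (m-1)) ≤ lo ∧ hi ≤ c.Φ (c.P 0) ∧
      lo < hi ∧ ∀ φ, lo < φ → φ < hi → (φ - c.Φ r) * (φ - c.Φ u) < 0 := by
    rcases lt_or_gt_of_ne hne with h | h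
    · exact ⟨_, _, rr.1, ru.2, h, fun φ a b => mul_neg_of_pos_of_neg (by linarith) (by linarith)⟩
    · exact ⟨_, _, ru.1, rr.2, h, fun φ a b => mul_neg_of_neg_of_pos (by linarith) (by linarith)⟩
  obtain ⟨g, hg, hg1, hg2⟩ : ∃ g, g < m - 1 ∧ hi ≤ c.Φ (c.P g) ∧ c.Φ (c.P (g+1)) < hi := by
    set g := Nat.findGreatest (fun i => hi ≤ c.Φ (c.P i)) (m - 1) with hgd
    have p1 : hi ≤ c.Φ (c.P g) := Nat.findGreatest_spec (P := fun i => hi ≤ c.Φ (c.P i)) (Nat.zero_le (m-1)) hhi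
    have p2 : g ≤ m - 1 := Nat.findGreatest_le _
    have p3 : g < m - 1 := by
      rcases p2.lt_or_eq with h | h
      · exact h
      · rw [h] at p1; linarith
    refine ⟨g, p3, p1, ?_⟩
    have := Nat.findGreatest_is_greatest (P := fun i => hi ≤ c.Φ (c.P i)) (n := m - 1) (k := g + 1)
      (by omega) (by omega)
    exact not_le.1 this
  obtain ⟨φ, hφ1, hφ2⟩ := exists_between (show max lo (c.Φ (c.P (g+1))) < hi from max_lt hlohi hg2)
  have := c.cnt hT ((Finset.range (m-1)).erase g) (Finset.erase_subset _ _) (by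
    intro τ hτ i j hij hj hτe htτ g' hg1' hg2'
    rw [Finset.mem_erase, Finset.mem_range]
    refine ⟨?_, by omega⟩
    rintro rfl
    have zz : ∀ i, c.Z (c.P i) < c.h := fun i => by rw [c.PZ]; exact c.hpos
    have e1 := c.Φ_mono_le hg1' (by omega)
    have e2 := c.Φ_mono_le (show g' + 1 ≤ j by omega) hj
    have e3 := le_max_right lo (c.Φ (c.P (g'+1)))
    have e4 := le_max_left lo (c.Φ (c.P (g'+1)))
    have := c.sector_unique hT hσ hτ hs hτe ht htτ zr zu (zz i) (zz j) (φ := φ)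
      (hbet φ (by linarith) hφ2) (mul_neg_of_neg_of_pos (by linarith) (by linarith))
    rw [this, hτe] at huσ
    simp only [Finset.mem_insert, Finset.mem_singleton] at huσ
    rcases huσ with h | h | h | h
    · exact c.vu_ne (Or.inl rfl) hu h.symm
    · exact c.vu_ne (Or.inr rfl) hu h.symm
    · exact c.u_notS hu (h ▸ c.P_mem (by omega))
    · exact c.u_notS hu (h ▸ c.P_mem hj))
  rw [Finset.card_erase_of_mem (Finset.mem_range.2 hg), Finset.card_range] at this
  omega

end Cfg


namespace Cfg
variable {m : ℕ} {S : Finset Pt3} {v1 v2 u1 u2 : Pt3} (c : Cfg m S v1 v2 u1 u2)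
variable {T : Finset (Finset Pt3)}

theorem D_cross {i t b : ℕ} (ht : t < i) (hb : i + 1 < b) (hbm : b < m) :
    c.D i (i+1) t * c.D i (i+1) b < 0 := by
  have a0 := c.α_pos t
  have a1 := c.α_mono ht
  have a2 := c.α_mono (show i < i + 1 by omega)
  have a3 := c.α_mono hb
  have e (l : ℕ) : c.θ l = c.α l ∨ c.θ l = - c.α l := by
    rcases Nat.even_or_odd l with h | h
    · left; exact c.θ_even h
    · right; exact c.θ_odd h
  rcases Nat.even_or_odd i with h | h
  · have e1 := c.θ_even h
    have e2 := c.θ_odd h.add_one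
    have p1 : 0 < c.D (i+1) i t := by
      apply c.D_pos (by omega) (by omega) (by omega) <;> rcases e t with q | q <;> rw [q] <;> linarith
    have p2 : 0 < c.D i (i+1) b := by
      rcases e b with q | q
      · have := c.D_pos (i := i+1) (j := b) (l := i) (by omega) (by omega) (by omega)
          (by linarith) (by linarith)
        rw [← D_rot]; exact this
      · have := c.D_pos (i := b) (j := i) (l := i+1) (by omega) (by omega) (by omega)
          (by linarith) (by linarith)
        rw [D_rot]; exact this
    rw [D_swap] at p1
    nlinarith
  · have e1 := c.θ_odd h
    have e2 := c.θ_even h.add_one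
    have p1 : 0 < c.D i (i+1) t := by
      apply c.D_pos (by omega) (by omega) (by omega) <;> rcases e t with q | q <;> rw [q] <;> linarith
    have p2 : 0 < c.D (i+1) i b := by
      rcases e b with q | q
      · have := c.D_pos (i := i) (j := b) (l := i+1) (by omega) (by omega) (by omega)
          (by linarith) (by linarith)
        rw [← D_rot]; exact this
      · have := c.D_pos (i := b) (j := i+1) (l := i) (by omega) (by omega) (by omega)
          (by linarith) (by linarith)
        rw [D_rot]; exact this
    rw [D_swap] at p2
    nlinarith

theorem short_blocked (c : Cfg m S v1 v2 u1 u2) (hT : IsTriangulation (VV S v1 v2 u1 u2) T)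
    {i t b : ℕ} (ht : t < i) (hb : i + 1 < b) (hbm : b < m) (hi : i ∈ c.AA T) {σ : Finset Pt3}
    (hσ : σ ∈ T) (he : σ = {u1, u2, c.P t, c.P b}) : False := by
  simp only [AA, Finset.mem_filter, Finset.mem_range] at hi
  have := c.chord_cross hT hσ hi.2 (c.P_mem (i := i) (by omega)) (c.P_mem (i := i+1) (by omega))
    (fun h => by have := c.P_inj (by omega) (by omega) h; omega) (by simp) (by simp)
    (x := c.P t) (y := c.P b) (subset_convexHull ℝ _ (c.P_mem (by omega)))
    (subset_convexHull ℝ _ (c.P_mem (by omega)))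
    (subset_convexHull ℝ _ (by simp [he])) (subset_convexHull ℝ _ (by simp [he]))
    (c.D_cross ht hb hbm)
  have h1 := this.1
  rw [he] at h1
  simp only [Finset.mem_insert, Finset.mem_singleton] at h1
  have hS := c.P_mem (i := i) (by omega)
  rcases h1 with h | h | h | h
  · exact c.u_notS (.inl rfl) (h ▸ hS)
  · exact c.u_notS (.inr rfl) (h ▸ hS)
  · have := c.P_inj (by omega) (by omega) h; omega
  · have := c.P_inj (by omega) (by omega) h; omega

/-! heights in the orthogonal direction -/
theorem α_half {j : ℕ} (hj : 2 * j + 2 ≤ m) : c.α j < Real.pi / 2 := by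
  have h := c.α_symm (i := j) (by omega)
  have := c.α_mono (show j < m - 1 - j by omega)
  linarith

theorem sin_lt {l j : ℕ} (hl : l < j) (hj : 2 * j + 2 ≤ m) :
    Real.sin (c.α l) < Real.sin (c.α j) := by
  have h1 := c.α_half hj
  have h2 := c.α_pos l
  have h3 := c.α_mono hl
  apply Real.sin_lt_sin_of_lt_of_le_pi_div_two <;> linarith

theorem sin_symm {l : ℕ} (hl : l < m) : Real.sin (c.α (m - 1 - l)) = Real.sin (c.α l) := by
  rw [c.α_symm hl, Real.sin_pi_sub]

theorem X_symm {l : ℕ} (hl : l < m) : c.X (c.P (m - 1 - l)) = - c.X (c.P l) := by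
  rw [PX, PX, c.sin_symm hl]
  have : (-1 : ℝ) ^ (m - 1 - l) = - (-1) ^ l := by
    obtain ⟨a, ha⟩ := c.even
    rcases Nat.even_or_odd l with h | h
    · have : Odd (m - 1 - l) := by obtain ⟨b, hb⟩ := h; exact ⟨a - b - 1, by omega⟩
      rw [this.neg_one_pow, h.neg_one_pow]
    · have : Even (m - 1 - l) := by obtain ⟨b, hb⟩ := h; exact ⟨a - b - 1, by omega⟩
      rw [this.neg_one_pow, h.neg_one_pow]; ring
  rw [this]; ring

/-- Q is strictly between -/
def Btw (c : Cfg m S v1 v2 u1 u2) (j l : ℕ) : Prop :=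
  (c.X (c.P l) - c.X (c.P j)) * (c.X (c.P l) - c.X (c.P (j+1))) < 0

theorem btw_abs {j l : ℕ} (h1 : Real.sin (c.α l) < Real.sin (c.α j))
    (h2 : Real.sin (c.α l) < Real.sin (c.α (j+1))) (hl : l < m) : c.Btw j l := by
  unfold Btw
  rw [PX, PX, PX, pow_succ]
  have := c.sin_pos hl
  rcases neg_one_pow_eq_or ℝ l with h | h <;> rcases neg_one_pow_eq_or ℝ j with h' | h' <;>
    rw [h, h'] <;> nlinarith

/-- lower half -/
theorem btw_low {j l : ℕ} (hj : 2 * j + 2 ≤ m) (hl : l < j) : c.Btw j l := by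
  have h1 := c.sin_lt hl hj
  refine c.btw_abs h1 ?_ (by omega)
  rcases eq_or_ne (2 * j + 2) m with h | h
  · have : j + 1 = m - 1 - j := by omega
    rw [this, c.sin_symm (by omega)]; exact h1
  · exact h1.trans (c.sin_lt (show j < j + 1 by omega) (by obtain ⟨a, ha⟩ := c.even; omega))

theorem btw_high {j l : ℕ} (hj : 2 * j + 2 ≤ m) (hl : l < j) : c.Btw j (m - 1 - l) := by
  have h1 := c.sin_lt hl hj
  have e := c.sin_symm (l := l) (by omega)
  refine c.btw_abs (by rwa [e]) ?_ (by omega)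
  rw [e]
  rcases eq_or_ne (2 * j + 2) m with h | h
  · have : j + 1 = m - 1 - j := by omega
    rw [this, c.sin_symm (by omega)]; exact h1
  · exact h1.trans (c.sin_lt (show j < j + 1 by omega) (by obtain ⟨a, ha⟩ := c.even; omega))

theorem btw_extra {j : ℕ} (hj : 2 * j + 4 ≤ m) : c.Btw j (m - 1 - j) := by
  unfold Btw
  rw [c.X_symm (by omega), PX, PX, pow_succ]
  have := c.sin_pos (i := j) (by omega)
  have := c.sin_lt (show j < j + 1 by omega) (by omega)
  rcases neg_one_pow_eq_or ℝ j with h' | h' <;> rw [h'] <;> nlinarith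

theorem btw_symm {j l : ℕ} (hj : j + 2 ≤ m) (hl : l < m) (h : c.Btw j l) :
    c.Btw (m - 2 - j) (m - 1 - l) := by
  unfold Btw at *
  have e1 : m - 2 - j = m - 1 - (j + 1) := by omega
  have e2 : m - 2 - j + 1 = m - 1 - j := by omega
  rw [e2, e1, c.X_symm hl, c.X_symm (by omega), c.X_symm (by omega)]
  nlinarith

theorem btw_card_low {j : ℕ} (hj : 2 * j + 2 ≤ m) :
    min (2 * j + 2) (m - 1) ≤ ((Finset.range m).filter (c.Btw j)).card + 1 := by
  rcases eq_or_ne (2 * j + 2) m with h | h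
  · have hsub : Finset.range j ∪ Finset.Ico (m - j) m ⊆ (Finset.range m).filter (c.Btw j) := by
      intro l hl
      simp only [Finset.mem_union, Finset.mem_range, Finset.mem_Ico] at hl
      simp only [Finset.mem_filter, Finset.mem_range]
      rcases hl with hl | hl
      · exact ⟨by omega, c.btw_low hj hl⟩
      · refine ⟨hl.2, ?_⟩
        have := c.btw_high (l := m - 1 - l) hj (by omega)
        rwa [show m - 1 - (m - 1 - l) = l by omega] at this
    have := Finset.card_le_card hsub
    rw [Finset.card_union_of_disjoint (by
      rw [Finset.disjoint_left]; intro l h1 h2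
      simp only [Finset.mem_range, Finset.mem_Ico] at h1 h2; omega)] at this
    simp only [Finset.card_range, Nat.card_Ico] at this
    omega
  · have hm : 2 * j + 4 ≤ m := by obtain ⟨a, ha⟩ := c.even; omega
    have hsub : Finset.range j ∪ Finset.Ico (m - 1 - j) m ⊆ (Finset.range m).filter (c.Btw j) := by
      intro l hl
      simp only [Finset.mem_union, Finset.mem_range, Finset.mem_Ico] at hl
      simp only [Finset.mem_filter, Finset.mem_range]
      rcases hl with hl | hl
      · exact ⟨by omega, c.btw_low hj hl⟩
      · refine ⟨hl.2, ?_⟩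
        rcases eq_or_ne l (m - 1 - j) with rfl | hne
        · exact c.btw_extra hm
        have := c.btw_high (l := m - 1 - l) hj (by omega)
        rwa [show m - 1 - (m - 1 - l) = l by omega] at this
    have := Finset.card_le_card hsub
    rw [Finset.card_union_of_disjoint (by
      rw [Finset.disjoint_left]; intro l h1 h2
      simp only [Finset.mem_range, Finset.mem_Ico] at h1 h2; omega)] at this
    simp only [Finset.card_range, Nat.card_Ico] at this
    omega

theorem btw_card {j : ℕ} (hj : j + 2 ≤ m) :
    min (2 * min j (m - 2 - j) + 2) (m - 1) ≤ ((Finset.range m).filter (c.Btw j)).card + 1 := by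
  rcases le_or_gt (2 * j + 2) m with h | h
  · have := c.btw_card_low h
    rwa [show min j (m - 2 - j) = j by omega]
  · have := c.btw_card_low (j := m - 2 - j) (by omega)
    rw [show min j (m - 2 - j) = m - 2 - j by omega]
    refine this.trans (Nat.add_le_add_right ?_ 1)
    apply Finset.card_le_card_of_injOn (fun l => m - 1 - l)
    · intro l hl
      simp only [Finset.coe_filter, mem_ofPred_eq, Finset.mem_range] at hl ⊢
      refine ⟨by omega, ?_⟩
      have := c.btw_symm (j := m - 2 - j) (by omega) hl.1 hl.2
      rwa [show m - 2 - (m - 2 - j) = j by omega] at this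
    · intro a ha b hb hab
      simp only [Finset.coe_filter, mem_ofPred_eq, Finset.mem_range] at ha hb hab
      omega

theorem short (c : Cfg m S v1 v2 u1 u2) (c' : Cfg m S u1 u2 v1 v2)
    (hT : IsTriangulation (VV S v1 v2 u1 u2) T) (ε : ℝ) (hε : ε = 1 ∨ ε = -1)
    (hx : ∀ p, c.Y p = ε * c'.X p) : (c.AA T).card + (c'.AA T).card ≤ m + 1 := by
  have h16 := c.h16
  have hA : c.AA T ⊆ Finset.range (m-1) := Finset.filter_subset _ _
  have hB : c'.AA T ⊆ Finset.range (m-1) := Finset.filter_subset _ _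
  have hA' := Finset.card_le_card hA
  have hB' := Finset.card_le_card hB
  rw [Finset.card_range] at hA' hB'
  rcases (c'.AA T).eq_empty_or_nonempty with h0 | hne
  · rw [h0]; simp; omega
  obtain ⟨j, hj, hmax⟩ := Finset.exists_max_image (c'.AA T) (fun j => min j (m - 2 - j)) hne
  have hjm : j < m - 1 := by simpa using hB hj
  set κ := min j (m - 2 - j) with hκ
  have hBc : (c'.AA T).card ≤ min (2 * κ + 2) (m - 1) := by
    refine le_min ?_ hB'
    have : c'.AA T ⊆ Finset.range (κ + 1) ∪ Finset.Ico (m - 2 - κ) (m - 1) := by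
      intro l hl
      have h1 := hmax l hl
      have h2 : l < m - 1 := by simpa using hB hl
      simp only [Finset.mem_union, Finset.mem_range, Finset.mem_Ico]
      omega
    refine (Finset.card_le_card this).trans ((Finset.card_union_le _ _).trans ?_)
    simp only [Finset.card_range, Nat.card_Ico]
    omega
  have hbt := c'.btw_card (j := j) (by omega)
  -- ranks
  have hr : ∀ l, l < m → ∃ i < m, c.P i = c'.P l := fun l hl => c.memS.1 (c'.P_mem hl)
  choose! r hr1 hr2 using hr
  have rinj : ∀ a < m, ∀ b < m, r a = r b → a = b := by
    intro a ha b hb hab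
    apply c'.P_inj ha hb
    rw [← hr2 a ha, ← hr2 b hb, hab]
  have key : ∃ t b, t < b ∧ b < m ∧ ({u1, u2, c.P t, c.P b} : Finset Pt3) ∈ T ∧
      ∀ l < m, c'.Btw j l → t < r l ∧ r l < b := by
    have hT' : ({u1, u2, c'.P j, c'.P (j+1)} : Finset Pt3) ∈ T := by
      simp only [AA, Finset.mem_filter] at hj; exact hj.2
    rw [← hr2 j (by omega), ← hr2 (j+1) (by omega)] at hT'
    have tr : ∀ l < m, c'.Btw j l → (c.Y (c.P (r l)) - c.Y (c.P (r j))) *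
        (c.Y (c.P (r l)) - c.Y (c.P (r (j+1)))) < 0 := by
      intro l hl hb
      rw [hr2 l hl, hr2 j (by omega), hr2 (j+1) (by omega), hx, hx, hx]
      unfold Btw at hb
      rcases hε with rfl | rfl <;> nlinarith
    have r1 := hr1 j (by omega)
    have r2 := hr1 (j+1) (by omega)
    rcases lt_trichotomy (r j) (r (j+1)) with h | h | h
    · refine ⟨r j, r (j+1), h, r2, hT', fun l hl hb => ?_⟩
      have h3 := tr l hl hb
      have h4 := c.Y_lt h r2
      have hrl := hr1 l hl
      rw [← c.Y_lt_iff r1 hrl, ← c.Y_lt_iff hrl r2]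
      rcases mul_neg_iff.1 h3 with ⟨a, b⟩ | ⟨a, b⟩ <;> constructor <;> linarith
    · have := rinj _ (by omega) _ (by omega) h; omega
    · refine ⟨r (j+1), r j, h, r1, ?_, fun l hl hb => ?_⟩
      · rw [Finset.pair_comm (c.P (r (j+1)))]; exact hT'
      have h3 := tr l hl hb
      have h4 := c.Y_lt h r1
      have hrl := hr1 l hl
      rw [← c.Y_lt_iff r2 hrl, ← c.Y_lt_iff hrl r1]
      rcases mul_neg_iff.1 h3 with ⟨a, b⟩ | ⟨a, b⟩ <;> constructor <;> linarith
  obtain ⟨t, b, htb, hbm, hσ, hl⟩ := key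
  have hcnt : ((Finset.range m).filter (c'.Btw j)).card ≤ (Finset.Ioo t b).card := by
    apply Finset.card_le_card_of_injOn r
    · intro l hl'
      simp only [Finset.coe_filter, mem_ofPred_eq, Finset.mem_range] at hl'
      simp only [Finset.coe_Ioo, mem_Ioo]
      exact hl l hl'.1 hl'.2
    · intro x hx' y hy' hxy
      simp only [Finset.coe_filter, mem_ofPred_eq, Finset.mem_range] at hx' hy'
      exact rinj _ hx'.1 _ hy'.1 hxy
  have hAc : (c.AA T).card + (Finset.Ioo t (b-1)).card ≤ m - 1 := by
    rw [← Finset.card_union_of_disjoint, ← Finset.card_range (m-1)]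
    · apply Finset.card_le_card
      intro i hi
      rcases Finset.mem_union.1 hi with hi | hi
      · exact hA hi
      · simp only [Finset.mem_Ioo] at hi
        simp only [Finset.mem_range]; omega
    · rw [Finset.disjoint_left]
      intro i hi hi'
      simp only [Finset.mem_Ioo] at hi'
      exact c.short_blocked hT (i := i) (t := t) (b := b) (by omega) (by omega) hbm hi hσ rfl
  simp only [Nat.card_Ioo] at hcnt hAc
  omega

end Cfg


/-- the standard frame rotated by `ψ` -/
def frX (ψ : ℝ) : Pt3 →ₗ[ℝ] ℝ :=
  Real.sin ψ • LinearMap.proj 0 - Real.cos ψ • LinearMap.proj 1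
def frY (ψ s : ℝ) : Pt3 →ₗ[ℝ] ℝ :=
  s • (Real.cos ψ • LinearMap.proj 0 + Real.sin ψ • LinearMap.proj 1)
def frZ (ζ : ℝ) : Pt3 →ₗ[ℝ] ℝ := ζ • LinearMap.proj 2

theorem frX_apply (ψ : ℝ) (p : Pt3) : frX ψ p = Real.sin ψ * p 0 - Real.cos ψ * p 1 := by
  simp [frX]
theorem frY_apply (ψ s : ℝ) (p : Pt3) :
    frY ψ s p = s * (Real.cos ψ * p 0 + Real.sin ψ * p 1) := by
  simp [frY]; ring
theorem frZ_apply (ζ : ℝ) (p : Pt3) : frZ ζ p = ζ * p 2 := by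
  simp [frZ]

def fr (ψ s ζ : ℝ) (hs : s ^ 2 = 1) (hζ : ζ ^ 2 = 1) : Frame where
  X := frX ψ
  Y := frY ψ s
  Z := frZ ζ
  inj := by
    intro p q h1 h2 h3
    rw [frX_apply, frX_apply] at h1
    rw [frY_apply, frY_apply] at h2
    rw [frZ_apply, frZ_apply] at h3
    have hc := Real.sin_sq_add_cos_sq ψ
    funext i
    fin_cases i
    · show p 0 = q 0
      linear_combination Real.sin ψ * h1 + s * Real.cos ψ * h2 - (p 0 - q 0) * hc
        - (Real.cos ψ * (Real.cos ψ * p 0 + Real.sin ψ * p 1 - Real.cos ψ * q 0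
          - Real.sin ψ * q 1)) * hs
    · show p 1 = q 1
      linear_combination - Real.cos ψ * h1 + s * Real.sin ψ * h2 - (p 1 - q 1) * hc
        - (Real.sin ψ * (Real.cos ψ * p 0 + Real.sin ψ * p 1 - Real.cos ψ * q 0
          - Real.sin ψ * q 1)) * hs
    · show p 2 = q 2
      linear_combination ζ * h3 - (p 2 - q 2) * hζ
  surj := by
    intro x y z
    have hc := Real.sin_sq_add_cos_sq ψ
    refine ⟨![Real.sin ψ * x + s * Real.cos ψ * y, - Real.cos ψ * x + s * Real.sin ψ * y, ζ * z],
      ?_, ?_, ?_⟩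
    · rw [frX_apply]
      simp only [Matrix.cons_val_zero, Matrix.cons_val_one]
      linear_combination x * hc
    · rw [frY_apply]
      simp only [Matrix.cons_val_zero, Matrix.cons_val_one]
      linear_combination y * hs * (Real.sin ψ ^ 2 + Real.cos ψ ^ 2) + y * hc
    · rw [frZ_apply]
      simp only [Matrix.cons_val]
      linear_combination z * hζ

/-- polygon vertices indexed by integers -/
def qz (m : ℕ) (k : ℤ) : Pt3 :=
  ![Real.cos (2 * Real.pi * k / m), Real.sin (2 * Real.pi * k / m), 0]

theorem ang_mod {m : ℕ} (hm : 0 < m) (δ : ℝ) {a b : ℤ} (h : (m : ℤ) ∣ a - b) :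
    Real.sin (δ + 2 * Real.pi * a / m) = Real.sin (δ + 2 * Real.pi * b / m) ∧
    Real.cos (δ + 2 * Real.pi * a / m) = Real.cos (δ + 2 * Real.pi * b / m) := by
  obtain ⟨n, hn⟩ := h
  have hm' : (m : ℝ) ≠ 0 := by exact_mod_cast hm.ne'
  have : (a : ℝ) = b + m * n := by
    have : a = b + m * n := by linarith
    exact_mod_cast this
  have e : δ + 2 * Real.pi * a / m = δ + 2 * Real.pi * b / m + n * (2 * Real.pi) := by
    rw [this]; field_simp; ring
  rw [e]
  exact ⟨Real.sin_add_int_mul_two_pi _ _, Real.cos_add_int_mul_two_pi _ _⟩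

theorem qz_mod {m : ℕ} (hm : 0 < m) {a b : ℤ} (h : (m : ℤ) ∣ a - b) : qz m a = qz m b := by
  have := ang_mod hm 0 h
  simp only [zero_add] at this
  rw [qz, qz, this.1, this.2]

theorem mem_regPoly {m : ℕ} {p : Pt3} : p ∈ regPoly m ↔ ∃ k : ℕ, k < m ∧ qz m k = p := by
  simp only [regPoly, Finset.mem_image, Finset.mem_univ, true_and, qz]
  constructor
  · rintro ⟨k, rfl⟩
    exact ⟨k.1, k.2, by simp⟩
  · rintro ⟨k, hk, rfl⟩
    exact ⟨⟨k, hk⟩, by simp⟩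

theorem qz_mem {m : ℕ} (hm : 0 < m) (k : ℤ) : qz m k ∈ regPoly m := by
  rw [mem_regPoly]
  have h0 := Int.emod_nonneg k (show (m:ℤ) ≠ 0 by omega)
  have h1 := Int.emod_lt_of_pos k (show (0:ℤ) < m by omega)
  refine ⟨(k % m).toNat, by omega, ?_⟩
  apply qz_mod hm
  rw [Int.toNat_of_nonneg h0]
  exact ⟨-(k / m), by have := Int.emod_add_mul_ediv k m; linarith⟩

theorem frX_qz (ψ : ℝ) (m : ℕ) (k : ℤ) :
    frX ψ (qz m k) = Real.sin (ψ - 2 * Real.pi * k / m) := by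
  rw [frX_apply, Real.sin_sub]; simp [qz]
theorem frY_qz (ψ s : ℝ) (m : ℕ) (k : ℤ) :
    frY ψ s (qz m k) = s * Real.cos (ψ - 2 * Real.pi * k / m) := by
  rw [frY_apply, Real.cos_sub]; simp [qz]
theorem frZ_qz (ζ : ℝ) (m : ℕ) (k : ℤ) : frZ ζ (qz m k) = 0 := by
  rw [frZ_apply]; simp [qz]

/-- steps -/
def tt (i : ℕ) : ℤ := if Even i then (i / 2 : ℕ) else -((i + 1) / 2 : ℕ)

theorem tt_ang {m : ℕ} (δ : ℝ) (i : ℕ) :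
    (-1) ^ i * Real.sin (alpha m δ i) = Real.sin (δ + 2 * Real.pi * tt i / m) ∧
    Real.cos (alpha m δ i) = Real.cos (δ + 2 * Real.pi * tt i / m) := by
  rcases Nat.even_or_odd i with h | h
  · rw [tt, alpha, if_pos h, if_pos h, h.neg_one_pow, one_mul]
    obtain ⟨a, rfl⟩ := h
    have : (a + a) / 2 = a := by omega
    rw [this]
    have : Real.pi * ((a + a : ℕ) : ℝ) / m + δ = δ + 2 * Real.pi * ((a : ℤ) : ℝ) / m := by
      push_cast; ring
    rw [this]
    exact ⟨rfl, rfl⟩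
  · have h' : ¬ Even i := by simpa using h
    rw [tt, alpha, if_neg h', if_neg h', h.neg_one_pow]
    obtain ⟨a, rfl⟩ := h
    have : (2 * a + 1 + 1) / 2 = a + 1 := by omega
    rw [this]
    have : δ + 2 * Real.pi * ((-((a + 1 : ℕ) : ℤ) : ℤ) : ℝ) / m =
        - (Real.pi * (((2 * a + 1 : ℕ) : ℝ) + 1) / m - δ) := by
      push_cast; ring
    rw [this, Real.sin_neg, Real.cos_neg]
    exact ⟨by ring, rfl⟩

theorem core_S {m : ℕ} (hm : 0 < m) (he : Even m) (ψ s ζ : ℝ) (hs : s ^ 2 = 1) (hζ : ζ ^ 2 = 1)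
    (δ : ℝ) (K e : ℤ) (he1 : e * e = 1)
    (hX : ∀ k : ℤ, Real.sin (ψ - 2 * Real.pi * k / m) =
      Real.sin (δ + 2 * Real.pi * ((K + e * k : ℤ) : ℝ) / m))
    (hY : ∀ k : ℤ, s * Real.cos (ψ - 2 * Real.pi * k / m) =
      Real.cos (δ + 2 * Real.pi * ((K + e * k : ℤ) : ℝ) / m)) :
    regPoly m = (Finset.range m).image (fun i => (fr ψ s ζ hs hζ).mk'
      ((-1) ^ i * Real.sin (alpha m δ i)) (Real.cos (alpha m δ i)) 0) := by
  have key : ∀ (k : ℤ) (i : ℕ), (m : ℤ) ∣ K + e * k - tt i → (fr ψ s ζ hs hζ).mk'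
      ((-1) ^ i * Real.sin (alpha m δ i)) (Real.cos (alpha m δ i)) 0 = qz m k := by
    intro k i hd
    have h1 := tt_ang (m := m) δ i
    have h2 := ang_mod hm δ hd
    apply (fr ψ s ζ hs hζ).inj
    · rw [Frame.X_mk]
      show _ = frX ψ (qz m k)
      rw [frX_qz, hX, h1.1, h2.1]
    · rw [Frame.Y_mk]
      show _ = frY ψ s (qz m k)
      rw [frY_qz, hY, h1.2, h2.2]
    · rw [Frame.Z_mk]
      show _ = frZ ζ (qz m k)
      rw [frZ_qz]
  ext p
  simp only [Finset.mem_image, Finset.mem_range]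
  constructor
  · intro hp
    obtain ⟨k, hk, rfl⟩ := mem_regPoly.1 hp
    have h0 := Int.emod_nonneg (K + e * k) (show (m:ℤ) ≠ 0 by omega)
    have h1 := Int.emod_lt_of_pos (K + e * k) (show (0:ℤ) < m by omega)
    have h2 := Int.emod_add_mul_ediv (K + e * k) m
    set τ := (K + e * k) % m with hτ
    set Q := (K + e * k) / m with hQ
    obtain ⟨n, rfl⟩ := he
    rcases lt_or_ge τ n with h | h
    · refine ⟨2 * τ.toNat, by omega, key _ _ ?_⟩
      have : tt (2 * τ.toNat) = τ := by
        rw [tt, if_pos (by simp)]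
        omega
      rw [this]
      exact ⟨Q, by linarith⟩
    · refine ⟨2 * (n + n - τ).toNat - 1, by omega, key _ _ ?_⟩
      have : tt (2 * ((n:ℤ) + n - τ).toNat - 1) = τ - (n + n) := by
        rw [tt, if_neg (by rw [Nat.not_even_iff_odd]; exact ⟨((n:ℤ) + n - τ).toNat - 1, by omega⟩)]
        omega
      rw [this]
      exact ⟨Q + 1, by push_cast at *; linarith⟩
  · rintro ⟨i, hi, rfl⟩
    rw [key (e * (tt i - K)) i ⟨0, by linear_combination (tt i - K) * he1⟩]
    exact qz_mem hm _

/-- vertices symmetric with respect to the height direction are excluded -/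
theorem no_par {m : ℕ} (hm : 0 < m) {v1 v2 : Pt3} {ψ L : ℝ} (hL : 0 < L)
    (w0 : v2 0 - v1 0 = L * Real.sin ψ) (w1 : v2 1 - v1 1 = - (L * Real.cos ψ))
    (w2 : v1 2 = v2 2)
    (hpar : ∀ a ∈ regPoly m, ∀ b ∈ regPoly m, a ≠ b → ∀ t : ℝ, v2 - v1 ≠ t • (b - a))
    (k k' : ℤ) (x : ℝ) (hx : 0 < Real.sin x) (h1 : ψ - 2 * Real.pi * k / m = x)
    (h2 : ψ - 2 * Real.pi * k' / m = -x) : False := by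
  have X1 := frX_qz ψ m k
  have X2 := frX_qz ψ m k'
  have Y1 := frY_qz ψ 1 m k
  have Y2 := frY_qz ψ 1 m k'
  rw [h1] at X1 Y1
  rw [h2] at X2 Y2
  rw [Real.sin_neg] at X2
  rw [Real.cos_neg] at Y2
  refine hpar _ (qz_mem hm k') _ (qz_mem hm k) ?_ (L / (2 * Real.sin x)) ?_
  · intro h
    rw [h] at X2
    linarith
  · have hc := Real.sin_sq_add_cos_sq ψ
    apply (fr ψ 1 1 (by norm_num) (by norm_num)).inj
    · show frX ψ _ = frX ψ _
      rw [map_smul, map_sub _ (qz m k), X1, X2, frX_apply, Pi.sub_apply, Pi.sub_apply, w0, w1, smul_eq_mul]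
      field_simp
      linear_combination 2 * hc
    · show frY ψ 1 _ = frY ψ 1 _
      rw [map_smul, map_sub _ (qz m k), Y1, Y2, frY_apply, Pi.sub_apply, Pi.sub_apply, w0, w1, smul_eq_mul]
      ring
    · show frZ 1 _ = frZ 1 _
      rw [map_smul, map_sub _ (qz m k), frZ_qz, frZ_qz, frZ_apply, Pi.sub_apply, w2]
      simp

theorem exists_cfg {m : ℕ} (he : Even m) (h16 : 16 ≤ m) {v1 v2 u1 u2 : Pt3} (hne : v1 ≠ v2)
    (ζ : ℝ) (hζ : ζ ^ 2 = 1) (hv : v1 2 = v2 2) (hv0 : 0 < ζ * v1 2) (hu : u1 2 = u2 2)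
    (hu0 : ζ * u1 2 < 0)
    (hcr : ∀ v, (v = v1 ∨ v = v2) → ∀ u, (u = u1 ∨ u = u2) →
      (openSegment ℝ v u ∩ convexHull ℝ (regPoly m : Set Pt3)).Nonempty)
    (hpar : ∀ a ∈ regPoly m, ∀ b ∈ regPoly m, a ≠ b → ∀ t : ℝ, v2 - v1 ≠ t • (b - a)) :
    ∃ (c : Cfg m (regPoly m) v1 v2 u1 u2) (ψ s L : ℝ), s ^ 2 = 1 ∧ 0 < L ∧
      v2 0 - v1 0 = L * Real.sin ψ ∧ v2 1 - v1 1 = - (L * Real.cos ψ) ∧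
      (∀ p, c.X p = frX ψ p) ∧ (∀ p, c.Y p = frY ψ s p) ∧ (∀ p, c.Z p = ζ * p 2) := by
  have hm : 0 < m := by omega
  have hmR : (0:ℝ) < m := by exact_mod_cast hm
  have hpi := Real.pi_pos
  obtain ⟨ψ, L, hL, w0, w1⟩ : ∃ ψ L : ℝ, 0 < L ∧ v2 0 - v1 0 = L * Real.sin ψ ∧
      v2 1 - v1 1 = - (L * Real.cos ψ) := by
    let z : ℂ := ⟨-(v2 1 - v1 1), v2 0 - v1 0⟩
    have hz : z ≠ 0 := by
      intro h
      have h1 := congrArg Complex.re h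
      have h2 := congrArg Complex.im h
      simp only [z, Complex.zero_re, Complex.zero_im] at h1 h2
      apply hne
      funext i
      fin_cases i
      · show v1 0 = v2 0
        linarith
      · show v1 1 = v2 1
        linarith
      · exact hv
    refine ⟨z.arg, ‖z‖, norm_pos_iff.2 hz, ?_, ?_⟩
    · rw [Complex.norm_mul_sin_arg]
    · rw [Complex.norm_mul_cos_arg]; simp [z]
  have hnp := no_par hm hL w0 w1 hv hpar
  -- nearest vertex
  set k0 : ℤ := round (ψ * m / (2 * Real.pi)) with hk0
  set d0 : ℝ := ψ - 2 * Real.pi * k0 / m with hd0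
  have hr := abs_sub_round (ψ * m / (2 * Real.pi))
  rw [← hk0] at hr
  have hd1 : |d0| ≤ Real.pi / m := by
    have : d0 = (2 * Real.pi / m) * (ψ * m / (2 * Real.pi) - k0) := by
      rw [hd0]; field_simp
    rw [this, abs_mul, abs_of_pos (by positivity)]
    calc _ ≤ 2 * Real.pi / m * (1 / 2) := by gcongr
      _ = _ := by ring
  have hpm : Real.pi / m < Real.pi / 2 := by
    apply div_lt_div_of_pos_left hpi (by norm_num)
    exact_mod_cast (by omega : 2 < m)
  have hpm0 : 0 < Real.pi / m := by positivity
  have n0 : d0 ≠ 0 := by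
    intro h
    apply hnp (k0 - 1) (k0 + 1) (2 * Real.pi / m)
    · apply Real.sin_pos_of_pos_of_lt_pi (by positivity)
      rw [mul_div_assoc]; linarith
    · have : ψ - 2 * Real.pi * ((k0 - 1 : ℤ) : ℝ) / m = d0 + 2 * Real.pi / m := by
        rw [hd0]; push_cast; ring
      rw [this, h, zero_add]
    · have : ψ - 2 * Real.pi * ((k0 + 1 : ℤ) : ℝ) / m = d0 - 2 * Real.pi / m := by
        rw [hd0]; push_cast; ring
      rw [this, h, zero_sub]
  have n1 : d0 ≠ Real.pi / m := by
    intro h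
    apply hnp k0 (k0 + 1) (Real.pi / m)
    · apply Real.sin_pos_of_pos_of_lt_pi (by positivity); linarith
    · exact h
    · have : ψ - 2 * Real.pi * ((k0 + 1 : ℤ) : ℝ) / m = d0 - 2 * (Real.pi / m) := by
        rw [hd0]; push_cast; ring
      rw [this, h]; ring
  have n2 : d0 ≠ - (Real.pi / m) := by
    intro h
    apply hnp (k0 - 1) k0 (Real.pi / m)
    · apply Real.sin_pos_of_pos_of_lt_pi (by positivity); linarith
    · have : ψ - 2 * Real.pi * ((k0 - 1 : ℤ) : ℝ) / m = d0 + 2 * (Real.pi / m) := by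
        rw [hd0]; push_cast; ring
      rw [this, h]; ring
    · exact h
  have hdlt : |d0| < Real.pi / m := by
    refine lt_of_le_of_ne hd1 fun h => ?_
    rcases abs_choice d0 with h' | h' <;> rw [h'] at h
    · exact n1 h
    · exact n2 (by linarith)
  have hdpos : 0 < |d0| := abs_pos.2 n0
  have core : ∃ (s : ℝ) (K e : ℤ), s ^ 2 = 1 ∧ e * e = 1 ∧
    (∀ k : ℤ, Real.sin (ψ - 2 * Real.pi * k / m) =
      Real.sin (|d0| + 2 * Real.pi * ((K + e * k : ℤ) : ℝ) / m)) ∧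
    (∀ k : ℤ, s * Real.cos (ψ - 2 * Real.pi * k / m) =
      Real.cos (|d0| + 2 * Real.pi * ((K + e * k : ℤ) : ℝ) / m)) := by
    rcases lt_or_gt_of_ne n0 with h | h
    · obtain ⟨n, hn⟩ := he
      have hnR : (m : ℝ) = n + n := by exact_mod_cast hn
      have e (k : ℤ) : |d0| + 2 * Real.pi * (((n - k0) + 1 * k : ℤ) : ℝ) / m =
          Real.pi - (ψ - 2 * Real.pi * k / m) := by
        rw [abs_of_neg h, hd0]
        push_cast
        field_simp
        rw [hnR]; ring
      refine ⟨-1, n - k0, 1, by norm_num, by norm_num, fun k => ?_, fun k => ?_⟩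
      · rw [e, Real.sin_pi_sub]
      · rw [e, Real.cos_pi_sub]; ring
    · have e (k : ℤ) : |d0| + 2 * Real.pi * ((k0 + (-1) * k : ℤ) : ℝ) / m =
          ψ - 2 * Real.pi * k / m := by
        rw [abs_of_pos h, hd0]
        push_cast
        ring
      refine ⟨1, k0, -1, by norm_num, by norm_num, fun k => ?_, fun k => ?_⟩
      · rw [e]
      · rw [e, one_mul]
  obtain ⟨s, K, e, hs, he1, hX, hY⟩ := core
  have hc := Real.sin_sq_add_cos_sq ψ
  refine ⟨{ toFrame := fr ψ s ζ hs hζ, even := he, h16 := h16, δ := |d0|, δpos := hdpos, δlt := hdlt,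
            hS := core_S hm he ψ s ζ hs hζ |d0| K e he1 hX hY, h := ζ * v1 2, k := - (ζ * u1 2),
            hpos := hv0, kpos := by linarith, zv1 := frZ_apply _ _,
            zv2 := by rw [hv]; exact frZ_apply _ _,
            zu1 := by rw [neg_neg]; exact frZ_apply _ _,
            zu2 := by rw [neg_neg, hu]; exact frZ_apply _ _,
            yv := ?_, xv := ?_, hp := ?_ }, ψ, s, L, hs, hL, w0, w1, fun _ => rfl, fun _ => rfl,
            fun p => frZ_apply _ _⟩
  · show frY ψ s v1 = frY ψ s v2
    rw [frY_apply, frY_apply]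
    linear_combination - s * Real.cos ψ * w0 - s * Real.sin ψ * w1
  · show frX ψ v1 < frX ψ v2
    rw [frX_apply, frX_apply]
    have : Real.sin ψ * v2 0 - Real.cos ψ * v2 1 - (Real.sin ψ * v1 0 - Real.cos ψ * v1 1) = L := by
      linear_combination Real.sin ψ * w0 - Real.cos ψ * w1 + L * hc
    linarith
  · intro v hv' u hu'
    obtain ⟨p, ⟨a, b, ha, hb, hab, rfl⟩, hp⟩ := hcr v hv' u hu'
    have z0 : (a • v + b • u) 2 = 0 := by
      have : convexHull ℝ (regPoly m : Set Pt3) ⊆ {p | frZ 1 p = 0} := by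
        refine convexHull_min (fun q hq => ?_) (convex_hyperplane (frZ 1).isLinear _)
        obtain ⟨k, _, rfl⟩ := mem_regPoly.1 hq
        exact frZ_qz _ _ _
      have := this hp
      rw [mem_ofPred_eq, frZ_apply, one_mul] at this
      exact this
    have zv : v 2 = v1 2 := by rcases hv' with rfl | rfl <;> simp [hv]
    have zu : u 2 = u1 2 := by rcases hu' with rfl | rfl <;> simp [hu]
    simp only [Pi.add_apply, Pi.smul_apply, smul_eq_mul, zv, zu] at z0
    have hpos : 0 < ζ * v1 2 + - (ζ * u1 2) := by linarith
    have ea : a = - (ζ * u1 2) / (ζ * v1 2 + - (ζ * u1 2)) := by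
      rw [eq_div_iff hpos.ne']
      linear_combination ζ * z0 - ζ * u1 2 * hab
    have eb : b = (ζ * v1 2) / (ζ * v1 2 + - (ζ * u1 2)) := by
      rw [eq_div_iff hpos.ne']
      linear_combination - ζ * z0 + ζ * v1 2 * hab
    rw [← ea, ← eb]
    exact hp



namespace Cfg
variable {m : ℕ} {S : Finset Pt3} {v1 v2 u1 u2 : Pt3} (c : Cfg m S v1 v2 u1 u2)
variable {T : Finset (Finset Pt3)}

theorem VV_swap : VV S v1 v2 u1 u2 = VV S u1 u2 v1 v2 := by
  ext p
  simp only [VV, Finset.mem_union, Finset.mem_insert, Finset.mem_singleton]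
  tauto

/-- a tetrahedron is not contained in a horizontal plane -/
theorem nonplanar (c : Cfg m S v1 v2 u1 u2) {σ : Finset Pt3} (h : IsTet σ) :
    ∃ p ∈ σ, c.Z p ≠ 0 := by
  by_contra hn
  push Not at hn
  have := sep_disjoint (σ := σ) (τ := σ) h
  obtain ⟨x, hx⟩ := interior_tet_nonempty h
  have hsub : convexHull ℝ (σ : Set Pt3) ⊆ {p | c.Z p = 0} :=
    convexHull_min (fun q hq => hn q hq) (convex_hyperplane c.Z.isLinear _)
  have hcont : Tendsto (fun t : ℝ => x + t • c.e) (𝓝[>] 0) (𝓝 x) := by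
    have : Continuous (fun t : ℝ => x + t • c.e) := by fun_prop
    have h2 := this.tendsto 0
    simp only [zero_smul, add_zero] at h2
    exact h2.mono_left nhdsWithin_le_nhds
  have hev := hcont.eventually (isOpen_interior.mem_nhds hx)
  obtain ⟨t, ht, ht0⟩ := (hev.and self_mem_nhdsWithin).exists
  have h1 := hsub (interior_subset ht)
  have h2 := hsub (interior_subset hx)
  simp only [mem_ofPred_eq, map_add, map_smul, smul_eq_mul, Frame.e, Frame.Z_mk, mul_one] at h1 h2
  have : (0:ℝ) < t := ht0
  linarith

theorem pp_hull (c : Cfg m S v1 v2 u1 u2) {w w' : Pt3} (hw : w ∈ convexHull ℝ ({v1, v2} : Set Pt3))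
    (hw' : w' ∈ convexHull ℝ ({u1, u2} : Set Pt3)) : c.pp w w' ∈ convexHull ℝ (S : Set Pt3) := by
  have step : ∀ u, (u = u1 ∨ u = u2) → c.pp w u ∈ convexHull ℝ (S : Set Pt3) := by
    intro u hu
    have : convexHull ℝ ({v1, v2} : Set Pt3) ⊆ {w | c.pp w u ∈ convexHull ℝ (S : Set Pt3)} := by
      refine convexHull_min (fun q hq => c.pp_conv hq hu) ?_
      intro x hx y hy a b ha hb hab
      have := convex_convexHull ℝ (S : Set Pt3) hx hy ha hb hab
      have e : a • c.pp x u + b • c.pp y u = c.pp (a • x + b • y) u := by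
        have : b = 1 - a := by linarith
        subst this
        unfold pp; module
      rw [e] at this
      exact this
    exact this hw
  have : convexHull ℝ ({u1, u2} : Set Pt3) ⊆ {w' | c.pp w w' ∈ convexHull ℝ (S : Set Pt3)} := by
    refine convexHull_min (fun q hq => step q hq) ?_
    intro x hx y hy a b ha hb hab
    have := convex_convexHull ℝ (S : Set Pt3) hx hy ha hb hab
    have e : a • c.pp w x + b • c.pp w y = c.pp w (a • x + b • y) := by
      have : b = 1 - a := by linarith
      subst this
      unfold pp; module
    rw [e] at this
    exact this
  exact this hw'

theorem conv_three {K : Set Pt3} (hK : Convex ℝ K) {x y z : Pt3} (hx : x ∈ K) (hy : y ∈ K)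
    (hz : z ∈ K) {a b d : ℝ} (ha : 0 ≤ a) (hb : 0 ≤ b) (hd : 0 ≤ d) (h : a + b + d = 1) :
    a • x + b • y + d • z ∈ K := by
  have := hK.sum_mem (t := Finset.univ) (w := ![a, b, d]) (z := ![x, y, z]) (by
    intro i _; fin_cases i <;> simpa) (by simp [Fin.sum_univ_three, h]) (by
    intro i _; fin_cases i <;> simpa)
  simpa [Fin.sum_univ_three] using this

theorem hull_split (c : Cfg m S v1 v2 u1 u2) :
    convexHull ℝ ((VV S v1 v2 u1 u2 : Finset Pt3) : Set Pt3) ⊆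
      convexHull ℝ ((S ∪ {v1, v2} : Finset Pt3) : Set Pt3) ∪
      convexHull ℝ ((S ∪ {u1, u2} : Finset Pt3) : Set Pt3) := by
  intro x hx
  have hh := c.hpos
  have hk := c.kpos
  have hSne : (S : Set Pt3).Nonempty := ⟨_, c.P_mem (i := 0) (by have := c.h16; omega)⟩
  have e : ((VV S v1 v2 u1 u2 : Finset Pt3) : Set Pt3) = (S : Set Pt3) ∪ ({v1, v2} ∪ {u1, u2}) := by
    ext p
    simp only [VV, Finset.coe_union, Finset.coe_insert, Finset.coe_singleton, Set.mem_union,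
      Set.mem_insert_iff, Set.mem_singleton_iff]
    tauto
  rw [e, convexHull_union hSne (by simp), convexHull_union (by simp) (by simp)] at hx
  obtain ⟨s, hs, y, hy, hx⟩ := mem_convexJoin.1 hx
  obtain ⟨w, hw, w', hw', hy⟩ := mem_convexJoin.1 hy
  obtain ⟨a, b, ha, hb, hab, rfl⟩ := hx
  obtain ⟨a', b', ha', hb', hab', rfl⟩ := hy
  have hp := c.pp_hull hw hw'
  have i1 : convexHull ℝ (S : Set Pt3) ⊆ convexHull ℝ ((S ∪ {v1, v2} : Finset Pt3) : Set Pt3) :=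
    convexHull_mono (by
      intro p hp
      simp only [Finset.coe_union, Finset.coe_insert, Finset.coe_singleton, Set.mem_union,
        Set.mem_insert_iff, Set.mem_singleton_iff] at hp ⊢
      tauto)
  have i2 : convexHull ℝ (S : Set Pt3) ⊆ convexHull ℝ ((S ∪ {u1, u2} : Finset Pt3) : Set Pt3) :=
    convexHull_mono (by
      intro p hp
      simp only [Finset.coe_union, Finset.coe_insert, Finset.coe_singleton, Set.mem_union,
        Set.mem_insert_iff, Set.mem_singleton_iff] at hp ⊢
      tauto)
  have i3 : convexHull ℝ ({v1, v2} : Set Pt3) ⊆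
      convexHull ℝ ((S ∪ {v1, v2} : Finset Pt3) : Set Pt3) := convexHull_mono (by
      intro p hp
      simp only [Finset.coe_union, Finset.coe_insert, Finset.coe_singleton, Set.mem_union,
        Set.mem_insert_iff, Set.mem_singleton_iff] at hp ⊢
      tauto)
  have i4 : convexHull ℝ ({u1, u2} : Set Pt3) ⊆
      convexHull ℝ ((S ∪ {u1, u2} : Finset Pt3) : Set Pt3) := convexHull_mono (by
      intro p hp
      simp only [Finset.coe_union, Finset.coe_insert, Finset.coe_singleton, Set.mem_union,
        Set.mem_insert_iff, Set.mem_singleton_iff] at hp ⊢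
      tauto)
  have hhk : c.h + c.k ≠ 0 := by positivity
  rcases le_total (b' * c.k) (a' * c.h) with h | h
  · left
    have e1 : a • s + b • (a' • w + b' • w') = a • s + (b * (a' - b' * c.k / c.h)) • w +
        (b * (b' * (c.h + c.k) / c.h)) • c.pp w w' := by
      unfold pp
      match_scalars <;> field_simp <;> ring
    rw [e1]
    refine conv_three (convex_convexHull ℝ _) (i1 hs) (i3 hw) (i1 hp) ha ?_ (by positivity) ?_
    · apply mul_nonneg hb
      rw [sub_nonneg, div_le_iff₀ hh]; exact h
    · field_simp
      linear_combination c.h * hab + b * c.h * hab'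
  · right
    have e1 : a • s + b • (a' • w + b' • w') = a • s + (b * (b' - a' * c.h / c.k)) • w' +
        (b * (a' * (c.h + c.k) / c.k)) • c.pp w w' := by
      unfold pp
      match_scalars <;> field_simp <;> ring
    rw [e1]
    refine conv_three (convex_convexHull ℝ _) (i2 hs) (i4 hw') (i2 hp) ha ?_ (by positivity) ?_
    · apply mul_nonneg hb
      rw [sub_nonneg, div_le_iff₀ hk]; exact h
    · field_simp
      linear_combination c.k * hab + b * c.k * hab'

theorem dissect (c : Cfg m S v1 v2 u1 u2) (c' : Cfg m S u1 u2 v1 v2) :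
    ∃ D, D.card = 4 * m - 6 ∧ IsDissection (VV S v1 v2 u1 u2) D := by
  have hm := c.h16
  obtain ⟨D1, n1, t1, d1, cov1⟩ := c.upper
  obtain ⟨D2, n2, t2, d2, cov2⟩ := c'.upper
  have z1 : ∀ σ ∈ D1, ∀ p ∈ σ, 0 ≤ c.Z p := by
    intro σ hσ p hp
    have := (t1 σ hσ).2 hp
    simp only [Finset.mem_union, Finset.mem_insert, Finset.mem_singleton] at this
    rcases this with h | h
    · rw [c.S_Z h]
    · rw [c.zv h]; exact c.hpos.le
  have z2 : ∀ σ ∈ D2, ∀ p ∈ σ, c.Z p ≤ 0 := by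
    intro σ hσ p hp
    have := (t2 σ hσ).2 hp
    simp only [Finset.mem_union, Finset.mem_insert, Finset.mem_singleton] at this
    rcases this with h | h
    · rw [c.S_Z h]
    · rw [c.zu h]; linarith [c.kpos]
  have d21 : ∀ σ ∈ D2, ∀ τ ∈ D1, Dj σ τ := by
    intro σ hσ τ hτ
    refine sep_disjoint (t2 σ hσ).1 c.Z 0 (z2 σ hσ) ?_ (z1 τ hτ)
    obtain ⟨p, hp, h⟩ := c.nonplanar (t2 σ hσ).1
    exact ⟨p, hp, lt_of_le_of_ne (z2 σ hσ p hp) h⟩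
  refine ⟨D1 ∪ D2, ?_, ?_, ?_, ?_⟩
  · rw [Finset.card_union_of_disjoint, n1, n2]
    · omega
    · rw [Finset.disjoint_left]
      intro σ h1 h2
      have h := d21 σ h2 σ h1
      unfold Dj at h
      rw [Set.inter_self] at h
      have := interior_tet_nonempty (t1 σ h1).1
      rw [h] at this
      exact Set.not_nonempty_empty this
  · intro σ hσ
    rcases Finset.mem_union.1 hσ with h | h
    · refine ⟨(t1 σ h).1, fun p hp => ?_⟩
      have := (t1 σ h).2 hp
      simp only [Finset.mem_union, Finset.mem_insert, Finset.mem_singleton, VV, Finset.mem_coe] at this ⊢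
      tauto
    · refine ⟨(t2 σ h).1, fun p hp => ?_⟩
      have := (t2 σ h).2 hp
      simp only [Finset.mem_union, Finset.mem_insert, Finset.mem_singleton, VV, Finset.mem_coe] at this ⊢
      tauto
  · intro σ hσ τ hτ hne
    rcases Finset.mem_union.1 hσ with h | h <;> rcases Finset.mem_union.1 hτ with h' | h'
    · exact d1 σ h τ h' hne
    · exact (d21 τ h' σ h).symm
    · exact d21 σ h τ h'
    · exact d2 σ h τ h' hne
  · apply Set.Subset.antisymm
    · intro x hx
      simp only [Set.mem_iUnion] at hx
      obtain ⟨σ, hσ, hx⟩ := hx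
      refine convexHull_mono ?_ hx
      intro p hp
      rcases Finset.mem_union.1 hσ with h | h
      · have := (t1 σ h).2 hp
        simp only [Finset.mem_union, Finset.mem_insert, Finset.mem_singleton, VV, Finset.mem_coe] at this ⊢
        tauto
      · have := (t2 σ h).2 hp
        simp only [Finset.mem_union, Finset.mem_insert, Finset.mem_singleton, VV, Finset.mem_coe] at this ⊢
        tauto
    · intro x hx
      rcases c.hull_split hx with h | h
      · have := cov1 h
        simp only [Set.mem_iUnion] at this ⊢
        obtain ⟨σ, hσ, h⟩ := this
        exact ⟨σ, Finset.mem_union_left _ hσ, h⟩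
      · have := cov2 h
        simp only [Set.mem_iUnion] at this ⊢
        obtain ⟨σ, hσ, h⟩ := this
        exact ⟨σ, Finset.mem_union_right _ hσ, h⟩

theorem total (c : Cfg m S v1 v2 u1 u2) (hT : IsTriangulation (VV S v1 v2 u1 u2) T) :
    T.card ≤ (T.filter fun σ => IsA v1 v2 u1 u2 σ ∨ IsM v1 v2 u1 u2 σ).card +
      (T.filter (IsL v1 v2 u1 u2)).card + (T.filter (IsA u1 u2 v1 v2)).card +
      (T.filter (IsL u1 u2 v1 v2)).card := by
  have : T ⊆ ((T.filter fun σ => IsA v1 v2 u1 u2 σ ∨ IsM v1 v2 u1 u2 σ) ∪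
      T.filter (IsL v1 v2 u1 u2)) ∪ T.filter (IsA u1 u2 v1 v2) ∪ T.filter (IsL u1 u2 v1 v2) := by
    intro σ hσ
    have : v1 ∈ σ ∨ v2 ∈ σ ∨ u1 ∈ σ ∨ u2 ∈ σ := by
      obtain ⟨p, hp, h⟩ := c.nonplanar (hT.1.1 σ hσ).1
      rcases mem_cases hT hσ hp with h' | (rfl | rfl) | (rfl | rfl)
      · exact absurd (c.S_Z h') h
      · tauto
      · tauto
      · tauto
      · tauto
    simp only [Finset.mem_union, Finset.mem_filter, hσ, true_and]
    unfold IsA IsL IsM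
    clear hσ hT c
    by_cases a1 : v1 ∈ σ <;> by_cases a2 : v2 ∈ σ <;> by_cases a3 : u1 ∈ σ <;>
      by_cases a4 : u2 ∈ σ <;> simp [a1, a2, a3, a4] at this ⊢
  refine (Finset.card_le_card this).trans ?_
  refine (Finset.card_union_le _ _).trans (Nat.add_le_add_right ?_ _)
  refine (Finset.card_union_le _ _).trans (Nat.add_le_add_right ?_ _)
  exact Finset.card_union_le _ _

theorem prs_le : (prs v1 v2 u1 u2 T).card ≤ 4 := by
  refine (Finset.card_filter_le _ _).trans ?_
  rw [Finset.card_product]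
  have := Finset.card_le_two (a := v1) (b := v2)
  have := Finset.card_le_two (a := u1) (b := u2)
  nlinarith

theorem prs_four (h : 4 ≤ (prs v1 v2 u1 u2 T).card) {v u : Pt3} (hv : v = v1 ∨ v = v2)
    (hu : u = u1 ∨ u = u2) : ∃ σ ∈ T, v ∈ σ ∧ u ∈ σ := by
  have h2 : prs v1 v2 u1 u2 T = ({v1, v2} : Finset Pt3) ×ˢ ({u1, u2} : Finset Pt3) := by
    apply Finset.eq_of_subset_of_card_le (Finset.filter_subset _ _)
    refine le_trans ?_ h
    rw [Finset.card_product]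
    have := Finset.card_le_two (a := v1) (b := v2)
    have := Finset.card_le_two (a := u1) (b := u2)
    nlinarith
  have : (v, u) ∈ prs v1 v2 u1 u2 T := by
    rw [h2]; simp [hv, hu]
  exact (mem_prs.1 this).2

set_option maxHeartbeats 2000000 in
theorem tri_bound (c : Cfg m S v1 v2 u1 u2) (c' : Cfg m S u1 u2 v1 v2)
    (hT : IsTriangulation (VV S v1 v2 u1 u2) T) (hsh : (c.AA T).card + (c'.AA T).card ≤ m + 1) :
    2 * T.card ≤ 7 * m + 2 := by
  have hT' : IsTriangulation (VV S u1 u2 v1 v2) T := by rw [← VV_swap]; exact hT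
  have hm := c.h16
  obtain ⟨n, hn⟩ := c.even
  have b1 := c.bound1 hT
  have b1' := c'.bound1 hT'
  have b2 := c.bound2 hT
  have b2' := c'.bound2 hT'
  have r := prs_le (v1 := v1) (v2 := v2) (u1 := u1) (u2 := u2) (T := T)
  have r' := prs_le (v1 := u1) (v2 := u2) (u1 := v1) (u2 := v2) (T := T)
  have t := c.total hT
  have t' := c'.total hT'
  have l0 := c.cnt0 hT
  have l0' := c'.cnt0 hT'
  rcases lt_or_ge (prs v1 v2 u1 u2 T).card 4 with h4 | h4
  · omega
  have pf := fun {v u : Pt3} => prs_four h4 (v := v) (u := u)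
  by_cases hv : ∃ σ ∈ T, v1 ∈ σ ∧ v2 ∈ σ ∧ (u1 ∈ σ ∨ u2 ∈ σ)
  swap
  · have := c.bound4 hT (fun σ hσ hM hb => hv ⟨σ, hσ, hb.1, hb.2, hM.2⟩)
      (pf (.inl rfl) (.inl rfl)) (pf (.inr rfl) (.inl rfl))
    omega
  by_cases hu : ∃ σ ∈ T, u1 ∈ σ ∧ u2 ∈ σ ∧ (v1 ∈ σ ∨ v2 ∈ σ)
  swap
  · have := c'.bound4 hT' (fun σ hσ hM hb => hu ⟨σ, hσ, hb.1, hb.2, hM.2⟩)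
      (by obtain ⟨σ, h1, h2, h3⟩ := pf (.inl rfl) (.inl rfl); exact ⟨σ, h1, h3, h2⟩)
      (by obtain ⟨σ, h1, h2, h3⟩ := pf (.inl rfl) (.inr rfl); exact ⟨σ, h1, h3, h2⟩)
    omega
  have l1 := c.cnt1 hT hv
  have l1' := c'.cnt1 hT' hu
  by_cases hq : ∃ σ ∈ T, IsM v1 v2 u1 u2 σ ∧ ∃ q ∈ S, q ∈ σ
  · obtain ⟨σ, hσ, hM, q, hqS, hqσ⟩ := hq
    have := c'.bound3 hT' hσ ⟨hM.2, hM.1⟩ hqS hqσ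
    omega
  · have hone : (T.filter (IsM v1 v2 u1 u2)).card ≤ 1 := by
      refine le_trans (Finset.card_le_card (t := {({v1, v2, u1, u2} : Finset Pt3)}) ?_) (by simp)
      intro σ hσ
      obtain ⟨hσ, hM⟩ := Finset.mem_filter.1 hσ
      rw [Finset.mem_singleton]
      apply Finset.eq_of_subset_of_card_le
      · intro p hp
        rcases mem_cases hT hσ hp with h | h | h
        · exact absurd ⟨σ, hσ, hM, p, h, hp⟩ hq
        · rcases h with h | h <;> simp [h]
        · rcases h with h | h <;> simp [h]
      · rw [(hT.1.1 σ hσ).1.1]; exact Finset.card_le_four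
    have hor : (T.filter fun σ => IsA v1 v2 u1 u2 σ ∨ IsM v1 v2 u1 u2 σ).card ≤
        (T.filter (IsA v1 v2 u1 u2)).card + (T.filter (IsM v1 v2 u1 u2)).card := by
      rw [Finset.filter_or]; exact Finset.card_union_le _ _
    omega

end Cfg

theorem Pm_dissection_beats_triangulations (m : ℕ) (hm : 14 < m)
    (v₁ v₂ u₁ u₂ : Pt3) (h : PmSetup m v₁ v₂ u₁ u₂) :
    ∃ D, IsDissection (regPoly m ∪ {v₁, v₂, u₁, u₂}) D ∧
      ∀ T, IsTriangulation (regPoly m ∪ {v₁, v₂, u₁, u₂}) T →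
        T.card < D.card ∧ T.card + m / 2 ≤ D.card + 7 := by
  obtain ⟨he, -, hv, hu, zv, zv0, zu, zu0, hor, hcr, hpar⟩ := h
  have h16 : 16 ≤ m := by obtain ⟨n, hn⟩ := he; omega
  obtain ⟨c, ψ, s, L, hs, hL, w0, w1, cX, cY, cZ⟩ := exists_cfg he h16 (u1 := u₁) (u2 := u₂) hv 1
    (by norm_num) zv (by linarith) zu (by linarith)
    (fun v hv u hu => (hcr v hv u hu).mono
      (Set.inter_subset_inter_right _ intrinsicInterior_subset))
    (fun a ha b hb hab t => (hpar a ha b hb hab t).1)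
  obtain ⟨c', ψ', s', L', hs', hL', w0', w1', cX', cY', cZ'⟩ :=
    exists_cfg he h16 (u1 := v₁) (u2 := v₂) hu (-1)
    (by norm_num) zu (by linarith) zv (by linarith)
    (fun u hu v hv => by
      rw [openSegment_symm]
      exact (hcr v hv u hu).mono (Set.inter_subset_inter_right _ intrinsicInterior_subset))
    (fun a ha b hb hab t => (hpar a ha b hb hab t).2)
  rw [w0, w1, w0', w1'] at hor
  have hor' : Real.sin ψ * Real.sin ψ' + Real.cos ψ * Real.cos ψ' = 0 := by
    have : (L * L') * (Real.sin ψ * Real.sin ψ' + Real.cos ψ * Real.cos ψ') = 0 := by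
      linear_combination hor
    rcases mul_eq_zero.1 this with h | h
    · exact absurd h (by positivity)
    · exact h
  have hc := Real.sin_sq_add_cos_sq ψ
  have hc' := Real.sin_sq_add_cos_sq ψ'
  set η := Real.sin ψ' * Real.cos ψ - Real.cos ψ' * Real.sin ψ with hη
  have hη2 : η ^ 2 = 1 := by
    rw [hη]
    linear_combination hc' * (Real.sin ψ ^ 2 + Real.cos ψ ^ 2) + hc -
      (Real.sin ψ * Real.sin ψ' + Real.cos ψ * Real.cos ψ') * hor'
  obtain ⟨D, hD, hdis⟩ := c.dissect c'
  refine ⟨D, hdis, fun T hT => ?_⟩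
  have f1 : Real.cos ψ = η * Real.sin ψ' := by
    rw [hη]
    linear_combination - Real.cos ψ * hc' + Real.cos ψ' * hor'
  have f2 : Real.sin ψ = - (η * Real.cos ψ') := by
    rw [hη]
    linear_combination - Real.sin ψ * hc' + Real.sin ψ' * hor'
  have hsh := c.short c' hT (s * η) (by
    have h1 : (s * η - 1) * (s * η + 1) = 0 := by linear_combination s ^ 2 * hη2 + hs
    rcases mul_eq_zero.1 h1 with h | h
    · left; linarith
    · right; linarith) (by
    intro p
    rw [cY, cX', frY_apply, frX_apply, f1, f2]
    ring)
  have := c.tri_bound c' hT hsh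
  obtain ⟨n, hn⟩ := he
  omega
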